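/- Let pᵢ denote the i-th prime greater than 3 (so p₁ = 5, p₂ = 7, …), let k ≥ 4 be an integer, and set m = p₁p₂⋯p_k. Let F(x,y) be a maximal primitive irreducible integral binary cubic form whose splitting field has Galois group S₃, with |disc(F)| > m²⁰·(3.5)³⁰·3¹⁵, such that: F(x,1) is irreducible modulo 3; F does not split completely modulo 2; F splits completely modulo each of p₁, …, p_k; and for every prime p > p_k with p ≡ 1 (mod 3), the reduction of F modulo p is not of the form c·L(x,y)³ for any linear form L and constant c over 𝔽_p. Then there exist 3^k pairwise GL₂(ℤ)-inequivalent irreducible maximal integral binary cubic forms G₁, …, G_{3^k}, each with disc(Gⱼ) = disc(F)·m², such that at least 3^k − 34 of the Gⱼ satisfy all of the following: (i) Gⱼ locally represents 1 everywhere; (ii) Gⱼ(x,y) = 1 has no solution (x,y) ∈ ℤ²; and (iii) Gⱼ is maximal. -/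

import Mathlib

open Finset

/-- Evaluation of the binary form of degree `n` with coefficient vector `c` at `(x, y)`:
`c 0 * x^n + c 1 * x^(n-1) * y + ⋯ + c n * y^n`. -/
def binEval {n : ℕ} {R : Type*} [CommRing R] (c : Fin (n + 1) → R) (x y : R) : R :=
  ∑ i : Fin (n + 1), c i * x ^ (n - (i : ℕ)) * y ^ (i : ℕ)

/-- The binary form with coefficient vector `c` as an element of `MvPolynomial (Fin 2) R`. -/
noncomputable def formPolyR {n : ℕ} {R : Type*} [CommRing R] (c : Fin (n + 1) → R) :
    MvPolynomial (Fin 2) R :=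
  ∑ i : Fin (n + 1), MvPolynomial.C (c i) * MvPolynomial.X 0 ^ (n - (i : ℕ)) *
    MvPolynomial.X 1 ^ (i : ℕ)

/-- The binary form with integer coefficient vector `c`, base-changed to `R`. -/
noncomputable def formPoly {n : ℕ} (R : Type*) [CommRing R] (c : Fin (n + 1) → ℤ) :
    MvPolynomial (Fin 2) R :=
  formPolyR (fun i => ((c i : R)))

/-- `F(X, 1)` over `R`, for the binary form with integer coefficient vector `c`. -/
noncomputable def formPolyX {n : ℕ} (R : Type*) [CommRing R] (c : Fin (n + 1) → ℤ) :
    Polynomial R :=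
  ∑ i : Fin (n + 1), Polynomial.C ((c i : R)) * Polynomial.X ^ (n - (i : ℕ))

/-- `IsDisc c D`: the binary form with coefficient vector `c` factors over `ℂ` as
`∏ (αᵢ x - βᵢ y)` and `D = ∏_{i<j} (αᵢ βⱼ - αⱼ βᵢ)²` is its discriminant. -/
def IsDisc {n : ℕ} (c : Fin (n + 1) → ℤ) (D : ℤ) : Prop :=
  ∃ α β : Fin n → ℂ,
    (∀ x y : ℂ, binEval (fun i => ((c i : ℂ))) x y = ∏ i : Fin n, (α i * x - β i * y)) ∧
    (D : ℂ) = ∏ i : Fin n, ∏ j ∈ Finset.univ.filter (fun j => i < j),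
      (α i * β j - α j * β i) ^ 2

/-- `G` is a maximal form: it is not a proper subform of any integral binary form. -/
def IsMaximalForm {n : ℕ} (G : Fin (n + 1) → ℤ) : Prop :=
  ¬ ∃ (F : Fin (n + 1) → ℤ) (a b c d : ℤ), 1 < |a * d - b * c| ∧
      ∀ x y : ℤ, binEval G x y = binEval F (a * x + b * y) (c * x + d * y)

/-- `GL₂(ℤ)`-equivalence of integral binary forms. -/
def FormEquiv {n : ℕ} (F G : Fin (n + 1) → ℤ) : Prop :=
  ∃ a b c d : ℤ, |a * d - b * c| = 1 ∧
    ∀ x y : ℤ, binEval G x y = binEval F (a * x + b * y) (c * x + d * y)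

/-- The form locally represents `h` everywhere: over `ℝ` and over `ℤ_p` for all primes `p`. -/
def LocallyRep {n : ℕ} (c : Fin (n + 1) → ℤ) (h : ℤ) : Prop :=
  (∃ x y : ℝ, binEval (fun i => ((c i : ℝ))) x y = (h : ℝ)) ∧
  ∀ (p : ℕ) (hp : p.Prime),
    haveI : Fact p.Prime := ⟨hp⟩
    ∃ x y : ℤ_[p], binEval (fun i => ((c i : ℤ_[p]))) x y = (h : ℤ_[p])

/-- The integral binary form is primitive: the gcd of its coefficients is 1. -/
def IsPrimitiveForm {n : ℕ} (c : Fin (n + 1) → ℤ) : Prop :=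
  ∀ d : ℤ, (∀ i, d ∣ c i) → IsUnit d

/-- The form splits completely modulo `p`: modulo `p` it is a product of pairwise
non-proportional linear forms over `ℤ/pℤ`. -/
def SplitsCompletelyMod (p : ℕ) {n : ℕ} (c : Fin (n + 1) → ℤ) : Prop :=
  ∃ L : Fin n → ZMod p × ZMod p,
    (∀ i j, i ≠ j → (L i).1 * (L j).2 ≠ (L j).1 * (L i).2) ∧
    formPoly (ZMod p) c =
      ∏ i : Fin n, (MvPolynomial.C (L i).1 * MvPolynomial.X 0 +
        MvPolynomial.C (L i).2 * MvPolynomial.X 1)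

theorem factorial_dvd_three_pow_mul_prod (n : ℤ) (j : ℕ) :
    (j.factorial : ℤ) ∣ 3 ^ j * ∏ i ∈ range j, (n - 3 * (i : ℤ)) := by
  obtain ⟨e, N, hN, hj⟩ := Nat.exists_eq_pow_mul_and_not_dvd (Nat.factorial_ne_zero j) 3 (by norm_num)
  have he : e ≤ j := by
    have : Fact (Nat.Prime 3) := ⟨Nat.prime_three⟩
    have h1 := sub_one_mul_padicValNat_factorial (p := 3) j
    have h2 : padicValNat 3 j.factorial = e := by
      rw [hj, padicValNat.mul (by positivity) (by rintro rfl; simp at hN)]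
      simp [padicValNat.eq_zero_of_not_dvd hN]
    omega
  have hcop : IsCoprime (3 : ℤ) (N : ℤ) := by
    have := (Nat.Prime.coprime_iff_not_dvd Nat.prime_three).2 hN
    exact_mod_cast Nat.isCoprime_iff_coprime.2 this
  have hNd : (N : ℤ) ∣ ∏ i ∈ range j, (n - 3 * (i : ℤ)) := by
    obtain ⟨a, b, hab⟩ := hcop
    have h1 : (j.factorial : ℤ) ∣ ∏ i ∈ range j, (-(a * n) + (i : ℤ)) :=
      Nat.factorial_coe_dvd_prod j _
    have h2 : (N : ℤ) ∣ ∏ i ∈ range j, (-(a * n) + (i : ℤ)) :=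
      dvd_trans ⟨(3 : ℤ) ^ e, by rw [hj]; push_cast; ring⟩ h1
    rw [← ZMod.intCast_zmod_eq_zero_iff_dvd] at h2 ⊢
    have h3 : (a : ZMod N) * 3 = 1 := by
      have := congrArg (Int.cast : ℤ → ZMod N) hab
      push_cast at this
      simpa using this
    have h4 : ((∏ i ∈ range j, (n - 3 * (i : ℤ)) : ℤ) : ZMod N)
        = (-3) ^ j * ((∏ i ∈ range j, (-(a * n) + (i : ℤ)) : ℤ) : ZMod N) := by
      push_cast
      rw [← Finset.card_range j, ← Finset.prod_const, card_range, ← Finset.prod_mul_distrib]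
      refine Finset.prod_congr rfl fun i _ => ?_
      linear_combination (-(n : ZMod N)) * h3
    rw [h4, h2, mul_zero]
  rw [hj]
  push_cast
  exact mul_dvd_mul (pow_dvd_pow _ he) hNd

/-- The integer `9 ^ j * binom (n / 3) j`. -/
def thirdChoose (n : ℤ) (j : ℕ) : ℤ :=
  (3 ^ j * ∏ i ∈ range j, (n - 3 * (i : ℤ))) / (j.factorial : ℤ)

theorem thirdChoose_mul_factorial (n : ℤ) (j : ℕ) :
    thirdChoose n j * j.factorial = 3 ^ j * ∏ i ∈ range j, (n - 3 * (i : ℤ)) :=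
  Int.ediv_mul_cancel (factorial_dvd_three_pow_mul_prod n j)

theorem thirdChoose_succ (n : ℤ) (j : ℕ) :
    thirdChoose n (j + 1) * (j + 1) = thirdChoose n j * (3 * (n - 3 * j)) := by
  have h1 := thirdChoose_mul_factorial n j
  have h2 := thirdChoose_mul_factorial n (j + 1)
  rw [Finset.prod_range_succ, Nat.factorial_succ] at h2
  push_cast at h2
  have h3 : (j.factorial : ℤ) ≠ 0 := by positivity
  apply mul_right_cancel₀ h3
  linear_combination h2 - (3 * (n - 3 * j)) * h1

theorem thirdChoose_bounds (r j : ℕ) (n : ℤ) (hn : n = 3 * r + 1 ∨ n = 3 * r - 1) (hj : j ≤ r) :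
    0 < thirdChoose n j ∧ thirdChoose n j ≤ 9 ^ j * 2 ^ (r + 1) := by
  have h1 := thirdChoose_mul_factorial n j
  have hf : (0 : ℤ) < j.factorial := by positivity
  have hpos : ∀ i ∈ range j, 0 < n - 3 * (i : ℤ) ∧ n - 3 * (i : ℤ) ≤ 3 * ((r + 1 - i : ℕ) : ℤ) := by
    intro i hi
    have := mem_range.1 hi
    rw [Nat.cast_sub (by omega)]
    push_cast
    constructor <;> omega
  have hP : 0 < ∏ i ∈ range j, (n - 3 * (i : ℤ)) := prod_pos fun i hi => (hpos i hi).1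
  have hQ : ∏ i ∈ range j, (n - 3 * (i : ℤ)) ≤ 3 ^ j * ((r + 1).choose j * j.factorial : ℕ) := by
    calc ∏ i ∈ range j, (n - 3 * (i : ℤ)) ≤ ∏ i ∈ range j, (3 * ((r + 1 - i : ℕ) : ℤ)) :=
          prod_le_prod (fun i hi => (hpos i hi).1.le) fun i hi => (hpos i hi).2
      _ = _ := by
          rw [prod_mul_distrib, prod_const, card_range, mul_comm ((r + 1).choose j),
            ← Nat.descFactorial_eq_factorial_mul_choose, Nat.descFactorial_eq_prod_range]
          push_cast
          rfl
  have hc : (((r + 1).choose j : ℕ) : ℤ) ≤ 2 ^ (r + 1) := by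
    exact_mod_cast Nat.choose_le_two_pow _ _
  constructor
  · by_contra h
    push Not at h
    have : thirdChoose n j * j.factorial ≤ 0 := mul_nonpos_of_nonpos_of_nonneg h hf.le
    have : 0 < 3 ^ j * ∏ i ∈ range j, (n - 3 * (i : ℤ)) := by positivity
    omega
  · apply le_of_mul_le_mul_right _ hf
    rw [h1]
    calc 3 ^ j * ∏ i ∈ range j, (n - 3 * (i : ℤ))
        ≤ 3 ^ j * (3 ^ j * ((r + 1).choose j * j.factorial : ℕ)) := by gcongr
      _ = 9 ^ j * ((r + 1).choose j : ℕ) * j.factorial := by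
          push_cast
          rw [show (9 : ℤ) = 3 * 3 by norm_num, mul_pow]; ring
      _ ≤ _ := by gcongr

/-- Coefficients of the diagonal Padé approximants to the cube root, scaled to be integers. -/
def padeCoeff (r j : ℕ) : ℤ :=
  thirdChoose (3 * r + 1) j * thirdChoose (3 * r - 1) (r - j)

theorem padeCoeff_pos {r j : ℕ} (hj : j ≤ r) : 0 < padeCoeff r j :=
  mul_pos (thirdChoose_bounds r j _ (.inl rfl) hj).1
    (thirdChoose_bounds r (r - j) _ (.inr rfl) (Nat.sub_le _ _)).1

theorem padeCoeff_le {r j : ℕ} (hj : j ≤ r) : padeCoeff r j ≤ 4 * 36 ^ r := by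
  have h1 := thirdChoose_bounds r j _ (.inl rfl) hj
  have h2 := thirdChoose_bounds r (r - j) _ (.inr rfl) (Nat.sub_le _ _)
  calc padeCoeff r j ≤ (9 ^ j * 2 ^ (r + 1)) * (9 ^ (r - j) * 2 ^ (r + 1)) :=
        mul_le_mul h1.2 h2.2 h2.1.le (by positivity)
    _ = (9 ^ (j + (r - j))) * (2 ^ (r + 1) * 2 ^ (r + 1)) := by rw [pow_add]; ring
    _ = 4 * 36 ^ r := by
        rw [Nat.add_sub_cancel' hj, ← mul_pow, pow_succ,
          show (36 : ℤ) = 9 * (2 * 2) by norm_num]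
        simp only [mul_pow]
        ring

theorem padeCoeff_succ {r j : ℕ} (hj : j < r) :
    ((3 * (j : ℤ) + 3) * (3 * j + 2)) * padeCoeff r (j + 1) =
      ((3 * (r : ℤ) - 3 * j) * (3 * r + 1 - 3 * j)) * padeCoeff r j := by
  have h1 := thirdChoose_succ (3 * r + 1) j
  have h2 := thirdChoose_succ (3 * r - 1) (r - j - 1)
  have h3 : r - j - 1 + 1 = r - j := by omega
  have h4 : ((r - j - 1 : ℕ) : ℤ) = r - j - 1 := by omega
  rw [h3, h4] at h2
  unfold padeCoeff
  rw [show r - (j + 1) = r - j - 1 by omega]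
  linear_combination (3 * (3 * j + 2) * thirdChoose (3 * r - 1) (r - j - 1)) * h1 -
    (3 * (3 * r + 1 - 3 * j) * thirdChoose (3 * r + 1) j) * h2

open Polynomial in
/-- The polynomial `A(X³) - X B(X³)` attached to the Padé approximant `A / B`. -/
noncomputable def padePoly (r : ℕ) : ℤ[X] :=
  ∑ j ∈ range (r + 1), C (padeCoeff r j) * (X ^ (3 * j) - X ^ (3 * r + 1 - 3 * j))

open Polynomial in
theorem padePoly_ode (r : ℕ) :
    (1 - X ^ 3) * derivative (derivative (padePoly r)) + C (6 * (r : ℤ)) * X ^ 2 *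
      derivative (padePoly r) - C (3 * (r : ℤ) * (3 * r + 1)) * X * padePoly r = 0 := by
  have key : ∀ n : ℕ, (1 - X ^ 3) * derivative (derivative (X ^ n : ℤ[X])) +
      C (6 * (r : ℤ)) * X ^ 2 * derivative (X ^ n : ℤ[X]) -
      C (3 * (r : ℤ) * (3 * r + 1)) * X * X ^ n =
      C ((n : ℤ) * (n - 1)) * X ^ (n - 2) -
        C (((n : ℤ) - 3 * r) * (n - 3 * r - 1)) * X ^ (n + 1) := by
    intro n
    rcases n with _ | _ | n
    · simp; ring
    · simp; ring
    · simp
      ring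
  let g : ℕ → ℤ[X] := fun j => Nat.casesOn j 0 fun j =>
    C (padeCoeff r j * ((3 * (r : ℤ) - 3 * j) * (3 * r + 1 - 3 * j))) * X ^ (3 * j + 1)
  let h : ℕ → ℤ[X] := fun j => Nat.casesOn j 0 fun j =>
    C (padeCoeff r j * ((3 * (r : ℤ) - 3 * j) * (3 * r + 1 - 3 * j))) * X ^ (3 * r - 1 - 3 * j)
  have hterm : ∀ j ∈ range (r + 1),
      (1 - X ^ 3) * derivative (derivative
        (C (padeCoeff r j) * (X ^ (3 * j) - X ^ (3 * r + 1 - 3 * j)))) +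
      C (6 * (r : ℤ)) * X ^ 2 * derivative
        (C (padeCoeff r j) * (X ^ (3 * j) - X ^ (3 * r + 1 - 3 * j))) -
      C (3 * (r : ℤ) * (3 * r + 1)) * X *
        (C (padeCoeff r j) * (X ^ (3 * j) - X ^ (3 * r + 1 - 3 * j))) =
      -(h (j + 1) - h j) - (g (j + 1) - g j) := by
    intro j hj
    have hjr : j ≤ r := Nat.lt_succ_iff.1 (mem_range.1 hj)
    have e1 := key (3 * j)
    have e2 := key (3 * r + 1 - 3 * j)
    have hcast : ((3 * r + 1 - 3 * j : ℕ) : ℤ) = 3 * r + 1 - 3 * j := by omega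
    rw [hcast] at e2
    have hg : g j = C (padeCoeff r j * ((3 * (j : ℤ)) * (3 * j - 1))) * X ^ (3 * j - 2) := by
      rcases j with _ | j
      · simp [g]
      · simp only [g]
        rw [show 3 * (j + 1) - 2 = 3 * j + 1 by omega]
        congr 2
        push_cast
        linear_combination -padeCoeff_succ (r := r) (j := j) (by omega)
    have hh : h j = C (padeCoeff r j * ((3 * (j : ℤ)) * (3 * j - 1))) *
        X ^ (3 * r + 1 - 3 * j + 1) := by
      rcases j with _ | j
      · simp [h]
      · simp only [h]
        rw [show 3 * r + 1 - 3 * (j + 1) + 1 = 3 * r - 1 - 3 * j by omega]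
        congr 2
        push_cast
        linear_combination -padeCoeff_succ (r := r) (j := j) (by omega)
    have hg1 : g (j + 1) =
      C (padeCoeff r j * ((3 * (r : ℤ) - 3 * j) * (3 * r + 1 - 3 * j))) * X ^ (3 * j + 1) := rfl
    have hh1 : h (j + 1) =
      C (padeCoeff r j * ((3 * (r : ℤ) - 3 * j) * (3 * r + 1 - 3 * j))) *
        X ^ (3 * r + 1 - 3 * j - 2) := by
      rw [show 3 * r + 1 - 3 * j - 2 = 3 * r - 1 - 3 * j by omega]
    rw [hg, hh, hg1, hh1, derivative_C_mul, derivative_C_mul, derivative_sub, derivative_sub]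
    simp only [C_mul, C_sub, C_add, C_1, Nat.cast_mul, Nat.cast_ofNat] at e1 e2 ⊢
    linear_combination C (padeCoeff r j) * e1 - C (padeCoeff r j) * e2
  unfold padePoly
  simp only [derivative_sum, Finset.mul_sum, ← Finset.sum_add_distrib, ← Finset.sum_sub_distrib]
  rw [Finset.sum_congr rfl hterm, Finset.sum_sub_distrib, Finset.sum_neg_distrib, Finset.sum_range_sub,
    Finset.sum_range_sub]
  simp [g, h]

open Polynomial in
theorem sub_one_pow_dvd_padePoly (r : ℕ) : (X - 1) ^ (2 * r + 1) ∣ padePoly r := by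
  suffices ∀ k ≤ 2 * r, (X - 1) ^ (k + 1) ∣ padePoly r from this _ le_rfl
  have hX : (X - 1 : ℤ[X]) ≠ 0 := by simpa using X_sub_C_ne_zero (1 : ℤ)
  have hdvd : ∀ p : ℤ[X], eval 1 p = 0 → (X - 1) ∣ p := fun p hp => by
    simpa using dvd_iff_isRoot.2 (show IsRoot p 1 from hp)
  intro k
  induction k with
  | zero =>
    intro _
    rw [zero_add, pow_one]
    apply hdvd
    simp [padePoly, eval_finsetSum]
  | succ k ih =>
    intro hk
    obtain ⟨Q, hQ⟩ := ih (by omega)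
    have ode := padePoly_ode r
    have h0 : (X - 1) ^ k * (-((1 + X + X ^ 2) * (C ((k : ℤ) * (k + 1)) * Q +
        2 * C ((k : ℤ) + 1) * (X - 1) * derivative Q + (X - 1) ^ 2 * derivative (derivative Q))) +
        C (6 * (r : ℤ)) * X ^ 2 * (C ((k : ℤ) + 1) * Q + (X - 1) * derivative Q) -
        C (3 * (r : ℤ) * (3 * r + 1)) * X * (X - 1) * Q) = 0 := by
      rw [← ode, hQ]
      rcases k with _ | k
      · simp [derivative_mul]
        ring
      · simp [derivative_mul, derivative_pow]
        ring
    have h1 := (mul_eq_zero.1 h0).resolve_left (pow_ne_zero _ hX)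
    have h2 := congrArg (eval 1) h1
    simp at h2
    have h3 : eval 1 Q = 0 := by
      have h4 : ((k : ℤ) + 1) * (6 * r - 3 * k) * eval 1 Q = 0 := by linear_combination h2
      have h5 : ((k : ℤ) + 1) * (6 * r - 3 * k) ≠ 0 := by
        apply mul_ne_zero <;> omega
      exact (mul_eq_zero.1 h4).resolve_left h5
    obtain ⟨Q', hQ'⟩ := hdvd Q h3
    exact ⟨Q', by rw [hQ, hQ']; ring⟩

/-- The homogenized numerator of the Padé approximant. -/
def padeEval {R : Type*} [CommRing R] (r : ℕ) (x y : R) : R :=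
  ∑ j ∈ range (r + 1), (padeCoeff r j : R) * (x ^ (r - j) * y ^ j)

theorem map_padeEval {R S : Type*} [CommRing R] [CommRing S] (f : R →+* S) (r : ℕ) (x y : R) :
    f (padeEval r x y) = padeEval r (f x) (f y) := by
  simp [padeEval, map_sum]

theorem padeEval_smul {R : Type*} [CommRing R] (r : ℕ) (t x y : R) :
    padeEval r (t * x) (t * y) = t ^ r * padeEval r x y := by
  simp only [padeEval, Finset.mul_sum]
  refine sum_congr rfl fun j hj => ?_
  have hp : t ^ r = t ^ (r - j) * t ^ j := by
    rw [← pow_add, Nat.sub_add_cancel (Nat.lt_succ_iff.1 (mem_range.1 hj))]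
  rw [hp]
  simp only [mul_pow]
  ring

theorem padeEval_one_zero (r : ℕ) : padeEval r (1 : ℤ) 0 = padeCoeff r 0 := by
  simp [padeEval, sum_range_succ']

theorem padeEval_zero_one (r : ℕ) : padeEval r (0 : ℤ) 1 = padeCoeff r r := by
  rw [padeEval, sum_range_succ, sum_eq_zero]
  · simp
  · intro j hj
    have := mem_range.1 hj
    simp [show r - j ≠ 0 by omega]

theorem norm_padeEval_le (r : ℕ) (x y : ℂ) (B : ℝ) (hx : ‖x‖ ≤ B) (hy : ‖y‖ ≤ B) :
    ‖padeEval r x y‖ ≤ 4 * 72 ^ r * B ^ r := by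
  have hB : 0 ≤ B := (norm_nonneg x).trans hx
  calc ‖padeEval r x y‖ ≤ ∑ j ∈ range (r + 1), ‖(padeCoeff r j : ℂ) * (x ^ (r - j) * y ^ j)‖ :=
        norm_sum_le _ _
    _ ≤ ∑ j ∈ range (r + 1), 4 * 36 ^ r * B ^ r := by
        refine sum_le_sum fun j hj => ?_
        have hjr : j ≤ r := Nat.lt_succ_iff.1 (mem_range.1 hj)
        rw [norm_mul, norm_mul, norm_pow, norm_pow]
        have h1 : ‖(padeCoeff r j : ℂ)‖ ≤ 4 * 36 ^ r := by
          rw [Complex.norm_intCast, abs_of_pos (by exact_mod_cast padeCoeff_pos hjr)]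
          exact_mod_cast padeCoeff_le hjr
        calc _ ≤ 4 * 36 ^ r * (B ^ (r - j) * B ^ j) := by gcongr
          _ = _ := by rw [← pow_add, Nat.sub_add_cancel hjr]
    _ = (r + 1 : ℕ) * (4 * 36 ^ r * B ^ r) := by rw [sum_const, card_range, nsmul_eq_mul]
    _ ≤ (2 ^ r : ℕ) * (4 * 36 ^ r * B ^ r) := by
        gcongr
        exact Nat.lt_two_pow_self
    _ = _ := by
        rw [show (72 : ℝ) = 2 * 36 by norm_num, mul_pow]
        push_cast
        ring

theorem sum_padeCoeff_choose_eq_zero (r k : ℕ) (hk : k ≤ 2 * r) :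
    ∑ j ∈ range (r + 1), padeCoeff r j *
      (((3 * j).choose k : ℤ) - ((3 * r + 1 - 3 * j).choose k : ℤ)) = 0 := by
  have h := (Polynomial.X_sub_C_pow_dvd_iff (p := padePoly r) (t := 1) (n := 2 * r + 1)).1
    (by simpa using sub_one_pow_dvd_padePoly r)
  rw [Polynomial.X_pow_dvd_iff] at h
  have h2 := h k (by omega)
  rw [← h2, padePoly, Polynomial.sum_comp, Polynomial.finsetSum_coeff]
  refine sum_congr rfl fun j _ => ?_
  simp [Polynomial.coeff_X_add_one_pow]

theorem pade_remainder_eq (r : ℕ) (x y : ℂ) :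
    x * padeEval r (x ^ 3) (y ^ 3) - y * padeEval r (y ^ 3) (x ^ 3) =
      ∑ k ∈ range (3 * r + 2), (∑ j ∈ range (r + 1), padeCoeff r j *
      (((3 * j).choose k : ℤ) - ((3 * r + 1 - 3 * j).choose k : ℤ)) : ℤ) *
        ((y - x) ^ k * x ^ (3 * r + 1 - k)) := by
  have key : ∀ n ≤ 3 * r + 1, y ^ n * x ^ (3 * r + 1 - n) = ∑ k ∈ range (3 * r + 2),
      (n.choose k : ℂ) * ((y - x) ^ k * x ^ (3 * r + 1 - k)) := by
    intro n hn
    conv_lhs => rw [show y = (y - x) + x by ring, add_pow, sum_mul]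
    rw [← sum_subset (s₁ := range (n + 1)) (s₂ := range (3 * r + 2)) (range_subset_range.2 (by omega))]
    · refine sum_congr rfl fun k hk => ?_
      have : k ≤ n := Nat.lt_succ_iff.1 (mem_range.1 hk)
      rw [show 3 * r + 1 - k = (n - k) + (3 * r + 1 - n) by omega, pow_add]
      ring
    · intro k _ hk
      rw [Nat.choose_eq_zero_of_lt (by simpa using hk)]
      simp
  simp only [padeEval, mul_sum, ← sum_sub_distrib]
  push_cast
  simp only [sum_mul]
  rw [sum_comm]
  refine sum_congr rfl fun j hj => ?_
  have hjr : j ≤ r := Nat.lt_succ_iff.1 (mem_range.1 hj)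
  have h1 := key (3 * j) (by omega)
  have h2 := key (3 * r + 1 - 3 * j) (by omega)
  simp only [mul_assoc, ← mul_sum, sub_mul, sum_sub_distrib]
  rw [← h1, ← h2, show 3 * r + 1 - (3 * r + 1 - 3 * j) = 3 * j by omega,
    show 3 * r + 1 - 3 * j = 3 * (r - j) + 1 by omega]
  simp only [pow_succ]
  ring

theorem pade_remainder_bound (r : ℕ) (x y : ℂ) (B : ℝ) (hx : ‖x‖ ≤ B) (hy : ‖x - y‖ ≤ B) :
    ‖x * padeEval r (x ^ 3) (y ^ 3) - y * padeEval r (y ^ 3) (x ^ 3)‖ ≤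
      8 * 1152 ^ r * ‖x - y‖ ^ (2 * r + 1) * B ^ r := by
  have hB : 0 ≤ B := (norm_nonneg x).trans hx
  rw [pade_remainder_eq, show 3 * r + 2 = (2 * r + 1) + (r + 1) by ring, sum_range_add,
    sum_eq_zero, zero_add]
  swap
  · intro k hk
    rw [sum_padeCoeff_choose_eq_zero r k (by have := mem_range.1 hk; omega)]
    simp
  have hpow : (r + 1 : ℝ) ≤ 2 ^ r := by exact_mod_cast Nat.lt_two_pow_self (n := r)
  have hcoef : ∀ k, ‖((∑ j ∈ range (r + 1), padeCoeff r j *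
      (((3 * j).choose k : ℤ) - ((3 * r + 1 - 3 * j).choose k : ℤ)) : ℤ) : ℂ)‖ ≤
      2 ^ r * (8 * 288 ^ r) := by
    intro k
    push_cast
    calc _ ≤ ∑ j ∈ range (r + 1), ‖(padeCoeff r j : ℂ) *
          (((3 * j).choose k : ℂ) - ((3 * r + 1 - 3 * j).choose k : ℂ))‖ := norm_sum_le _ _
      _ ≤ ∑ j ∈ range (r + 1), (8 * 288 ^ r : ℝ) := by
          refine sum_le_sum fun j hj => ?_
          have hjr : j ≤ r := Nat.lt_succ_iff.1 (mem_range.1 hj)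
          have h1 : ‖(padeCoeff r j : ℂ)‖ ≤ 4 * 36 ^ r := by
            rw [Complex.norm_intCast, abs_of_pos (by exact_mod_cast padeCoeff_pos hjr)]
            exact_mod_cast padeCoeff_le hjr
          have hc : ∀ n ≤ 3 * r + 1, (n.choose k : ℤ) ≤ 2 ^ (3 * r + 1) := fun n hn => by
            exact_mod_cast (Nat.choose_le_two_pow n k).trans (Nat.pow_le_pow_right (by norm_num) hn)
          have h2 : ‖(((3 * j).choose k : ℂ) - ((3 * r + 1 - 3 * j).choose k : ℂ))‖ ≤
              2 ^ (3 * r + 1) := by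
            have : (((3 * j).choose k : ℂ) - ((3 * r + 1 - 3 * j).choose k : ℂ)) =
              ((((3 * j).choose k : ℤ) - ((3 * r + 1 - 3 * j).choose k : ℤ) : ℤ) : ℂ) := by
                push_cast; rfl
            rw [this, Complex.norm_intCast]
            have ha := hc (3 * j) (by omega)
            have hb := hc (3 * r + 1 - 3 * j) (by omega)
            have : |((3 * j).choose k : ℤ) - ((3 * r + 1 - 3 * j).choose k : ℤ)| ≤
              2 ^ (3 * r + 1) := by
                rw [abs_le]; constructor <;> omega
            exact_mod_cast this
          rw [norm_mul]
          calc _ ≤ (4 * 36 ^ r) * (2 : ℝ) ^ (3 * r + 1) := by gcongr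
            _ = _ := by
              rw [pow_succ, pow_mul, show (288 : ℝ) = 36 * 2 ^ 3 by norm_num, mul_pow]; ring
      _ = (r + 1 : ℝ) * (8 * 288 ^ r) := by
          rw [sum_const, card_range, nsmul_eq_mul]; push_cast; ring
      _ ≤ _ := by gcongr
  calc _ ≤ ∑ i ∈ range (r + 1), (2 ^ r * (8 * 288 ^ r)) * (‖x - y‖ ^ (2 * r + 1) * B ^ r) := by
        refine (norm_sum_le _ _).trans (sum_le_sum fun i hi => ?_)
        have hi' : i ≤ r := Nat.lt_succ_iff.1 (mem_range.1 hi)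
        rw [norm_mul, norm_mul, norm_pow, norm_pow, norm_sub_rev y x]
        refine mul_le_mul (hcoef _) ?_ (by positivity) (by positivity)
        rw [pow_add, mul_assoc]
        refine mul_le_mul_of_nonneg_left ?_ (by positivity)
        calc ‖x - y‖ ^ i * ‖x‖ ^ (3 * r + 1 - (2 * r + 1 + i)) ≤ B ^ i * B ^ (r - i) := by
              rw [show 3 * r + 1 - (2 * r + 1 + i) = r - i by omega]
              gcongr
          _ = B ^ r := by rw [← pow_add, Nat.add_sub_cancel' hi']
    _ = (r + 1 : ℝ) * ((2 ^ r * (8 * 288 ^ r)) * (‖x - y‖ ^ (2 * r + 1) * B ^ r)) := by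
        rw [sum_const, card_range, nsmul_eq_mul]; push_cast; ring
    _ ≤ 2 ^ r * ((2 ^ r * (8 * 288 ^ r)) * (‖x - y‖ ^ (2 * r + 1) * B ^ r)) := by gcongr
    _ = _ := by
        rw [show (1152 : ℝ) = 2 * 2 * 288 by norm_num, mul_pow, mul_pow]; ring

theorem padeCoeff_cross (r : ℕ) :
    padeCoeff r 0 * padeCoeff (r + 1) (r + 1) ≠ padeCoeff r r * padeCoeff (r + 1) 0 := by
  have h1 := thirdChoose_mul_factorial (3 * r + 1) r
  have h2 := thirdChoose_mul_factorial (3 * r - 1) r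
  have h3 := thirdChoose_mul_factorial (3 * (r + 1 : ℕ) + 1) (r + 1)
  have h4 := thirdChoose_mul_factorial (3 * (r + 1 : ℕ) - 1) (r + 1)
  rw [prod_range_succ'] at h3 h4
  have e3 : ∏ i ∈ range r, (3 * ((r + 1 : ℕ) : ℤ) + 1 - 3 * ((i + 1 : ℕ) : ℤ)) =
      ∏ i ∈ range r, (3 * (r : ℤ) + 1 - 3 * (i : ℤ)) :=
    prod_congr rfl fun i _ => by push_cast; ring
  have e4 : ∏ i ∈ range r, (3 * ((r + 1 : ℕ) : ℤ) - 1 - 3 * ((i + 1 : ℕ) : ℤ)) =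
      ∏ i ∈ range r, (3 * (r : ℤ) - 1 - 3 * (i : ℤ)) :=
    prod_congr rfl fun i _ => by push_cast; ring
  rw [e3, pow_succ, Nat.factorial_succ] at h3
  rw [e4, pow_succ, Nat.factorial_succ] at h4
  have hz : ∀ n, thirdChoose n 0 = 1 := fun n => by simp [thirdChoose]
  simp only [padeCoeff, hz, Nat.sub_self, Nat.sub_zero, one_mul, mul_one]
  have hu := (thirdChoose_bounds r r _ (.inl rfl) le_rfl).1
  have hv := (thirdChoose_bounds r r _ (.inr rfl) le_rfl).1
  set u := thirdChoose (3 * r + 1) r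
  set v := thirdChoose (3 * r - 1) r
  set u' := thirdChoose (3 * (r + 1 : ℕ) + 1) (r + 1)
  set v' := thirdChoose (3 * (r + 1 : ℕ) - 1) (r + 1)
  set P := ∏ i ∈ range r, (3 * (r : ℤ) + 1 - 3 * (i : ℤ))
  set Q := ∏ i ∈ range r, (3 * (r : ℤ) - 1 - 3 * (i : ℤ))
  have hf : (r.factorial : ℤ) ≠ 0 := by positivity
  push_cast at h3 h4
  have h5 : u' * (r + 1) = 3 * (3 * r + 4) * u := by
    apply mul_right_cancel₀ hf
    linear_combination h3 - 3 * (3 * r + 4) * h1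
  have h6 : v' * (r + 1) = 3 * (3 * r + 2) * v := by
    apply mul_right_cancel₀ hf
    linear_combination h4 - 3 * (3 * r + 2) * h2
  intro h
  have : 6 * (u * v) = 0 := by linear_combination (r + 1 : ℤ) * h - v * h5 + u * h6
  have : 0 < u * v := mul_pos hu hv
  omega

open Polynomial in
theorem natDegree_padeEval_le (r : ℕ) :
    (padeEval r (1 : ℤ[X]) X).natDegree ≤ r ∧ (padeEval r (X : ℤ[X]) 1).natDegree ≤ r := by
  constructor <;>
  · refine natDegree_sum_le_of_forall_le _ _ fun j hj => ?_
    have := mem_range.1 hj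
    simp only [one_pow, one_mul, mul_one]
    rw [← C_eq_intCast]
    exact (natDegree_C_mul_X_pow_le _ _).trans (by omega)

open Polynomial in
theorem padePoly_eq (r : ℕ) :
    padePoly r = padeEval r 1 (X ^ 3) - X * padeEval r (X ^ 3) 1 := by
  simp only [padePoly, padeEval, mul_sum, ← sum_sub_distrib]
  refine sum_congr rfl fun j hj => ?_
  have := mem_range.1 hj
  have hC : (C (padeCoeff r j) : ℤ[X]) = ((padeCoeff r j : ℤ) : ℤ[X]) := by simp
  rw [show 3 * r + 1 - 3 * j = 3 * (r - j) + 1 by omega, hC]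
  simp only [one_pow, pow_succ, pow_mul]
  ring

open Polynomial in
theorem pade_cross_poly (r : ℕ) : ∃ c : ℤ, c ≠ 0 ∧
    padeEval r (1 : ℤ[X]) X * padeEval (r + 1) X 1 - padeEval r X 1 * padeEval (r + 1) 1 X =
      C c * (X - 1) ^ (2 * r + 1) := by
  set W : ℤ[X] :=
    padeEval r (1 : ℤ[X]) X * padeEval (r + 1) X 1 - padeEval r X 1 * padeEval (r + 1) 1 X with hW
  have hX : (X - 1 : ℤ[X]) ≠ 0 := by simpa using X_sub_C_ne_zero (1 : ℤ)
  have hW0 : W.eval 0 ≠ 0 := by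
    have hmap : ∀ s (x y : ℤ[X]), eval 0 (padeEval s x y) = padeEval s (eval 0 x) (eval 0 y) :=
      fun s x y => map_padeEval (evalRingHom (0 : ℤ)) s x y
    simp only [hW, eval_sub, eval_mul, hmap, eval_one, eval_X, padeEval_one_zero,
      padeEval_zero_one]
    exact sub_ne_zero.2 (padeCoeff_cross r)
  have hWne : W ≠ 0 := by rintro h; simp [h] at hW0
  have hdeg : W.natDegree ≤ 2 * r + 1 := by
    have h1 := natDegree_padeEval_le r
    have h2 := natDegree_padeEval_le (r + 1)
    refine (natDegree_sub_le _ _).trans (max_le ?_ ?_)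
    · exact natDegree_mul_le.trans (by omega)
    · exact natDegree_mul_le.trans (by omega)
  have hdvd : (X - 1) ^ (2 * r + 1) ∣ X * W.comp (X ^ 3) := by
    have hmap : ∀ s (x y : ℤ[X]), (padeEval s x y).comp (X ^ 3) =
        padeEval s (x.comp (X ^ 3)) (y.comp (X ^ 3)) :=
      fun s x y => map_padeEval (compRingHom (X ^ 3 : ℤ[X])) s x y
    have : X * W.comp (X ^ 3) = padePoly r * padeEval (r + 1) 1 (X ^ 3) -
        padeEval r 1 (X ^ 3) * padePoly (r + 1) := by
      rw [padePoly_eq, padePoly_eq]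
      simp only [hW, sub_comp, mul_comp, hmap, one_comp, X_comp]
      ring
    rw [this]
    refine dvd_sub ((sub_one_pow_dvd_padePoly r).mul_right _)
      (Dvd.dvd.mul_left ((pow_dvd_pow _ (by omega)).trans (sub_one_pow_dvd_padePoly (r + 1))) _)
  obtain ⟨V, hV, hV1⟩ := exists_eq_pow_rootMultiplicity_mul_and_not_dvd W hWne 1
  set n := W.rootMultiplicity 1
  rw [C_1] at hV hV1
  have hn : 2 * r + 1 ≤ n := by
    by_contra hlt
    push Not at hlt
    apply hV1
    have h1 : (X - 1) ^ (n + 1) ∣ (X - 1) ^ n * (X * (X ^ 2 + X + 1) ^ n * V.comp (X ^ 3)) := by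
      refine ((pow_dvd_pow _ (by omega)).trans hdvd).trans (dvd_of_eq ?_)
      conv_lhs => rw [hV]
      simp only [mul_comp, pow_comp, sub_comp, X_comp, one_comp]
      rw [show (X ^ 3 - 1 : ℤ[X]) = (X - 1) * (X ^ 2 + X + 1) by ring, mul_pow]
      ring
    rw [pow_succ, mul_dvd_mul_iff_left (pow_ne_zero _ hX)] at h1
    have h2 := (dvd_iff_isRoot (p := X * (X ^ 2 + X + 1) ^ n * V.comp (X ^ 3)) (a := (1 : ℤ))).1
      (by simpa using h1)
    have h3 := h2.eq_zero
    simp only [eval_mul, eval_X, eval_pow, eval_add, eval_one, eval_comp, one_pow] at h3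
    have h4 : V.eval 1 = 0 := (mul_eq_zero.1 h3).resolve_left (by positivity)
    simpa using dvd_iff_isRoot.2 (show IsRoot V 1 from h4)
  obtain ⟨Q, hQ⟩ : (X - 1) ^ (2 * r + 1) ∣ W :=
    (pow_dvd_pow _ hn).trans ⟨V, hV⟩
  have hQ0 : Q ≠ 0 := by rintro rfl; simp [hWne] at hQ
  have hQd : Q.natDegree = 0 := by
    have h1 : W.natDegree = (2 * r + 1) + Q.natDegree := by
      rw [hQ, natDegree_mul (pow_ne_zero _ hX) hQ0, natDegree_pow]
      have : (X - 1 : ℤ[X]).natDegree = 1 := by simpa using natDegree_X_sub_C (1 : ℤ)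
      rw [this, mul_one]
    omega
  obtain ⟨c, rfl⟩ := natDegree_eq_zero.1 hQd
  exact ⟨c, by rintro rfl; simp at hQ0, by rw [hQ, mul_comm]⟩

open Polynomial in
theorem pade_cross_ne_zero (r : ℕ) (x y : ℂ) (hxy : x ≠ y) :
    padeEval r x y * padeEval (r + 1) y x - padeEval r y x * padeEval (r + 1) x y ≠ 0 := by
  have main : ∀ x y : ℂ, x ≠ y → x ≠ 0 →
      padeEval r x y * padeEval (r + 1) y x - padeEval r y x * padeEval (r + 1) x y ≠ 0 := by
    intro x y hxy hx
    obtain ⟨c, hc, h⟩ := pade_cross_poly r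
    have h2 := congrArg (aeval (y / x)) h
    have hmap : ∀ s (p q : ℤ[X]), aeval (y / x) (padeEval s p q) =
        padeEval s (aeval (y / x) p) (aeval (y / x) q) :=
      fun s p q => map_padeEval ((aeval (y / x)) : ℤ[X] →ₐ[ℤ] ℂ).toRingHom s p q
    simp only [map_sub, map_mul, map_pow, hmap, map_one, aeval_X, aeval_C] at h2
    have e1 : ∀ s, padeEval s x y = x ^ s * padeEval s 1 (y / x) := fun s => by
      rw [← padeEval_smul, mul_one, mul_div_cancel₀ _ hx]
    have e2 : ∀ s, padeEval s y x = x ^ s * padeEval s (y / x) 1 := fun s => by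
      rw [← padeEval_smul, mul_one, mul_div_cancel₀ _ hx]
    have : padeEval r x y * padeEval (r + 1) y x - padeEval r y x * padeEval (r + 1) x y =
        x ^ r * x ^ (r + 1) * (algebraMap ℤ ℂ c * (y / x - 1) ^ (2 * r + 1)) := by
      rw [e1, e2, e1, e2, ← h2]; ring
    rw [this]
    refine mul_ne_zero (mul_ne_zero (pow_ne_zero _ hx) (pow_ne_zero _ hx))
      (mul_ne_zero (by simpa using hc) (pow_ne_zero _ ?_))
    rw [sub_ne_zero, Ne, div_eq_one_iff_eq hx]
    exact hxy.symm
  by_cases hx : x = 0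
  · have hy : y ≠ 0 := by rintro rfl; exact hxy hx
    have := main y x hxy.symm hy
    intro h
    apply this
    linear_combination -h
  · exact main x y hxy hx

/-- If `ξ₁ ^ 3, η₁ ^ 3` and `ξ₁ η₂ ± ξ₂ η₁` are conjugate quadratic integers up to scaling, then the
Padé linear form is an integral multiple of a fixed number. -/
theorem exists_padeForm_eq (r : ℕ) (E G F P s : ℤ) (κ τ ξ₁ η₁ ξ₂ η₂ : ℂ) (hτ : τ * τ = E)
    (h₁ : ξ₁ ^ 3 = κ * (G + F * τ)) (h₂ : η₁ ^ 3 = κ * (G - F * τ))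
    (h₃ : ξ₁ * η₂ + ξ₂ * η₁ = P) (h₄ : ξ₁ * η₂ - ξ₂ * η₁ = s * τ) :
    ∃ n : ℤ, ξ₁ * padeEval r (ξ₁ ^ 3) (η₁ ^ 3) * η₂ - η₁ * padeEval r (η₁ ^ 3) (ξ₁ ^ 3) * ξ₂ =
      κ ^ r * (n * τ) := by
  set f : ℤ√E →+* ℂ := Zsqrtd.lift ⟨τ, hτ⟩ with hf
  set g : ℤ√E →+* ℂ := Zsqrtd.lift ⟨-τ, by simpa using hτ⟩ with hg
  set z : ℤ√E := padeEval r ⟨G, F⟩ ⟨G, -F⟩ with hz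
  have e1 : padeEval r (G + F * τ) (G - F * τ) = z.re + z.im * τ := by
    have : f z = z.re + z.im * τ := by simp [hf]
    rw [← this, hz, map_padeEval]
    simp [hf, sub_eq_add_neg]
  have e2 : padeEval r (G - F * τ) (G + F * τ) = z.re - z.im * τ := by
    have : g z = z.re - z.im * τ := by simp [hg, sub_eq_add_neg]
    rw [← this, hz, map_padeEval]
    simp [hg, sub_eq_add_neg]
  have e3 : ξ₁ * η₂ = (P + s * τ) / 2 := by linear_combination (h₃ + h₄) / 2
  have e4 : ξ₂ * η₁ = (P - s * τ) / 2 := by linear_combination (h₃ - h₄) / 2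
  refine ⟨P * z.im + s * z.re, ?_⟩
  rw [h₁, h₂, padeEval_smul, padeEval_smul, e1, e2]
  push_cast
  linear_combination κ ^ r * (z.re + z.im * τ) * e3 - κ ^ r * (z.re - z.im * τ) * e4

/-- The Lagrange-type linear factors of a binary cubic form, normalized to have zero sum. -/
def cubicFactor (a b : Fin 3 → ℂ) (i : Fin 3) (x y : ℂ) : ℂ :=
  (a (i + 1) * b (i + 2) - a (i + 2) * b (i + 1)) * (a i * x - b i * y)

def cubicSqrtDisc (a b : Fin 3 → ℂ) : ℂ :=
  (a 1 * b 2 - a 2 * b 1) * (a 2 * b 0 - a 0 * b 2) * (a 0 * b 1 - a 1 * b 0)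

theorem cubicFactor_zero (a b : Fin 3 → ℂ) (x y : ℂ) :
    cubicFactor a b 0 x y = (a 1 * b 2 - a 2 * b 1) * (a 0 * x - b 0 * y) := rfl

theorem cubicFactor_one (a b : Fin 3 → ℂ) (x y : ℂ) :
    cubicFactor a b 1 x y = (a 2 * b 0 - a 0 * b 2) * (a 1 * x - b 1 * y) := rfl

theorem cubicFactor_two (a b : Fin 3 → ℂ) (x y : ℂ) :
    cubicFactor a b 2 x y = (a 0 * b 1 - a 1 * b 0) * (a 2 * x - b 2 * y) := rfl

theorem binEval_cubic {R : Type*} [CommRing R] (c : Fin 4 → R) (x y : R) :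
    binEval c x y = c 0 * x ^ 3 + c 1 * x ^ 2 * y + c 2 * x * y ^ 2 + c 3 * y ^ 3 := by
  simp [binEval, Fin.sum_univ_four]

theorem binEval_intCast {n : ℕ} (R : Type*) [CommRing R] (c : Fin (n + 1) → ℤ) (x y : ℤ) :
    binEval (fun i => (c i : R)) (x : R) (y : R) = ((binEval c x y : ℤ) : R) := by
  simp [binEval]

/-- `c` is the product of the linear forms `a i * x - b i * y`. -/
structure CubicSplits (c : Fin 4 → ℤ) (a b : Fin 3 → ℂ) : Prop where
  c0 : (c 0 : ℂ) = a 0 * a 1 * a 2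
  c1 : (c 1 : ℂ) = -(a 0 * a 1 * b 2 + a 0 * b 1 * a 2 + b 0 * a 1 * a 2)
  c2 : (c 2 : ℂ) = a 0 * b 1 * b 2 + b 0 * a 1 * b 2 + b 0 * b 1 * a 2
  c3 : (c 3 : ℂ) = -(b 0 * b 1 * b 2)

theorem CubicSplits.of_eval {c : Fin 4 → ℤ} {a b : Fin 3 → ℂ}
    (h : ∀ x y : ℂ, binEval (fun i => ((c i : ℂ))) x y = ∏ i : Fin 3, (a i * x - b i * y)) :
    CubicSplits c a b := by
  simp only [binEval_cubic, Fin.prod_univ_three] at h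
  have h1 := h 1 0
  have h2 := h 0 1
  have h3 := h 1 1
  have h4 := h 1 (-1)
  refine ⟨?_, ?_, ?_, ?_⟩
  · linear_combination h1
  · linear_combination (h3 - h4) / 2 - h2
  · linear_combination (h3 + h4) / 2 - h1
  · linear_combination h2

theorem CubicSplits.eval {c : Fin 4 → ℤ} {a b : Fin 3 → ℂ} (h : CubicSplits c a b) (x y : ℂ) :
    binEval (fun i => ((c i : ℂ))) x y = ∏ i : Fin 3, (a i * x - b i * y) := by
  simp only [binEval_cubic, Fin.prod_univ_three, h.c0, h.c1, h.c2, h.c3]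
  ring

theorem prod_disc_eq (a b : Fin 3 → ℂ) :
    ∏ i : Fin 3, ∏ j ∈ Finset.univ.filter (fun j => i < j), (a i * b j - a j * b i) ^ 2 =
      cubicSqrtDisc a b ^ 2 := by
  have h0 : (Finset.univ.filter (fun j => (0 : Fin 3) < j)) = {1, 2} := by decide
  have h1 : (Finset.univ.filter (fun j => (1 : Fin 3) < j)) = {2} := by decide
  have h2 : (Finset.univ.filter (fun j => (2 : Fin 3) < j)) = ∅ := by decide
  rw [Fin.prod_univ_three, h0, h1, h2, prod_pair (by decide), prod_singleton, prod_empty,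
    cubicSqrtDisc]
  ring

theorem cubicFactor_sum (a b : Fin 3 → ℂ) (x y : ℂ) :
    cubicFactor a b 0 x y + cubicFactor a b 1 x y + cubicFactor a b 2 x y = 0 := by
  simp only [cubicFactor_zero, cubicFactor_one, cubicFactor_two]
  ring

theorem cubicFactor_prod {c : Fin 4 → ℤ} {a b : Fin 3 → ℂ} (h : CubicSplits c a b) (x y : ℤ) :
    cubicFactor a b 0 x y * cubicFactor a b 1 x y * cubicFactor a b 2 x y =
      cubicSqrtDisc a b * (binEval c x y : ℤ) := by
  rw [← binEval_intCast, h.eval, Fin.prod_univ_three]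
  simp only [cubicFactor_zero, cubicFactor_one, cubicFactor_two, cubicSqrtDisc]
  ring

theorem cubicFactor_det (a b : Fin 3 → ℂ) (x y x' y' : ℂ) :
    cubicFactor a b 0 x y * cubicFactor a b 1 x' y' -
      cubicFactor a b 1 x y * cubicFactor a b 0 x' y' =
      -(cubicSqrtDisc a b * (x * y' - x' * y)) := by
  simp only [cubicFactor_zero, cubicFactor_one, cubicSqrtDisc]
  ring

theorem cubicFactor_covariant {c : Fin 4 → ℤ} {a b : Fin 3 → ℂ} (h : CubicSplits c a b)
    (x y : ℤ) : ∃ G : ℤ, (cubicFactor a b 0 x y - cubicFactor a b 1 x y) *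
      (cubicFactor a b 1 x y - cubicFactor a b 2 x y) *
      (cubicFactor a b 2 x y - cubicFactor a b 0 x y) = G := by
  refine ⟨-((27 * c 0 ^ 2 * c 3 - 9 * c 0 * c 1 * c 2 + 2 * c 1 ^ 3) * x ^ 3 +
    3 * (9 * c 0 * c 1 * c 3 - 6 * c 0 * c 2 ^ 2 + c 1 ^ 2 * c 2) * x ^ 2 * y -
    3 * (9 * c 0 * c 2 * c 3 - 6 * c 1 ^ 2 * c 3 + c 1 * c 2 ^ 2) * x * y ^ 2 -
    (27 * c 0 * c 3 ^ 2 - 9 * c 1 * c 2 * c 3 + 2 * c 2 ^ 3) * y ^ 3), ?_⟩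
  push_cast
  simp only [cubicFactor_zero, cubicFactor_one, cubicFactor_two, h.c0, h.c1, h.c2, h.c3]
  ring

theorem cubicFactor_polar {c : Fin 4 → ℤ} {a b : Fin 3 → ℂ} (h : CubicSplits c a b)
    (x y x' y' : ℤ) : ∃ P : ℤ,
      cubicFactor a b 0 x y * cubicFactor a b 1 x' y' +
      cubicFactor a b 1 x y * cubicFactor a b 0 x' y' +
      (cubicFactor a b 0 x y * cubicFactor a b 2 x' y' +
      cubicFactor a b 2 x y * cubicFactor a b 0 x' y') +
      (cubicFactor a b 1 x y * cubicFactor a b 2 x' y' +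
      cubicFactor a b 2 x y * cubicFactor a b 1 x' y') = P := by
  refine ⟨-(2 * (c 1 ^ 2 - 3 * c 0 * c 2) * x * x' +
    (c 1 * c 2 - 9 * c 0 * c 3) * (x * y' + x' * y) +
    2 * (c 2 ^ 2 - 3 * c 1 * c 3) * y * y'), ?_⟩
  push_cast
  simp only [cubicFactor_zero, cubicFactor_one, cubicFactor_two, h.c0, h.c1, h.c2, h.c3]
  ring

theorem cubic_resolvent {R : Type*} [CommRing R] [NoZeroDivisors R] (ω L₀ L₁ L₂ : R)
    (hω : ω ^ 2 + ω + 1 = 0) (h : L₀ + L₁ + L₂ = 0) :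
    (L₀ + ω * L₁ + ω ^ 2 * L₂) - (-(L₀ + ω ^ 2 * L₁ + ω * L₂)) = 3 * L₀ ∧
    (L₀ + ω * L₁ + ω ^ 2 * L₂) ^ 3 - (-(L₀ + ω ^ 2 * L₁ + ω * L₂)) ^ 3 = 27 * (L₀ * L₁ * L₂) ∧
    (L₀ + ω * L₁ + ω ^ 2 * L₂) ^ 3 + (-(L₀ + ω ^ 2 * L₁ + ω * L₂)) ^ 3 =
      -(3 * (2 * ω + 1) * ((L₀ - L₁) * (L₁ - L₂) * (L₂ - L₀))) := by
  obtain rfl : L₂ = -(L₀ + L₁) := by linear_combination h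
  have h2 : ω ^ 2 = -ω - 1 := by linear_combination hω
  refine ⟨?_, ?_, ?_⟩ <;> grind

theorem cubic_resolvent_pair {R : Type*} [CommRing R] (ω L₀ L₁ L₂ K₀ K₁ K₂ : R)
    (hω : ω ^ 2 + ω + 1 = 0) (h : L₀ + L₁ + L₂ = 0) (h' : K₀ + K₁ + K₂ = 0) :
    (L₀ + ω * L₁ + ω ^ 2 * L₂) * (-(K₀ + ω ^ 2 * K₁ + ω * K₂)) +
      (K₀ + ω * K₁ + ω ^ 2 * K₂) * (-(L₀ + ω ^ 2 * L₁ + ω * L₂)) =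
      3 * (L₀ * K₁ + L₁ * K₀ + (L₀ * K₂ + L₂ * K₀) + (L₁ * K₂ + L₂ * K₁)) ∧
    (L₀ + ω * L₁ + ω ^ 2 * L₂) * (-(K₀ + ω ^ 2 * K₁ + ω * K₂)) -
      (K₀ + ω * K₁ + ω ^ 2 * K₂) * (-(L₀ + ω ^ 2 * L₁ + ω * L₂)) =
      3 * (2 * ω + 1) * (L₀ * K₁ - L₁ * K₀) := by
  obtain rfl : L₂ = -(L₀ + L₁) := by linear_combination h
  obtain rfl : K₂ = -(K₀ + K₁) := by linear_combination h'
  have h2 : ω ^ 2 = -ω - 1 := by linear_combination hω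
  refine ⟨?_, ?_⟩ <;> grind

/-- The linear form in Padé polynomials attached to two points. -/
noncomputable def padeForm (r : ℕ) (ξ₁ η₁ ξ₂ η₂ : ℂ) : ℂ :=
  ξ₁ * padeEval r (ξ₁ ^ 3) (η₁ ^ 3) * η₂ - η₁ * padeEval r (η₁ ^ 3) (ξ₁ ^ 3) * ξ₂

theorem padeForm_ne_zero (r : ℕ) (ξ₁ η₁ ξ₂ η₂ : ℂ) (h : ξ₁ ^ 3 ≠ η₁ ^ 3)
    (h' : ξ₁ * η₂ - ξ₂ * η₁ ≠ 0) :
    padeForm r ξ₁ η₁ ξ₂ η₂ ≠ 0 ∨ padeForm (r + 1) ξ₁ η₁ ξ₂ η₂ ≠ 0 := by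
  by_contra! hcon
  obtain ⟨h1, h2⟩ := hcon
  have hW := pade_cross_ne_zero r _ _ h
  unfold padeForm at h1 h2
  set A := padeEval r (ξ₁ ^ 3) (η₁ ^ 3)
  set B := padeEval r (η₁ ^ 3) (ξ₁ ^ 3)
  set A' := padeEval (r + 1) (ξ₁ ^ 3) (η₁ ^ 3)
  set B' := padeEval (r + 1) (η₁ ^ 3) (ξ₁ ^ 3)
  have hu : ξ₁ * η₂ = 0 := by
    refine (mul_eq_zero.1 (?_ : (ξ₁ * η₂) * (A * B' - B * A') = 0)).resolve_right hW
    linear_combination h1 * B' - h2 * B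
  have hv : ξ₂ * η₁ = 0 := by
    refine (mul_eq_zero.1 (?_ : (ξ₂ * η₁) * (A * B' - B * A') = 0)).resolve_right hW
    linear_combination h1 * A' - h2 * A
  exact h' (by rw [hu, hv, sub_zero])

theorem norm_padeForm_le (r : ℕ) (ξ₁ η₁ ξ₂ η₂ : ℂ) (X Z l l' : ℝ) (hξ : ‖ξ₁‖ ≤ X)
    (hη : ‖η₁‖ ≤ X) (hl : ‖ξ₁ - η₁‖ ≤ l) (hlX : l ≤ X) (hη' : ‖η₂‖ ≤ Z) (hl' : ‖ξ₂ - η₂‖ ≤ l') :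
    ‖padeForm r ξ₁ η₁ ξ₂ η₂‖ ≤ 8 * 1152 ^ r * l ^ (2 * r + 1) * X ^ r * Z +
      X * (4 * 72 ^ r * (X ^ 3) ^ r) * l' := by
  have hX : 0 ≤ X := (norm_nonneg _).trans hξ
  have h1 := pade_remainder_bound r ξ₁ η₁ X hξ (hl.trans hlX)
  have h2 := norm_padeEval_le r (η₁ ^ 3) (ξ₁ ^ 3) (X ^ 3)
    (by rw [norm_pow]; gcongr) (by rw [norm_pow]; gcongr)
  have : padeForm r ξ₁ η₁ ξ₂ η₂ =
      (ξ₁ * padeEval r (ξ₁ ^ 3) (η₁ ^ 3) - η₁ * padeEval r (η₁ ^ 3) (ξ₁ ^ 3)) * η₂ -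
        η₁ * padeEval r (η₁ ^ 3) (ξ₁ ^ 3) * (ξ₂ - η₂) := by
    rw [padeForm]; ring
  rw [this]
  refine (norm_sub_le _ _).trans (add_le_add ?_ ?_)
  · rw [norm_mul]
    refine mul_le_mul (h1.trans ?_) hη' (norm_nonneg _) ?_
    · gcongr
    · have : 0 ≤ l := (norm_nonneg _).trans hl
      positivity
  · rw [norm_mul, norm_mul]
    refine mul_le_mul ?_ hl' (norm_nonneg _) (by positivity)
    exact mul_le_mul hη h2 (norm_nonneg _) hX

theorem pade_first_term_lt (r : ℕ) (X Z l Δ m q : ℝ) (hq : 1 ≤ q) (hX : X = q ^ 2) (hl0 : 0 ≤ l)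
    (hZ0 : 0 ≤ Z) (hm : 1 ≤ m) (hΔ : 1 ≤ Δ) (hl : l * X ^ 2 ≤ 2 * Δ * m)
    (hQ : 1000000 * (m ^ 2 * Δ ^ 2) ≤ q) (hZ : Z ≤ q ^ (5 * r)) :
    8 * 1152 ^ r * (3 * l) ^ (2 * r + 1) * (3 * X) ^ r * (3 * Z) < Δ / 2 := by
  have hq0 : 0 < q := by linarith
  have hpos : 0 < q ^ (8 * r + 4) := by positivity
  refine lt_of_mul_lt_mul_right ?_ hpos.le
  have h1 : (3 * l * q ^ 4) ^ (2 * r + 1) ≤ (6 * (Δ * m)) ^ (2 * r + 1) := by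
    refine pow_le_pow_left₀ (by positivity) ?_ _
    rw [hX] at hl
    nlinarith
  have e1 : q ^ (8 * r + 4) = (q ^ 4) ^ (2 * r + 1) := by rw [← pow_mul]; congr 1; ring
  calc 8 * 1152 ^ r * (3 * l) ^ (2 * r + 1) * (3 * X) ^ r * (3 * Z) * q ^ (8 * r + 4)
      = 24 * 1152 ^ r * (3 * l * q ^ 4) ^ (2 * r + 1) * (3 * X) ^ r * Z := by
        rw [e1, mul_pow (3 * l)]; ring
    _ ≤ 24 * 1152 ^ r * (6 * (Δ * m)) ^ (2 * r + 1) * (3 * q ^ 2) ^ r * q ^ (5 * r) := by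
        rw [hX]
        gcongr
    _ = 144 * (Δ * m) * (124416 * (m ^ 2 * Δ ^ 2)) ^ r * q ^ (7 * r) := by
        rw [show (124416 : ℝ) = 1152 * 36 * 3 by norm_num, pow_add, pow_mul (6 * (Δ * m))]
        simp only [mul_pow]
        rw [show (6 : ℝ) ^ 2 = 36 by norm_num, ← pow_mul q,
          show 7 * r = 2 * r + 5 * r by ring, pow_add]
        ring
    _ ≤ 144 * (Δ * m) * q ^ r * q ^ (7 * r) := by
        gcongr
        refine le_trans ?_ hQ
        gcongr
        norm_num
    _ = (144 * m) * (Δ * q ^ (8 * r)) := by rw [show 8 * r = r + 7 * r by ring, pow_add]; ring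
    _ < (q ^ 4 / 2) * (Δ * q ^ (8 * r)) := by
        refine mul_lt_mul_of_pos_right ?_ (by positivity)
        have h2' : m * 1 ≤ m ^ 2 * Δ ^ 2 := mul_le_mul (le_self_pow₀ hm two_ne_zero)
            (one_le_pow₀ hΔ) zero_le_one (by positivity)
        have h2 : 1000000 * m ≤ q := by linarith
        have h3 : q ≤ q ^ 4 := le_self_pow₀ hq (by norm_num)
        linarith
    _ = Δ / 2 * q ^ (8 * r + 4) := by rw [pow_add]; ring

theorem pade_second_term_lt (r : ℕ) (X Z l Δ m q : ℝ) (hq : 1 ≤ q) (hX : X = q ^ 2) (hl0 : 0 ≤ l)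
    (hZ0 : 0 < Z) (hm : 1 ≤ m) (hΔ : 1 ≤ Δ) (hl : l * Z ^ 2 ≤ 2 * Δ * m)
    (hQ : 1000000 * (m ^ 2 * Δ ^ 2) ≤ q) (hZ : q ^ (7 * r + 4) ≤ Z ^ 2) :
    3 * X * (4 * 72 ^ r * ((3 * X) ^ 3) ^ r) * (3 * l) < Δ / 2 := by
  have hq0 : 0 < q := by linarith
  have hpos : 0 < Z ^ 2 := by positivity
  refine lt_of_mul_lt_mul_right ?_ hpos.le
  have h2' : m * 1 ≤ m ^ 2 * Δ ^ 2 := mul_le_mul (le_self_pow₀ hm two_ne_zero)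
      (one_le_pow₀ hΔ) zero_le_one (by positivity)
  have h2 : 1000000 * m ≤ q := by linarith
  have h5 : (1944 : ℝ) ≤ q := by linarith
  calc 3 * X * (4 * 72 ^ r * ((3 * X) ^ 3) ^ r) * (3 * l) * Z ^ 2
      = 36 * 1944 ^ r * (X * (X ^ 3) ^ r) * (l * Z ^ 2) := by
        rw [show (1944 : ℝ) = 72 * 3 ^ 3 by norm_num]
        simp only [mul_pow]
        ring
    _ ≤ 36 * q ^ r * (X * (X ^ 3) ^ r) * (2 * Δ * m) := by
        have : 0 ≤ X := by rw [hX]; positivity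
        gcongr
    _ = 72 * m * (Δ * q ^ (7 * r + 2)) := by
        rw [hX, ← pow_mul, ← pow_mul, show 7 * r + 2 = r + (2 + 2 * 3 * r) by ring, pow_add q r,
          pow_add]
        ring
    _ < q ^ 2 / 2 * (Δ * q ^ (7 * r + 2)) := by
        refine mul_lt_mul_of_pos_right ?_ (by positivity)
        have h3 : q ≤ q ^ 2 := le_self_pow₀ hq (by norm_num)
        linarith
    _ = Δ / 2 * q ^ (7 * r + 4) := by rw [pow_add, pow_add]; ring
    _ ≤ Δ / 2 * Z ^ 2 := by gcongr

theorem exists_cubeRoot_of_unity : ∃ ω : ℂ, ω ^ 2 + ω + 1 = 0 ∧ ‖ω‖ ≤ 1 := by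
  obtain ⟨s, hs⟩ := IsAlgClosed.exists_pow_nat_eq (-3 : ℂ) (n := 2) (by norm_num)
  have h : ((s - 1) / 2) ^ 2 + (s - 1) / 2 + 1 = 0 := by linear_combination hs / 4
  refine ⟨(s - 1) / 2, h, ?_⟩
  have h3 : ((s - 1) / 2) ^ 3 = 1 := by linear_combination ((s - 1) / 2 - 1) * h
  have := congrArg norm h3
  rw [norm_pow, norm_one] at this
  exact (pow_eq_one_iff_of_nonneg (norm_nonneg _) (by norm_num)).1 this |>.le

/-- Two solutions of a cubic Thue equation close to the same root cannot be too far apart in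
size. -/
theorem no_far_pair {c : Fin 4 → ℤ} {a b : Fin 3 → ℂ} (h : CubicSplits c a b) (D : ℤ)
    (hD : (D : ℂ) = cubicSqrtDisc a b ^ 2) (m : ℕ) (hm : 1 ≤ m) (x y x' y' : ℤ)
    (hv : binEval c x y = m) (hdet : x * y' - x' * y ≠ 0) (X Z q : ℝ)
    (hLX : ∀ i, ‖cubicFactor a b i x y‖ ≤ X) (hLZ : ∀ i, ‖cubicFactor a b i x' y'‖ ≤ Z)
    (hlX : ‖cubicFactor a b 0 x y‖ * X ^ 2 ≤ 2 * ‖cubicSqrtDisc a b‖ * m)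
    (hlZ : ‖cubicFactor a b 0 x' y'‖ * Z ^ 2 ≤ 2 * ‖cubicSqrtDisc a b‖ * m)
    (hΔ : 1 ≤ ‖cubicSqrtDisc a b‖) (hq : 1 ≤ q) (hXq : X = q ^ 2)
    (hQ : 1000000 * ((m : ℝ) ^ 2 * ‖cubicSqrtDisc a b‖ ^ 2) ≤ q)
    (hZq : q ^ 44 ≤ Z) : False := by
  obtain ⟨ω, hω, hωn⟩ := exists_cubeRoot_of_unity
  set δ := cubicSqrtDisc a b with hδ
  set L := fun i => cubicFactor a b i x y with hL
  set K := fun i => cubicFactor a b i x' y' with hK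
  have hL0 : L 0 + L 1 + L 2 = 0 := cubicFactor_sum a b x y
  have hK0 : K 0 + K 1 + K 2 = 0 := cubicFactor_sum a b x' y'
  set ξ₁ := L 0 + ω * L 1 + ω ^ 2 * L 2 with hξ₁
  set η₁ := -(L 0 + ω ^ 2 * L 1 + ω * L 2) with hη₁
  set ξ₂ := K 0 + ω * K 1 + ω ^ 2 * K 2 with hξ₂
  set η₂ := -(K 0 + ω ^ 2 * K 1 + ω * K 2) with hη₂
  obtain ⟨r1, r2, r3⟩ := cubic_resolvent ω (L 0) (L 1) (L 2) hω hL0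
  obtain ⟨r1', -, -⟩ := cubic_resolvent ω (K 0) (K 1) (K 2) hω hK0
  obtain ⟨r4, r5⟩ := cubic_resolvent_pair ω (L 0) (L 1) (L 2) (K 0) (K 1) (K 2) hω hL0 hK0
  rw [← hξ₁, ← hη₁] at r1 r2 r3
  rw [← hξ₂, ← hη₂] at r1'
  rw [← hξ₁, ← hη₁, ← hξ₂, ← hη₂] at r4 r5
  have hprod : L 0 * L 1 * L 2 = δ * m := by
    have := cubicFactor_prod h x y
    rw [hv] at this
    simpa using this
  have hdet' : L 0 * K 1 - L 1 * K 0 = -(δ * ((x * y' - x' * y : ℤ) : ℂ)) := by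
    have := cubicFactor_det a b x y x' y'
    push_cast
    exact this
  obtain ⟨G, hG⟩ := cubicFactor_covariant h x y
  obtain ⟨P, hP⟩ := cubicFactor_polar h x y x' y'
  change (L 0 - L 1) * (L 1 - L 2) * (L 2 - L 0) = G at hG
  change L 0 * K 1 + L 1 * K 0 + (L 0 * K 2 + L 2 * K 0) + (L 1 * K 2 + L 2 * K 1) = P at hP
  rw [hP] at r4
  rw [hdet'] at r5
  rw [hG] at r3
  rw [hprod] at r2
  have hw : (2 * ω + 1) ^ 2 = -3 := by linear_combination 4 * hω
  have hwn : 1 ≤ ‖2 * ω + 1‖ := by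
    have := congrArg norm hw
    rw [norm_pow, norm_neg, Complex.norm_ofNat] at this
    nlinarith [norm_nonneg (2 * ω + 1)]
  set τ := -((2 * ω + 1) * δ) with hτ
  set κ := 3 * (2 * ω + 1) / 2 with hκ
  have hτ2 : τ * τ = ((-3 * D : ℤ) : ℂ) := by
    push_cast
    rw [hD, hτ]
    linear_combination δ ^ 2 * hw
  have h1 : ξ₁ ^ 3 = κ * (((-G : ℤ) : ℂ) + ((3 * m : ℤ) : ℂ) * τ) := by
    push_cast
    rw [hκ, hτ]
    linear_combination (r2 + r3) / 2 + 9 * δ * m * hw / 2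
  have h2 : η₁ ^ 3 = κ * (((-G : ℤ) : ℂ) - ((3 * m : ℤ) : ℂ) * τ) := by
    push_cast
    rw [hκ, hτ]
    linear_combination (r3 - r2) / 2 - 9 * δ * m * hw / 2
  have h3 : ξ₁ * η₂ + ξ₂ * η₁ = ((3 * P : ℤ) : ℂ) := by
    push_cast
    exact r4
  have h4 : ξ₁ * η₂ - ξ₂ * η₁ = ((3 * (x * y' - x' * y) : ℤ) : ℂ) * τ := by
    rw [r5]
    push_cast
    rw [hτ]
    ring
  have hδ0 : δ ≠ 0 := by
    rintro h0
    rw [h0, norm_zero] at hΔ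
    linarith
  have hm0 : (m : ℂ) ≠ 0 := by
    have : m ≠ 0 := by omega
    exact_mod_cast this
  have hw0 : (2 * ω + 1) ≠ 0 := by
    rintro h0
    rw [h0, norm_zero] at hwn
    linarith
  have hne3 : ξ₁ ^ 3 ≠ η₁ ^ 3 := by
    rw [← sub_ne_zero, r2]
    exact mul_ne_zero (by norm_num) (mul_ne_zero hδ0 hm0)
  have hne1 : ξ₁ * η₂ - ξ₂ * η₁ ≠ 0 := by
    rw [h4]
    refine mul_ne_zero ?_ (neg_ne_zero.2 (mul_ne_zero hw0 hδ0))
    exact_mod_cast mul_ne_zero (by norm_num : (3 : ℤ) ≠ 0) hdet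
  have hZ1 : 1 ≤ Z := (one_le_pow₀ hq).trans hZq
  have hX0 : 0 ≤ X := by rw [hXq]; positivity
  have hq3 : (3 : ℝ) < q := by
    have : (1 : ℝ) ≤ m := by exact_mod_cast hm
    have : 1 ≤ (m : ℝ) ^ 2 * ‖δ‖ ^ 2 := one_le_mul_of_one_le_of_one_le (one_le_pow₀ this)
      (one_le_pow₀ hΔ)
    linarith
  have hω2 : ‖ω ^ 2‖ ≤ 1 := by rw [norm_pow]; exact pow_le_one₀ (norm_nonneg _) hωn
  have hbd : ∀ (B : ℝ) (J : Fin 3 → ℂ) (u v : ℂ), (∀ i, ‖J i‖ ≤ B) → ‖u‖ ≤ 1 → ‖v‖ ≤ 1 →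
      ‖J 0 + u * J 1 + v * J 2‖ ≤ 3 * B := by
    intro B J u v hJ hu hv
    have hB : 0 ≤ B := (norm_nonneg _).trans (hJ 0)
    refine (norm_add₃_le).trans ?_
    rw [norm_mul, norm_mul]
    have i1 := mul_le_mul hu (hJ 1) (norm_nonneg _) zero_le_one
    have i2 := mul_le_mul hv (hJ 2) (norm_nonneg _) zero_le_one
    have := hJ 0
    linarith
  have lower : ∀ r, padeForm r ξ₁ η₁ ξ₂ η₂ ≠ 0 → ‖δ‖ ≤ ‖padeForm r ξ₁ η₁ ξ₂ η₂‖ := by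
    intro r hr
    obtain ⟨n, hn⟩ := exists_padeForm_eq r _ _ _ _ _ κ τ ξ₁ η₁ ξ₂ η₂ hτ2 h1 h2 h3 h4
    rw [padeForm, hn] at hr ⊢
    have hn0 : n ≠ 0 := by rintro rfl; simp at hr
    rw [norm_mul, norm_mul, norm_pow, Complex.norm_intCast]
    have i1 : (1 : ℝ) ≤ |(n : ℝ)| := by exact_mod_cast Int.one_le_abs hn0
    have i2 : 1 ≤ ‖κ‖ := by
      rw [hκ, norm_div, norm_mul, Complex.norm_ofNat, Complex.norm_ofNat]
      linarith
    have i3 : ‖δ‖ ≤ ‖τ‖ := by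
      rw [hτ, norm_neg, norm_mul]
      nlinarith
    have i4 : 1 ≤ ‖κ‖ ^ r := one_le_pow₀ i2
    calc ‖δ‖ = 1 * (1 * ‖δ‖) := by ring
      _ ≤ _ := by gcongr
  obtain ⟨r, hr1, hr2⟩ := exists_nat_pow_near hZ1 (y := q ^ 4) (one_lt_pow₀ (by linarith) (by norm_num))
  rw [← pow_mul] at hr1 hr2
  have hr11 : 11 ≤ r := by
    have := (pow_lt_pow_iff_right₀ (by linarith : (1 : ℝ) < q)).1 (hZq.trans_lt hr2)
    omega
  have upper : ∀ s, (s = r ∨ s = r + 1) → ‖padeForm s ξ₁ η₁ ξ₂ η₂‖ < ‖δ‖ := by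
    intro s hs
    have hm1 : (1 : ℝ) ≤ m := by exact_mod_cast hm
    have b1 := norm_padeForm_le s ξ₁ η₁ ξ₂ η₂ (3 * X) (3 * Z) (3 * ‖L 0‖) (3 * ‖K 0‖)
      (hbd X L _ _ hLX hωn hω2) (by rw [hη₁, norm_neg]; exact hbd X L _ _ hLX hω2 hωn)
      (by rw [r1, norm_mul, Complex.norm_ofNat]) (by have := hLX 0; linarith)
      (by rw [hη₂, norm_neg]; exact hbd Z K _ _ hLZ hω2 hωn)
      (by rw [r1', norm_mul, Complex.norm_ofNat])
    have b2 := pade_first_term_lt s X Z ‖L 0‖ ‖δ‖ m q hq hXq (norm_nonneg _) (by linarith) hm1 hΔ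
      hlX hQ (hr2.le.trans (pow_le_pow_right₀ hq (by omega)))
    have b3 := pade_second_term_lt s X Z ‖K 0‖ ‖δ‖ m q hq hXq (norm_nonneg _) (by linarith) hm1 hΔ
      hlZ hQ (by
        refine le_trans ?_ (pow_le_pow_left₀ (by positivity) hr1 2)
        rw [← pow_mul]
        exact pow_le_pow_right₀ hq (by omega))
    linarith
  rcases padeForm_ne_zero r ξ₁ η₁ ξ₂ η₂ hne3 hne1 with h0 | h0
  · exact absurd (lower _ h0) (not_le.2 (upper r (.inl rfl)))
  · exact absurd (lower _ h0) (not_le.2 (upper (r + 1) (.inr rfl)))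

theorem binEval_cubic_eq_of_det_eq_zero (c : Fin 4 → ℤ) (m x y x' y' : ℤ) (hm : m ≠ 0)
    (h : binEval c x y = m) (h' : binEval c x' y' = m) (hdet : x * y' - x' * y = 0) :
    x = x' ∧ y = y' := by
  rw [binEval_cubic] at h h'
  have hinj : Function.Injective (fun t : ℤ => t ^ 3) := (Odd.strictMono_pow (by decide)).injective
  have hd : x * y' = x' * y := by linarith
  constructor
  · apply hinj
    apply mul_right_cancel₀ hm
    change x ^ 3 * m = x' ^ 3 * m
    have : x ^ 3 * (c 0 * x' ^ 3 + c 1 * x' ^ 2 * y' + c 2 * x' * y' ^ 2 + c 3 * y' ^ 3) =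
        x' ^ 3 * (c 0 * x ^ 3 + c 1 * x ^ 2 * y + c 2 * x * y ^ 2 + c 3 * y ^ 3) := by
      grind
    rw [h, h'] at this
    exact this
  · apply hinj
    apply mul_right_cancel₀ hm
    change y ^ 3 * m = y' ^ 3 * m
    have : y ^ 3 * (c 0 * x' ^ 3 + c 1 * x' ^ 2 * y' + c 2 * x' * y' ^ 2 + c 3 * y' ^ 3) =
        y' ^ 3 * (c 0 * x ^ 3 + c 1 * x ^ 2 * y + c 2 * x * y ^ 2 + c 3 * y ^ 3) := by
      grind
    rw [h, h'] at this
    exact this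

theorem doubling_chain (y : ℕ → ℝ) (h0 : ∀ i, 0 ≤ y i) (n : ℕ) (h : ∀ i < n, y i ^ 2 ≤ y (i + 1))
    (i j : ℕ) (hij : i + j ≤ n) : y i ^ 2 ^ j ≤ y (i + j) := by
  induction j with
  | zero => simp
  | succ j ih =>
    rw [pow_succ, pow_mul]
    exact (pow_le_pow_left₀ (pow_nonneg (h0 i) _) (ih (by omega)) 2).trans (h _ (by omega))

theorem chain_growth (M : ℕ → ℝ) (m Δ : ℝ) (hm : 1 ≤ m) (hM : ∀ i, 0 ≤ M i)
    (hgap : ∀ i < 11, M i ^ 2 ≤ 4 * m * M (i + 1)) (hΔM : Δ ≤ 2 * M 0 * M 1)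
    (hbig : 10 ^ 10 * m ^ 10 ≤ Δ) :
    1000000 * (m ^ 2 * Δ ^ 2) ≤ √(M 6) ∧ M 6 ^ 22 ≤ M 11 ∧ 1 ≤ M 6 := by
  have hm0 : 0 < m := by linarith
  have hmp : ∀ n, 1 ≤ m ^ n := fun n => one_le_pow₀ hm
  have hΔ1 : 10 ^ 10 ≤ Δ := le_trans (by linarith [hmp 10]) hbig
  have hΔ0 : 0 < Δ := by linarith
  set y : ℕ → ℝ := fun i => M i / (4 * m) with hy
  have hMy : ∀ i, M i = 4 * m * y i := fun i => by simp only [hy]; field_simp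
  have hy0 : ∀ i, 0 ≤ y i := fun i => div_nonneg (hM i) (by linarith)
  have hy2 : ∀ i < 11, y i ^ 2 ≤ y (i + 1) := by
    intro i hi
    have := hgap i hi
    rw [hMy i, hMy (i + 1)] at this
    have h16 : 0 < 16 * m ^ 2 := by positivity
    nlinarith
  have hch := doubling_chain y hy0 11 hy2
  have h1 : Δ ≤ y 1 ^ 3 := by
    have e1 : Δ ^ 2 ≤ (2 * M 0 * M 1) ^ 2 := pow_le_pow_left₀ hΔ0.le hΔM 2
    have e2 : (2 * M 0 * M 1) ^ 2 ≤ 16 * m * M 1 ^ 3 := by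
      have := mul_le_mul_of_nonneg_right (hgap 0 (by norm_num)) (sq_nonneg (M 1))
      rw [zero_add] at this
      nlinarith
    rw [hMy 1] at e1 e2
    have e3 : Δ * (1024 * m ^ 4) ≤ Δ ^ 2 := by
      rw [sq]
      refine mul_le_mul_of_nonneg_left (le_trans ?_ hbig) hΔ0.le
      have : m ^ 4 ≤ m ^ 10 := pow_le_pow_right₀ hm (by norm_num)
      nlinarith [hmp 4]
    have e4 : Δ * (1024 * m ^ 4) ≤ y 1 ^ 3 * (1024 * m ^ 4) := by linarith
    exact le_of_mul_le_mul_right e4 (by positivity)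
  have h2 : 1 ≤ y 1 := by
    by_contra! hlt
    have := pow_le_one₀ (n := 3) (hy0 1) hlt.le
    linarith
  have h6 : Δ ^ 10 ≤ y 6 := by
    calc Δ ^ 10 ≤ (y 1 ^ 3) ^ 10 := pow_le_pow_left₀ hΔ0.le h1 10
      _ = y 1 ^ 30 := by ring
      _ ≤ y 1 ^ 2 ^ 5 := pow_le_pow_right₀ h2 (by norm_num)
      _ ≤ _ := hch 1 5 (by norm_num)
  have hΔp : 1 ≤ Δ := by linarith
  have hmΔ : 10 ^ 10 * m ≤ Δ := le_trans (by
    gcongr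
    exact le_self_pow₀ hm (by norm_num)) hbig
  have h61 : 1 ≤ y 6 := (one_le_pow₀ hΔp).trans h6
  refine ⟨?_, ?_, ?_⟩
  · apply Real.le_sqrt_of_sq_le
    rw [hMy]
    calc (1000000 * (m ^ 2 * Δ ^ 2)) ^ 2 = ((10 ^ 3 * m) ^ 4) * Δ ^ 4 := by ring
      _ ≤ Δ ^ 4 * Δ ^ 4 := by
        gcongr
        linarith
      _ = Δ ^ 8 := by ring
      _ ≤ Δ ^ 10 := pow_le_pow_right₀ hΔp (by norm_num)
      _ ≤ 1 * y 6 := by rw [one_mul]; exact h6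
      _ ≤ 4 * m * y 6 := by gcongr; linarith
  · rw [hMy 6, hMy 11, mul_pow]
    have e1 : (4 * m) ^ 21 ≤ y 6 ^ 10 := by
      calc (4 * m) ^ 21 ≤ Δ ^ 21 := by gcongr; linarith
        _ ≤ Δ ^ 100 := pow_le_pow_right₀ hΔp (by norm_num)
        _ = (Δ ^ 10) ^ 10 := by ring
        _ ≤ _ := pow_le_pow_left₀ (by positivity) h6 10
    calc (4 * m) ^ 22 * y 6 ^ 22 = (4 * m) * ((4 * m) ^ 21 * y 6 ^ 22) := by ring
      _ ≤ 4 * m * (y 6 ^ 10 * y 6 ^ 22) := by have := hy0 6; gcongr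
      _ = 4 * m * y 6 ^ 2 ^ 5 := by ring
      _ ≤ 4 * m * y 11 := by
        gcongr
        exact hch 6 5 (by norm_num)
  · rw [hMy]
    nlinarith

theorem cubicFactor_det_norm (a b : Fin 3 → ℂ) (x y x' y' : ℤ) (hdet : x * y' - x' * y ≠ 0) :
    ‖cubicSqrtDisc a b‖ ≤ ‖cubicFactor a b 0 x y‖ * ‖cubicFactor a b 1 x' y'‖ +
      ‖cubicFactor a b 1 x y‖ * ‖cubicFactor a b 0 x' y'‖ := by
  have h := cubicFactor_det a b x y x' y'
  rw [show ((x : ℂ) * y' - x' * y) = ((x * y' - x' * y : ℤ) : ℂ) by push_cast; ring] at h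
  have h1 : (1 : ℝ) ≤ ‖((x * y' - x' * y : ℤ) : ℂ)‖ := by
    rw [Complex.norm_intCast]
    exact_mod_cast Int.one_le_abs hdet
  calc ‖cubicSqrtDisc a b‖ ≤ ‖cubicSqrtDisc a b‖ * ‖((x * y' - x' * y : ℤ) : ℂ)‖ :=
        le_mul_of_one_le_right (norm_nonneg _) h1
    _ = ‖-(cubicSqrtDisc a b * ((x * y' - x' * y : ℤ) : ℂ))‖ := by rw [norm_neg, norm_mul]
    _ ≤ _ := by
      rw [← h]
      refine (norm_sub_le _ _).trans ?_
      rw [norm_mul, norm_mul]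

/-- A cubic Thue equation with large discriminant has at most eleven solutions close to a given
root. -/
theorem card_solutions_near_root_le {c : Fin 4 → ℤ} {a b : Fin 3 → ℂ} (h : CubicSplits c a b)
    (D : ℤ) (hD : (D : ℂ) = cubicSqrtDisc a b ^ 2) (m : ℕ) (hm : 1 ≤ m)
    (hbig : 10 ^ 10 * (m : ℝ) ^ 10 ≤ ‖cubicSqrtDisc a b‖)
    (S : Finset (ℤ × ℤ)) (hS : ∀ v ∈ S, binEval c v.1 v.2 = m)
    (hcls : ∀ v ∈ S, ∀ j, ‖cubicFactor a b 0 v.1 v.2‖ ≤ ‖cubicFactor a b j v.1 v.2‖) :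
    S.card ≤ 11 := by
  by_contra! hcard
  obtain ⟨S', hS', hcard'⟩ := exists_subset_card_eq (n := 12) hcard
  have hm1 : (1 : ℝ) ≤ m := by exact_mod_cast hm
  set L : Fin 3 → ℤ × ℤ → ℂ := fun i v => cubicFactor a b i v.1 v.2 with hL
  set Δ := ‖cubicSqrtDisc a b‖ with hΔ
  have hΔ1 : 1 ≤ Δ := le_trans (by nlinarith [one_le_pow₀ (n := 10) hm1]) hbig
  set N : ℤ × ℤ → ℝ := fun v => max ‖L 1 v‖ ‖L 2 v‖ with hN
  have hLN : ∀ v ∈ S, ∀ i, ‖L i v‖ ≤ N v := by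
    intro v hv i
    fin_cases i
    · exact (hcls v hv 1).trans (le_max_left _ _)
    · exact le_max_left _ _
    · exact le_max_right _ _
  have hsmall : ∀ v ∈ S, ‖L 0 v‖ * N v ^ 2 ≤ 2 * Δ * m := by
    intro v hv
    have h1 : L 0 v + L 1 v + L 2 v = 0 := cubicFactor_sum _ _ _ _
    have h2 := cubicFactor_prod h v.1 v.2
    rw [hS v hv] at h2
    have h3 : ‖L 0 v‖ * ‖L 1 v‖ * ‖L 2 v‖ = Δ * m := by
      rw [← norm_mul, ← norm_mul]
      change ‖cubicFactor a b 0 v.1 v.2 * cubicFactor a b 1 v.1 v.2 * cubicFactor a b 2 v.1 v.2‖ = _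
      rw [h2, norm_mul]
      simp [hΔ]
    have h4 : ‖L 1 v‖ ≤ 2 * ‖L 2 v‖ := by
      rw [show L 1 v = -(L 0 v + L 2 v) by linear_combination h1, norm_neg]
      have := norm_add_le (L 0 v) (L 2 v)
      have h0 : ‖L 0 v‖ ≤ ‖L 2 v‖ := hcls v hv 2
      linarith
    have h5 : ‖L 2 v‖ ≤ 2 * ‖L 1 v‖ := by
      rw [show L 2 v = -(L 0 v + L 1 v) by linear_combination h1, norm_neg]
      have := norm_add_le (L 0 v) (L 1 v)
      have h0 : ‖L 0 v‖ ≤ ‖L 1 v‖ := hcls v hv 1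
      linarith
    have h6 : N v ^ 2 ≤ 2 * (‖L 1 v‖ * ‖L 2 v‖) := by
      have n1 := norm_nonneg (L 1 v)
      have n2 := norm_nonneg (L 2 v)
      rcases max_choice ‖L 1 v‖ ‖L 2 v‖ with hc | hc <;> simp only [hN, hc] <;> nlinarith
    calc ‖L 0 v‖ * N v ^ 2 ≤ ‖L 0 v‖ * (2 * (‖L 1 v‖ * ‖L 2 v‖)) := by gcongr
      _ = 2 * (‖L 0 v‖ * ‖L 1 v‖ * ‖L 2 v‖) := by ring
      _ = _ := by rw [h3]; ring
  set e := (S'.equivFinOfCardEq hcard').symm with he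
  set g : Fin 12 → ℝ := fun i => N (e i) with hg
  have hmono := Tuple.monotone_sort g
  set w : ℕ → ℤ × ℤ := fun i => if hi : i < 12 then e (Tuple.sort g ⟨i, hi⟩) else 0 with hw
  have hwS : ∀ i < 12, w i ∈ S := by
    intro i hi
    simp only [hw, hi, dite_true]
    exact hS' (e _).2
  have hwne : ∀ i < 12, ∀ j < 12, i ≠ j →
      (w i).1 * (w j).2 - (w j).1 * (w i).2 ≠ 0 := by
    intro i hi j hj hij hdet
    have := binEval_cubic_eq_of_det_eq_zero c m _ _ _ _ (by exact_mod_cast (by omega : m ≠ 0))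
      (hS _ (hwS i hi)) (hS _ (hwS j hj)) hdet
    have h2 : w i = w j := Prod.ext this.1 this.2
    simp only [hw, hi, hj, dite_true] at h2
    have h3 := (Tuple.sort g).injective (e.injective (Subtype.ext h2))
    exact hij (by simpa using h3)
  have hwmono : ∀ i < 11, N (w i) ≤ N (w (i + 1)) := by
    intro i hi
    have := hmono (show (⟨i, by omega⟩ : Fin 12) ≤ ⟨i + 1, by omega⟩ by simp)
    simpa only [hw, show i < 12 by omega, show i + 1 < 12 by omega, dite_true, hg, Function.comp_apply] using this
  have hN0 : ∀ v, 0 ≤ N v := fun v => (norm_nonneg _).trans (le_max_left _ _)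
  have hgap : ∀ i < 11, N (w i) ^ 2 ≤ 4 * m * N (w (i + 1)) := by
    intro i hi
    have hi1 := hwS i (by omega)
    have hi2 := hwS (i + 1) (by omega)
    have h1 := cubicFactor_det_norm a b _ _ _ _ (hwne i (by omega) (i + 1) (by omega) (by omega))
    have h2 := hLN _ hi1
    have h3 := hLN _ hi2
    have h4 := hsmall _ hi1
    have h5 := hsmall _ hi2
    have h6 := hwmono i hi
    have h7 : Δ ≤ ‖L 0 (w i)‖ * N (w (i + 1)) + N (w i) * ‖L 0 (w (i + 1))‖ :=
      h1.trans (add_le_add (mul_le_mul_of_nonneg_left (h3 1) (norm_nonneg _))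
        (mul_le_mul_of_nonneg_right (h2 1) (norm_nonneg _)))
    have p := hN0 (w i)
    have p' := hN0 (w (i + 1))
    have h8 : Δ * N (w i) ^ 2 ≤ Δ * (4 * m * N (w (i + 1))) := by
      calc Δ * N (w i) ^ 2
          ≤ (‖L 0 (w i)‖ * N (w (i + 1)) + N (w i) * ‖L 0 (w (i + 1))‖) * N (w i) ^ 2 := by gcongr
        _ = (‖L 0 (w i)‖ * N (w i) ^ 2) * N (w (i + 1)) +
            ‖L 0 (w (i + 1))‖ * (N (w i) * N (w i)) * N (w i) := by ring
        _ ≤ (2 * Δ * m) * N (w (i + 1)) +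
            ‖L 0 (w (i + 1))‖ * (N (w (i + 1)) * N (w (i + 1))) * N (w (i + 1)) := by gcongr
        _ = (2 * Δ * m) * N (w (i + 1)) + (‖L 0 (w (i + 1))‖ * N (w (i + 1)) ^ 2) *
              N (w (i + 1)) := by ring
        _ ≤ (2 * Δ * m) * N (w (i + 1)) + (2 * Δ * m) * N (w (i + 1)) := by gcongr
        _ = _ := by ring
    exact le_of_mul_le_mul_left h8 (by linarith)
  have hΔM : Δ ≤ 2 * N (w 0) * N (w 1) := by
    have h1 := cubicFactor_det_norm a b _ _ _ _ (hwne 0 (by omega) 1 (by omega) (by omega))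
    have h2 := hLN _ (hwS 0 (by omega))
    have h3 := hLN _ (hwS 1 (by omega))
    refine h1.trans ?_
    have i1 := mul_le_mul (h2 0) (h3 1) (norm_nonneg _) (hN0 _)
    have i2 := mul_le_mul (h2 1) (h3 0) (norm_nonneg _) (hN0 _)
    simp only [hL] at i1 i2
    linarith
  obtain ⟨g1, g2, g3⟩ := chain_growth (fun i => N (w i)) m Δ hm1 (fun i => hN0 _) hgap hΔM hbig
  have hsq : N (w 6) = √(N (w 6)) ^ 2 := (Real.sq_sqrt (hN0 _)).symm
  refine no_far_pair h D hD m hm _ _ _ _ (hS _ (hwS 6 (by omega)))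
    (hwne 6 (by omega) 11 (by omega) (by omega)) (N (w 6)) (N (w 11)) (√(N (w 6)))
    (hLN _ (hwS 6 (by omega))) (hLN _ (hwS 11 (by omega))) (hsmall _ (hwS 6 (by omega)))
    (hsmall _ (hwS 11 (by omega))) hΔ1 (Real.one_le_sqrt.2 g3) hsq g1 ?_
  rw [show 44 = 2 * 22 by norm_num, pow_mul, ← hsq]
  exact g2

theorem cubicFactor_rotate (a b : Fin 3 → ℂ) (i j : Fin 3) (x y : ℂ) :
    cubicFactor (fun k => a (k + i)) (fun k => b (k + i)) j x y = cubicFactor a b (j + i) x y := by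
  simp only [cubicFactor, add_right_comm]

theorem cubicSqrtDisc_rotate (a b : Fin 3 → ℂ) (i : Fin 3) :
    cubicSqrtDisc (fun k => a (k + i)) (fun k => b (k + i)) = cubicSqrtDisc a b := by
  fin_cases i <;> simp [cubicSqrtDisc] <;> ring

theorem CubicSplits.rotate {c : Fin 4 → ℤ} {a b : Fin 3 → ℂ} (h : CubicSplits c a b) (i : Fin 3) :
    CubicSplits c (fun k => a (k + i)) (fun k => b (k + i)) := by
  refine CubicSplits.of_eval fun x y => ?_
  rw [h.eval]
  exact (Fintype.prod_equiv (Equiv.addRight i) _ _ fun k => rfl).symm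

/-- A cubic Thue equation with large discriminant has at most `33` solutions. -/
theorem card_solutions_le {c : Fin 4 → ℤ} (D : ℤ) (hD : IsDisc c D) (m : ℕ) (hm : 1 ≤ m)
    (hbig : (m : ℝ) ^ 20 * (3.5 : ℝ) ^ 30 * 3 ^ 15 < (|D| : ℝ))
    (S : Finset (ℤ × ℤ)) (hS : ∀ v ∈ S, binEval c v.1 v.2 = m) : S.card ≤ 33 := by
  obtain ⟨a, b, hab, hDe⟩ := hD
  rw [prod_disc_eq] at hDe
  have h := CubicSplits.of_eval hab
  have hbig' : 10 ^ 10 * (m : ℝ) ^ 10 ≤ ‖cubicSqrtDisc a b‖ := by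
    have h1 : |(D : ℝ)| = ‖cubicSqrtDisc a b‖ ^ 2 := by
      rw [← norm_pow, ← hDe, Complex.norm_intCast]
    refine le_of_sq_le_sq ?_ (norm_nonneg _)
    rw [← h1]
    refine le_trans ?_ hbig.le
    have : 0 ≤ (m : ℝ) ^ 20 := by positivity
    norm_num
    nlinarith
  by_contra! hcard
  choose f hf using fun v : ℤ × ℤ => Finite.exists_min (fun i => ‖cubicFactor a b i v.1 v.2‖)
  obtain ⟨i, -, hi⟩ := exists_lt_card_fiber_of_mul_lt_card_of_maps_to (s := S)
    (t := (univ : Finset (Fin 3))) (f := f) (n := 11) (fun v _ => mem_univ _) (by simpa using hcard)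
  have := card_solutions_near_root_le (h.rotate i) D (by rw [cubicSqrtDisc_rotate, hDe]) m hm
    (by rw [cubicSqrtDisc_rotate]; exact hbig') (S.filter (fun v => f v = i))
    (fun v hv => hS v (mem_filter.1 hv).1) (by
      intro v hv j
      rw [cubicFactor_rotate, cubicFactor_rotate, zero_add]
      obtain ⟨-, rfl⟩ := mem_filter.1 hv
      exact hf v _)
  omega

/-- The coefficients of the binary cubic form `F(p x + q y, r x + s y)`. -/
def cubicSubst {R : Type*} [CommRing R] (c : Fin 4 → R) (p q r s : R) : Fin 4 → R :=
  ![c 0 * p ^ 3 + c 1 * p ^ 2 * r + c 2 * p * r ^ 2 + c 3 * r ^ 3,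
    3 * c 0 * p ^ 2 * q + c 1 * (p ^ 2 * s + 2 * p * q * r) + c 2 * (q * r ^ 2 + 2 * p * r * s) +
      3 * c 3 * r ^ 2 * s,
    3 * c 0 * p * q ^ 2 + c 1 * (q ^ 2 * r + 2 * p * q * s) + c 2 * (p * s ^ 2 + 2 * q * r * s) +
      3 * c 3 * r * s ^ 2,
    c 0 * q ^ 3 + c 1 * q ^ 2 * s + c 2 * q * s ^ 2 + c 3 * s ^ 3]

theorem binEval_cubicSubst {R : Type*} [CommRing R] (c : Fin 4 → R) (p q r s x y : R) :
    binEval (cubicSubst c p q r s) x y = binEval c (p * x + q * y) (r * x + s * y) := by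
  simp only [binEval_cubic, cubicSubst, Matrix.cons_val]
  ring

theorem cubicSubst_intCast (R : Type*) [CommRing R] (c : Fin 4 → ℤ) (p q r s : ℤ) (i : Fin 4) :
    cubicSubst (fun j => (c j : R)) p q r s i = ((cubicSubst c p q r s i : ℤ) : R) := by
  fin_cases i <;> simp [cubicSubst]

theorem binEval_cubic_ext (c d : Fin 4 → ℤ) (h : ∀ x y : ℤ, binEval c x y = binEval d x y) :
    c = d := by
  simp only [binEval_cubic] at h
  have h1 := h 1 0
  have h2 := h 0 1
  have h3 := h 1 1
  have h4 := h 1 (-1)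
  norm_num at h1 h2 h3 h4
  funext i
  fin_cases i <;> simp only [Fin.zero_eta, Fin.mk_one, Fin.reduceFinMk] <;> linarith

/-- The discriminant of a binary cubic form as a polynomial in its coefficients. -/
def cubicDisc {R : Type*} [CommRing R] (c : Fin 4 → R) : R :=
  c 1 ^ 2 * c 2 ^ 2 - 4 * c 0 * c 2 ^ 3 - 4 * c 1 ^ 3 * c 3 - 27 * c 0 ^ 2 * c 3 ^ 2 +
    18 * c 0 * c 1 * c 2 * c 3

theorem cubicDisc_cubicSubst {R : Type*} [CommRing R] (c : Fin 4 → R) (p q r s : R) :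
    cubicDisc (cubicSubst c p q r s) = (p * s - q * r) ^ 6 * cubicDisc c := by
  simp only [cubicDisc, cubicSubst, Matrix.cons_val]
  ring

theorem IsDisc.eq_cubicDisc {c : Fin 4 → ℤ} {D : ℤ} (h : IsDisc c D) : D = cubicDisc c := by
  obtain ⟨a, b, hab, hD⟩ := h
  rw [prod_disc_eq] at hD
  have hs := CubicSplits.of_eval hab
  have : (D : ℂ) = (cubicDisc c : ℤ) := by
    rw [hD, cubicDisc]
    push_cast
    rw [hs.c0, hs.c1, hs.c2, hs.c3, cubicSqrtDisc]
    ring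
  exact_mod_cast this

/-- `G` is `F(x P + m y Q) / m`, where `F` is the form with coefficients `c`, `P = (p₁, p₂)`,
`Q = (q₁, q₂)` and `det (P, Q) = 1`. -/
structure IsTwist (m : ℤ) (c G : Fin 4 → ℤ) (p₁ p₂ q₁ q₂ : ℤ) : Prop where
  det : p₁ * q₂ - q₁ * p₂ = 1
  coeff0 : m * G 0 = cubicSubst c p₁ q₁ p₂ q₂ 0
  coeff1 : G 1 = cubicSubst c p₁ q₁ p₂ q₂ 1
  coeff2 : G 2 = m * cubicSubst c p₁ q₁ p₂ q₂ 2
  coeff3 : G 3 = m ^ 2 * cubicSubst c p₁ q₁ p₂ q₂ 3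

theorem IsTwist.eval {m : ℤ} {c G : Fin 4 → ℤ} {p₁ p₂ q₁ q₂ : ℤ} (h : IsTwist m c G p₁ p₂ q₁ q₂)
    {R : Type*} [CommRing R] (x y : R) : (m : R) * binEval (fun i => (G i : R)) x y =
      binEval (fun i => (c i : R)) (p₁ * x + m * q₁ * y) (p₂ * x + m * q₂ * y) := by
  have h0 := congrArg (Int.cast : ℤ → R) h.coeff0
  have h1 := congrArg (Int.cast : ℤ → R) h.coeff1
  have h2 := congrArg (Int.cast : ℤ → R) h.coeff2
  have h3 := congrArg (Int.cast : ℤ → R) h.coeff3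
  simp only [cubicSubst, Matrix.cons_val] at h0 h1 h2 h3
  push_cast at h0 h1 h2 h3
  simp only [binEval_cubic]
  linear_combination x ^ 3 * h0 + m * x ^ 2 * y * h1 + m * x * y ^ 2 * h2 + m * y ^ 3 * h3

theorem IsTwist.eval_int {m : ℤ} {c G : Fin 4 → ℤ} {p₁ p₂ q₁ q₂ : ℤ}
    (h : IsTwist m c G p₁ p₂ q₁ q₂) (x y : ℤ) : m * binEval G x y =
      binEval c (p₁ * x + m * q₁ * y) (p₂ * x + m * q₂ * y) := by
  simpa using h.eval (R := ℤ) x y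

theorem exists_isTwist {m : ℤ} {c : Fin 4 → ℤ} {p₁ p₂ q₁ q₂ : ℤ} (hdet : p₁ * q₂ - q₁ * p₂ = 1)
    (h : m ∣ binEval c p₁ p₂) : ∃ G, IsTwist m c G p₁ p₂ q₁ q₂ := by
  obtain ⟨g, hg⟩ := h
  refine ⟨![g, cubicSubst c p₁ q₁ p₂ q₂ 1, m * cubicSubst c p₁ q₁ p₂ q₂ 2,
    m ^ 2 * cubicSubst c p₁ q₁ p₂ q₂ 3], hdet, ?_, rfl, rfl, rfl⟩
  rw [binEval_cubic] at hg
  simp [cubicSubst, hg]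

theorem IsTwist.isDisc {m : ℤ} (hm : m ≠ 0) {c G : Fin 4 → ℤ} {p₁ p₂ q₁ q₂ : ℤ}
    (h : IsTwist m c G p₁ p₂ q₁ q₂) {D : ℤ} (hD : IsDisc c D) : IsDisc G (D * m ^ 2) := by
  obtain ⟨a, b, hab, hDe⟩ := hD
  have hm' : (m : ℂ) ≠ 0 := by exact_mod_cast hm
  have hdet : (p₁ * q₂ - q₁ * p₂ : ℂ) = 1 := by exact_mod_cast h.det
  rw [prod_disc_eq] at hDe
  refine ⟨![(a 0 * p₁ - b 0 * p₂) / m, a 1 * p₁ - b 1 * p₂, a 2 * p₁ - b 2 * p₂],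
    ![b 0 * q₂ - a 0 * q₁, m * (b 1 * q₂ - a 1 * q₁), m * (b 2 * q₂ - a 2 * q₁)], ?_, ?_⟩
  · intro x y
    apply mul_left_cancel₀ hm'
    rw [h.eval, hab, Fin.prod_univ_three, Fin.prod_univ_three]
    simp only [Matrix.cons_val]
    field_simp
    ring
  · rw [prod_disc_eq]
    have hs : cubicSqrtDisc ![(a 0 * p₁ - b 0 * p₂) / m, a 1 * p₁ - b 1 * p₂, a 2 * p₁ - b 2 * p₂]
        ![b 0 * q₂ - a 0 * q₁, m * (b 1 * q₂ - a 1 * q₁), m * (b 2 * q₂ - a 2 * q₁)] =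
        m * (p₁ * q₂ - q₁ * p₂) ^ 3 * cubicSqrtDisc a b := by
      simp only [cubicSqrtDisc, Matrix.cons_val]
      field_simp
      ring
    rw [hs, hdet]
    push_cast
    rw [hDe]
    ring

theorem exists_unimodular_multiple {q : ℕ} [Fact q.Prime] (κ₁ κ₂ : ZMod q)
    (h : κ₁ ≠ 0 ∨ κ₂ ≠ 0) : ∃ e t : ZMod q, ∃ l : ZMod q, 1 - e * t = l * κ₁ ∧ t = l * κ₂ := by
  by_cases h1 : κ₁ = 0
  · have h2 : κ₂ ≠ 0 := h.resolve_left (not_not.2 h1)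
    exact ⟨1, 1, κ₂⁻¹, by simp [h1], by field_simp⟩
  · exact ⟨0, κ₂ / κ₁, κ₁⁻¹, by field_simp; simp, by field_simp⟩

theorem IsTwist.isMaximalForm {m : ℤ} (hm : m ≠ 0) (hsq : Squarefree m) {c G : Fin 4 → ℤ}
    {p₁ p₂ q₁ q₂ : ℤ} (h : IsTwist m c G p₁ p₂ q₁ q₂) (hmax : IsMaximalForm c) {D : ℤ}
    (hD : IsDisc c D) (hmD : ∀ q : ℕ, q.Prime → (q : ℤ) ∣ m → ¬ (q : ℤ) ∣ D) :
    IsMaximalForm G := by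
  rintro ⟨K, a, b, a', b', hdet, hK⟩
  obtain ⟨q, hq, hqdet⟩ : ∃ q : ℕ, q.Prime ∧ (q : ℤ) ∣ a * b' - b * a' := by
    obtain ⟨q, hq, hd⟩ := Nat.exists_prime_and_dvd (n := (a * b' - b * a').natAbs) (by
      intro h1
      rw [Int.abs_eq_natAbs, h1] at hdet
      norm_num at hdet)
    exact ⟨q, hq, Int.natCast_dvd.2 hd⟩
  have hqp : Prime (q : ℤ) := Nat.prime_iff_prime_int.1 hq
  by_cases hqm : (q : ℤ) ∣ m
  · have hG : G = cubicSubst K a b a' b' :=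
      binEval_cubic_ext _ _ fun x y => by rw [hK, binEval_cubicSubst]
    have e1 := (h.isDisc hm hD).eq_cubicDisc
    rw [hG, cubicDisc_cubicSubst] at e1
    have h6 : (q : ℤ) ^ 6 ∣ D * m ^ 2 := by
      rw [e1]
      exact (pow_dvd_pow_of_dvd hqdet 6).mul_right _
    obtain ⟨m', rfl⟩ := hqm
    have hm' : ¬ (q : ℤ) ∣ m' := by
      intro hd
      exact hqp.not_isUnit (hsq q (mul_dvd_mul_left _ hd))
    have h4 : (q : ℤ) ∣ D * m' ^ 2 := by
      have : (q : ℤ) ^ 2 * q ^ 4 ∣ (q : ℤ) ^ 2 * (D * m' ^ 2) := by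
        convert h6 using 1 <;> ring
      have := (mul_dvd_mul_iff_left (pow_ne_zero 2 hqp.ne_zero)).1 this
      exact (dvd_pow_self _ (by norm_num)).trans this
    rcases hqp.dvd_or_dvd h4 with h5 | h5
    · exact hmD q hq (dvd_mul_right _ _) h5
    · exact hm' (hqp.dvd_of_dvd_pow h5)
  · have : Fact q.Prime := ⟨hq⟩
    set E11 := a * (m * q₂) - b * p₂ with hE11
    set E12 := b * p₁ - a * (m * q₁) with hE12
    set E21 := a' * (m * q₂) - b' * p₂ with hE21
    set E22 := b' * p₁ - a' * (m * q₁) with hE22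
    have hE : ∀ x y : ℤ, m ^ 2 * binEval c x y = binEval K (E11 * x + E12 * y)
        (E21 * x + E22 * y) := by
      intro x y
      apply mul_left_cancel₀ hm
      have e1 := h.eval_int (m * q₂ * x - m * q₁ * y) (p₁ * y - p₂ * x)
      rw [hK] at e1
      rw [show E11 * x + E12 * y = a * (m * q₂ * x - m * q₁ * y) + b * (p₁ * y - p₂ * x) by
        rw [hE11, hE12]; ring, show E21 * x + E22 * y = a' * (m * q₂ * x - m * q₁ * y) +
          b' * (p₁ * y - p₂ * x) by rw [hE21, hE22]; ring, e1,
        show p₁ * (m * q₂ * x - m * q₁ * y) + m * q₁ * (p₁ * y - p₂ * x) = m * x by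
          linear_combination m * x * h.det,
        show p₂ * (m * q₂ * x - m * q₁ * y) + m * q₂ * (p₁ * y - p₂ * x) = m * y by
          linear_combination m * y * h.det, binEval_cubic, binEval_cubic]
      ring
    have hEdet : E11 * E22 - E12 * E21 = m * (a * b' - b * a') := by
      simp only [hE11, hE12, hE21, hE22]
      linear_combination m * (a * b' - b * a') * h.det
    obtain ⟨κ, hκ0, hκ⟩ := Matrix.exists_mulVec_eq_zero_iff
      (M := !![(E11 : ZMod q), (E12 : ZMod q); (E21 : ZMod q), (E22 : ZMod q)]).2 (by
        rw [Matrix.det_fin_two_of]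
        have := (ZMod.intCast_zmod_eq_zero_iff_dvd (E11 * E22 - E12 * E21) q).2
          (by rw [hEdet]; exact hqdet.mul_left _)
        exact_mod_cast this)
    have hκ1 := congrFun hκ 0
    have hκ2 := congrFun hκ 1
    simp only [Matrix.mulVec, dotProduct, Fin.sum_univ_two, Matrix.of_apply, Matrix.cons_val,
      Pi.zero_apply] at hκ1 hκ2
    obtain ⟨e, t, l, he, ht⟩ := exists_unimodular_multiple (κ 0) (κ 1) (by
      by_contra! hcon
      exact hκ0 (funext fun i => by fin_cases i; exacts [hcon.1, hcon.2]))
    obtain ⟨e, rfl⟩ := ZMod.intCast_surjective e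
    obtain ⟨t, rfl⟩ := ZMod.intCast_surjective t
    obtain ⟨w1, hw1⟩ : (q : ℤ) ∣ E11 * (1 - e * t) + E12 * t := by
      rw [← ZMod.intCast_zmod_eq_zero_iff_dvd]
      push_cast
      rw [he]
      rw [ht]
      linear_combination l * hκ1
    obtain ⟨w2, hw2⟩ : (q : ℤ) ∣ E21 * (1 - e * t) + E22 * t := by
      rw [← ZMod.intCast_zmod_eq_zero_iff_dvd]
      push_cast
      rw [he]
      rw [ht]
      linear_combination l * hκ2
    set f := cubicSubst c (-e) (1 - e * t) 1 t with hf
    have hfK : ∀ x y : ℤ, m ^ 2 * binEval f x y =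
        binEval (cubicSubst K (E12 - E11 * e) (q * w1) (E22 - E21 * e) (q * w2)) x y := by
      intro x y
      rw [hf, binEval_cubicSubst, binEval_cubicSubst, hE, ← hw1, ← hw2]
      congr 1 <;> ring
    have hfK' : (fun i => m ^ 2 * f i) =
        cubicSubst K (E12 - E11 * e) (q * w1) (E22 - E21 * e) (q * w2) := by
      refine binEval_cubic_ext _ _ fun x y => ?_
      rw [← hfK, binEval_cubic, binEval_cubic]
      ring
    have hcop : IsCoprime (q : ℤ) (m ^ 2) :=
      (hqp.coprime_iff_not_dvd.2 hqm).pow_right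
    have hdvd : ∀ (i : Fin 4), (q : ℤ) ^ (i : ℕ) ∣ f i := by
      intro i
      refine (hcop.pow_left (m := (i : ℕ))).dvd_of_dvd_mul_left ?_
      rw [show m ^ 2 * f i = _ from congrFun hfK' i]
      fin_cases i
      · simp
      · refine ⟨3 * K 0 * (E12 - E11 * e) ^ 2 * w1 + K 1 * ((E12 - E11 * e) ^ 2 * w2 +
          2 * (E12 - E11 * e) * w1 * (E22 - E21 * e)) + K 2 * (w1 * (E22 - E21 * e) ^ 2 +
          2 * (E12 - E11 * e) * (E22 - E21 * e) * w2) + 3 * K 3 * (E22 - E21 * e) ^ 2 * w2, ?_⟩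
        simp [cubicSubst]
        ring
      · refine ⟨3 * K 0 * (E12 - E11 * e) * w1 ^ 2 + K 1 * (w1 ^ 2 * (E22 - E21 * e) +
          2 * (E12 - E11 * e) * w1 * w2) + K 2 * ((E12 - E11 * e) * w2 ^ 2 +
          2 * w1 * (E22 - E21 * e) * w2) + 3 * K 3 * (E22 - E21 * e) * w2 ^ 2, ?_⟩
        simp [cubicSubst]
        ring
      · refine ⟨binEval K w1 w2, ?_⟩
        simp [cubicSubst, binEval_cubic]
        ring
    choose g hg using hdvd
    refine hmax ⟨g, -t, 1 - e * t, q, q * e, ?_, ?_⟩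
    · rw [show -t * (q * e) - (1 - e * t) * q = -(q : ℤ) by ring, abs_neg, Nat.abs_cast]
      exact_mod_cast hq.one_lt
    · intro x y
      have e1 := binEval_cubicSubst c (-e) (1 - e * t) 1 t (-t * x + (1 - e * t) * y) (x + e * y)
      rw [show -e * (-t * x + (1 - e * t) * y) + (1 - e * t) * (x + e * y) = x by ring,
        show 1 * (-t * x + (1 - e * t) * y) + t * (x + e * y) = y by ring, ← hf] at e1
      rw [← e1, binEval_cubic, binEval_cubic, hg 0, hg 1, hg 2, hg 3]
      simp only [Fin.coe_ofNat_eq_mod]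
      norm_num
      ring

theorem formPoly_cubic (R : Type*) [CommRing R] (c : Fin 4 → ℤ) :
    formPoly R c = MvPolynomial.C (c 0 : R) * MvPolynomial.X 0 ^ 3 +
      MvPolynomial.C (c 1 : R) * MvPolynomial.X 0 ^ 2 * MvPolynomial.X 1 +
      MvPolynomial.C (c 2 : R) * MvPolynomial.X 0 * MvPolynomial.X 1 ^ 2 +
      MvPolynomial.C (c 3 : R) * MvPolynomial.X 1 ^ 3 := by
  simp [formPoly, formPolyR, Fin.sum_univ_four]

theorem formPolyX_cubic (R : Type*) [CommRing R] (c : Fin 4 → ℤ) :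
    formPolyX R c = Polynomial.C (c 0 : R) * Polynomial.X ^ 3 +
      Polynomial.C (c 1 : R) * Polynomial.X ^ 2 +
      Polynomial.C (c 2 : R) * Polynomial.X + Polynomial.C (c 3 : R) := by
  simp [formPolyX, Fin.sum_univ_four]

open MvPolynomial in
/-- An invertible linear change of variables. -/
noncomputable def linearChange (p q r s d : ℚ) (hd : (p * s - q * r) * d = 1) :
    MvPolynomial (Fin 2) ℚ ≃ₐ[ℚ] MvPolynomial (Fin 2) ℚ :=
  AlgEquiv.ofAlgHom (aeval ![C p * X 0 + C q * X 1, C r * X 0 + C s * X 1])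
    (aeval ![C (d * s) * X 0 - C (d * q) * X 1, C (d * p) * X 1 - C (d * r) * X 0])
    (by
      have h := congrArg (C (σ := Fin 2)) hd
      simp only [map_mul, map_sub, map_one] at h
      ext i : 1
      fin_cases i
      · simp [algebraMap_eq]
        linear_combination X 0 * h
      · simp [algebraMap_eq]
        linear_combination X 1 * h)
    (by
      have h := congrArg (C (σ := Fin 2)) hd
      simp only [map_mul, map_sub, map_one] at h
      ext i : 1
      fin_cases i
      · simp [algebraMap_eq]
        linear_combination X 0 * h
      · simp [algebraMap_eq]
        linear_combination X 1 * h)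

open MvPolynomial in
theorem IsTwist.irreducible {m : ℤ} (hm : m ≠ 0) {c G : Fin 4 → ℤ} {p₁ p₂ q₁ q₂ : ℤ}
    (h : IsTwist m c G p₁ p₂ q₁ q₂) (hirr : Irreducible (formPoly ℚ c)) :
    Irreducible (formPoly ℚ G) := by
  have hm' : (m : ℚ) ≠ 0 := by exact_mod_cast hm
  have hdet : (p₁ * q₂ - q₁ * p₂ : ℚ) = 1 := by exact_mod_cast h.det
  set φ := linearChange p₁ (m * q₁) p₂ (m * q₂) (m : ℚ)⁻¹ (by
    field_simp
    linear_combination hdet) with hφ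
  have h1 : Irreducible (φ (formPoly ℚ c)) := (MulEquiv.irreducible_iff φ).2 hirr
  have h2 : φ (formPoly ℚ c) = C (m : ℚ) * formPoly ℚ G := by
    have e0 := congrArg (fun z : ℤ => (C (z : ℚ) : MvPolynomial (Fin 2) ℚ)) h.coeff0
    have e1 := congrArg (fun z : ℤ => (C (z : ℚ) : MvPolynomial (Fin 2) ℚ)) h.coeff1
    have e2 := congrArg (fun z : ℤ => (C (z : ℚ) : MvPolynomial (Fin 2) ℚ)) h.coeff2
    have e3 := congrArg (fun z : ℤ => (C (z : ℚ) : MvPolynomial (Fin 2) ℚ)) h.coeff3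
    simp only [cubicSubst, Matrix.cons_val] at e0 e1 e2 e3
    push_cast at e0 e1 e2 e3
    simp only [map_mul, map_add, map_pow, map_ofNat, map_intCast] at e0 e1 e2 e3
    have hX0 : φ (X 0) = C (p₁ : ℚ) * X 0 + C (m * q₁ : ℚ) * X 1 := by
      simp [hφ, linearChange]
    have hX1 : φ (X 1) = C (p₂ : ℚ) * X 0 + C (m * q₂ : ℚ) * X 1 := by
      simp [hφ, linearChange]
    rw [formPoly_cubic, formPoly_cubic]
    simp only [map_add, map_mul, map_pow, hX0, hX1, map_intCast]
    linear_combination -X 0 ^ 3 * e0 - (m : MvPolynomial (Fin 2) ℚ) * X 0 ^ 2 * X 1 * e1 -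
      (m : MvPolynomial (Fin 2) ℚ) * X 0 * X 1 ^ 2 * e2 -
      (m : MvPolynomial (Fin 2) ℚ) * X 1 ^ 3 * e3
  rw [h2] at h1
  exact (irreducible_isUnit_mul ((isUnit_iff_ne_zero.2 hm').map C)).1 h1

open MvPolynomial in
theorem not_irreducible_of_mul_of_constantCoeff {p f g : MvPolynomial (Fin 2) ℚ} (h : p = f * g)
    (hf : constantCoeff f = 0) (hg : constantCoeff g = 0) : ¬ Irreducible p := by
  intro hi
  rcases hi.isUnit_or_isUnit h with hu | hu
  · have := hu.map constantCoeff
    rw [hf] at this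
    exact not_isUnit_zero this
  · have := hu.map constantCoeff
    rw [hg] at this
    exact not_isUnit_zero this

open MvPolynomial in
theorem leading_ne_zero_of_irreducible {c : Fin 4 → ℤ} (hirr : Irreducible (formPoly ℚ c)) :
    (c 0 : ℚ) ≠ 0 := by
  intro h0
  refine not_irreducible_of_mul_of_constantCoeff (f := X 1) (g := C (c 1 : ℚ) * X 0 ^ 2 +
    C (c 2 : ℚ) * X 0 * X 1 + C (c 3 : ℚ) * X 1 ^ 2) ?_ (by simp) (by simp) hirr
  rw [formPoly_cubic, h0, C_0]
  ring

open MvPolynomial in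
theorem no_rat_root_of_irreducible {c : Fin 4 → ℤ} (hirr : Irreducible (formPoly ℚ c)) (ρ : ℚ) :
    c 0 * ρ ^ 3 + c 1 * ρ ^ 2 + c 2 * ρ + c 3 ≠ 0 := by
  intro h
  refine not_irreducible_of_mul_of_constantCoeff (f := X 0 - C ρ * X 1)
    (g := C (c 0 : ℚ) * X 0 ^ 2 + C (c 1 + c 0 * ρ) * X 0 * X 1 +
      C (c 2 + c 1 * ρ + c 0 * ρ ^ 2) * X 1 ^ 2) ?_ (by simp) (by simp) hirr
  have h1 := congrArg (C (σ := Fin 2)) h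
  rw [formPoly_cubic]
  simp only [map_mul, map_add, map_pow, map_zero] at h1 ⊢
  linear_combination X 1 ^ 3 * h1

open Polynomial in
theorem formPolyX_irreducible {c : Fin 4 → ℤ} (hirr : Irreducible (formPoly ℚ c)) :
    Irreducible (formPolyX ℚ c) ∧ (formPolyX ℚ c).natDegree = 3 := by
  have h0 := leading_ne_zero_of_irreducible hirr
  have hdeg : (formPolyX ℚ c).natDegree = 3 := by
    rw [formPolyX_cubic]
    exact natDegree_cubic h0
  have hne : formPolyX ℚ c ≠ 0 := by
    intro h
    rw [h] at hdeg
    simp at hdeg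
  refine ⟨?_, hdeg⟩
  rw [irreducible_iff_roots_eq_zero_of_degree_le_three (by omega) (by omega)]
  refine Multiset.eq_zero_of_forall_notMem fun ρ hρ => ?_
  rw [mem_roots hne, IsRoot, formPolyX_cubic] at hρ
  refine no_rat_root_of_irreducible hirr ρ ?_
  simpa using hρ

open Polynomial in
theorem aeval_cubic {K : Type*} [Field K] [Algebra ℚ K] {p : ℚ[X]} {c0 c1 c2 c3 : ℚ}
    (hp : p = C c0 * X ^ 3 + C c1 * X ^ 2 + C c2 * X + C c3) (x : K) :
    aeval x p = algebraMap ℚ K c0 * x ^ 3 + algebraMap ℚ K c1 * x ^ 2 + algebraMap ℚ K c2 * x +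
      algebraMap ℚ K c3 := by
  rw [hp]
  simp

open Polynomial in
theorem card_gal_le_of_two_roots {p : ℚ[X]} {c0 c1 c2 c3 : ℚ} (hc0 : c0 ≠ 0)
    (hp : p = C c0 * X ^ 3 + C c1 * X ^ 2 + C c2 * X + C c3) (hirr : Irreducible p)
    (θ θ' : p.SplittingField) (hθ : aeval θ p = 0) (hθ' : aeval θ' p = 0) (hne : θ' ≠ θ)
    (hmem : θ' ∈ IntermediateField.adjoin ℚ {θ}) : Nat.card p.Gal ≤ 3 := by
  have hev : ∀ x : p.SplittingField, aeval x p = algebraMap ℚ _ c0 * x ^ 3 +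
      algebraMap ℚ _ c1 * x ^ 2 + algebraMap ℚ _ c2 * x + algebraMap ℚ _ c3 :=
    fun x => aeval_cubic hp x
  have hc0' : algebraMap ℚ p.SplittingField c0 ≠ 0 := by simpa using hc0
  have hnd : p.natDegree = 3 := by rw [hp]; exact natDegree_cubic hc0
  have hroots : ∀ x : p.SplittingField, aeval x p = 0 → x ∈ IntermediateField.adjoin ℚ {θ} := by
    intro x hx
    have hθm : θ ∈ IntermediateField.adjoin ℚ {θ} := IntermediateField.mem_adjoin_simple_self ℚ θ
    by_cases h1 : x = θ
    · rw [h1]; exact hθm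
    by_cases h2 : x = θ'
    · rw [h2]; exact hmem
    rw [hev] at hx hθ hθ'
    have e1 : algebraMap ℚ _ c0 * (x ^ 2 + x * θ + θ ^ 2) + algebraMap ℚ _ c1 * (x + θ) +
        algebraMap ℚ _ c2 = 0 := by
      apply mul_left_cancel₀ (sub_ne_zero.2 h1)
      linear_combination hx - hθ
    have e2 : algebraMap ℚ _ c0 * (θ' ^ 2 + θ' * θ + θ ^ 2) + algebraMap ℚ _ c1 * (θ' + θ) +
        algebraMap ℚ _ c2 = 0 := by
      apply mul_left_cancel₀ (sub_ne_zero.2 hne)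
      linear_combination hθ' - hθ
    have e3 : algebraMap ℚ _ c0 * (x + θ' + θ) + algebraMap ℚ _ c1 = 0 := by
      apply mul_left_cancel₀ (sub_ne_zero.2 h2)
      linear_combination e1 - e2
    have : x = -(algebraMap ℚ _ c1 / algebraMap ℚ _ c0) - θ' - θ := by
      field_simp
      linear_combination e3
    rw [this]
    exact sub_mem (sub_mem (neg_mem (div_mem (algebraMap_mem _ _) (algebraMap_mem _ _))) hmem) hθm
  have htop : IntermediateField.adjoin ℚ {θ} = ⊤ := by
    rw [← IntermediateField.toSubalgebra_inj, IntermediateField.top_toSubalgebra, eq_top_iff]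
    have hadj := SplittingField.adjoin_rootSet p
    refine hadj.symm.le.trans (Algebra.adjoin_le fun x hx => ?_)
    exact hroots x (aeval_eq_zero_of_mem_rootSet hx)
  rw [Gal.card_of_separable hirr.separable]
  have hintegral : IsIntegral ℚ θ := Algebra.IsIntegral.isIntegral θ
  have hfin := IntermediateField.adjoin.finrank hintegral
  rw [htop, IntermediateField.finrank_top'] at hfin
  refine hfin.le.trans ?_
  rw [← hnd]
  exact natDegree_le_of_dvd (minpoly.dvd ℚ θ hθ) hirr.ne_zero

open Polynomial in
theorem quadratic_coeffs_eq_zero {K : Type*} [Field K] [Algebra ℚ K] {p : ℚ[X]}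
    (hirr : Irreducible p) (hdeg : p.natDegree = 3) (θ : K) (hθ : aeval θ p = 0) (u v w : ℚ)
    (h : algebraMap ℚ K u * θ ^ 2 + algebraMap ℚ K v * θ + algebraMap ℚ K w = 0) :
    u = 0 ∧ v = 0 ∧ w = 0 := by
  set g : ℚ[X] := C u * X ^ 2 + C v * X + C w with hg
  have hg0 : g = 0 := by
    by_contra hne
    have h1 : aeval θ g = 0 := by simpa [hg] using h
    have h2 := natDegree_le_of_dvd (minpoly.dvd ℚ θ h1) hne
    have h3 := (minpoly.eq_of_irreducible hirr hθ)
    have h4 : (minpoly ℚ θ).natDegree = 3 := by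
      rw [← h3, natDegree_mul_C (by simpa using hirr.ne_zero), hdeg]
    have h5 : g.natDegree ≤ 2 := natDegree_quadratic_le
    omega
  refine ⟨?_, ?_, ?_⟩
  · simpa [hg] using congrArg (fun f => coeff f 2) hg0
  · simpa [hg] using congrArg (fun f => coeff f 1) hg0
  · simpa [hg] using congrArg (fun f => coeff f 0) hg0

theorem binEval_of_cubicSubst_eq {R : Type*} [CommRing R] {c : Fin 4 → ℤ} {p q r s m : ℤ}
    (h : cubicSubst c p q r s = fun i => m ^ 3 * c i) (x y : R) :
    binEval (fun i => (c i : R)) (p * x + q * y) (r * x + s * y) =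
      m ^ 3 * binEval (fun i => (c i : R)) x y := by
  have : cubicSubst (fun i => (c i : R)) p q r s = fun i => (m : R) ^ 3 * c i := by
    funext i
    rw [cubicSubst_intCast, h]
    push_cast
    ring
  rw [← binEval_cubicSubst, this, binEval_cubic, binEval_cubic]
  ring

open Polynomial in
theorem scalar_of_automorphism {c : Fin 4 → ℤ} (hirr : Irreducible (formPoly ℚ c))
    (hgal : Nonempty ((formPolyX ℚ c).Gal ≃* Equiv.Perm (Fin 3))) (b₁₁ b₁₂ b₂₁ b₂₂ m : ℤ)
    (hdet : b₁₁ * b₂₂ - b₁₂ * b₂₁ ≠ 0)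
    (h : ∀ x y : ℤ, binEval c (b₁₁ * x + b₁₂ * y) (b₂₁ * x + b₂₂ * y) = m ^ 3 * binEval c x y) :
    b₁₂ = 0 ∧ b₂₁ = 0 ∧ b₁₁ = m ∧ b₂₂ = m := by
  obtain ⟨hpi, hpd⟩ := formPolyX_irreducible hirr
  have hc0 := leading_ne_zero_of_irreducible hirr
  have hpc := formPolyX_cubic ℚ c
  set p := formPolyX ℚ c with hp
  let K := p.SplittingField
  obtain ⟨θ, hθ⟩ : ∃ θ : K, aeval θ p = 0 := by
    obtain ⟨θ, hθ⟩ := (SplittingField.splits p).exists_eval_eq_zero (by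
      rw [degree_map, degree_eq_natDegree hpi.ne_zero, hpd]
      decide)
    exact ⟨θ, by rwa [eval_map_algebraMap] at hθ⟩
  have hev : ∀ x : K, aeval x p = c 0 * x ^ 3 + c 1 * x ^ 2 + c 2 * x + c 3 := by
    intro x
    simpa using aeval_cubic hpc x
  have hcoef : cubicSubst c b₁₁ b₁₂ b₂₁ b₂₂ = fun i => m ^ 3 * c i := by
    refine binEval_cubic_ext _ _ fun x y => ?_
    rw [binEval_cubicSubst, h, binEval_cubic, binEval_cubic]
    ring
  have hcast := binEval_of_cubicSubst_eq (R := K) hcoef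
  have hθ1 : binEval (fun i => (c i : K)) θ 1 = 0 := by
    rw [hev] at hθ
    rw [binEval_cubic]
    linear_combination hθ
  have hB := hcast θ 1
  rw [hθ1, mul_zero, binEval_cubic] at hB
  simp only [mul_one] at hB
  have hden : (b₂₁ * θ + b₂₂ : K) ≠ 0 := by
    intro h0
    obtain ⟨-, e1, e2⟩ := quadratic_coeffs_eq_zero hpi hpd θ hθ 0 b₂₁ b₂₂ (by
      simpa using h0)
    have e1' : b₂₁ = 0 := by exact_mod_cast e1
    have e2' : b₂₂ = 0 := by exact_mod_cast e2
    rw [e1', e2'] at hdet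
    simp at hdet
  set θ' : K := (b₁₁ * θ + b₁₂) / (b₂₁ * θ + b₂₂) with hθ'
  have hroot' : aeval θ' p = 0 := by
    have hmul : θ' * (b₂₁ * θ + b₂₂) = b₁₁ * θ + b₁₂ := div_mul_cancel₀ _ hden
    rw [hev]
    apply mul_left_cancel₀ (pow_ne_zero 3 hden)
    rw [← hmul] at hB
    linear_combination hB
  by_cases hfix : θ' = θ
  · rw [hθ', div_eq_iff hden] at hfix
    obtain ⟨e1, e2, e3⟩ := quadratic_coeffs_eq_zero hpi hpd θ hθ b₂₁ (b₂₂ - b₁₁) (-b₁₂) (by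
      simp only [map_intCast, map_sub, map_neg]
      linear_combination -hfix)
    have e1' : b₂₁ = 0 := by exact_mod_cast e1
    have e3' : b₁₂ = 0 := by exact_mod_cast neg_eq_zero.1 e3
    have e2' : b₂₂ = b₁₁ := by exact_mod_cast sub_eq_zero.1 e2
    have hc0' : c 0 ≠ 0 := by exact_mod_cast hc0
    have h00 := congrFun hcoef 0
    simp only [cubicSubst, Matrix.cons_val, e1'] at h00
    have hb : b₁₁ ^ 3 = m ^ 3 := by
      apply mul_left_cancel₀ hc0'
      linear_combination h00
    have hb' : b₁₁ = m :=
      (Odd.strictMono_pow (R := ℤ) (n := 3) (by decide)).injective hb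
    exact ⟨e3', e1', hb', e2'.trans hb'⟩
  · exfalso
    have hmem : θ' ∈ IntermediateField.adjoin ℚ {θ} := by
      have hθm : θ ∈ IntermediateField.adjoin ℚ {θ} := IntermediateField.mem_adjoin_simple_self ℚ θ
      exact div_mem (add_mem (mul_mem (intCast_mem _ _) hθm) (intCast_mem _ _))
        (add_mem (mul_mem (intCast_mem _ _) hθm) (intCast_mem _ _))
    have h1 := card_gal_le_of_two_roots hc0 hpc hpi θ θ' hθ hroot' hfix hmem
    obtain ⟨e⟩ := hgal
    rw [Nat.card_congr e.toEquiv, Nat.card_eq_fintype_card, Fintype.card_perm] at h1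
    norm_num [Nat.factorial] at h1

theorem IsTwist.mem_range_of_formEquiv {m : ℤ} (hm : m ≠ 0) {c G H : Fin 4 → ℤ}
    {p₁ p₂ q₁ q₂ r₁ r₂ s₁ s₂ : ℤ} (hG : IsTwist m c G p₁ p₂ q₁ q₂)
    (hH : IsTwist m c H r₁ r₂ s₁ s₂) (hirr : Irreducible (formPoly ℚ c))
    (hgal : Nonempty ((formPolyX ℚ c).Gal ≃* Equiv.Perm (Fin 3))) (h : FormEquiv G H) :
    ∃ x y : ℤ, r₁ = p₁ * x + m * q₁ * y ∧ r₂ = p₂ * x + m * q₂ * y := by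
  obtain ⟨a, b, a', b', hdet, hGH⟩ := h
  have hU : a * b' - b * a' ≠ 0 := by
    intro h0
    rw [h0] at hdet
    simp at hdet
  have hdG := hG.det
  have hdH := hH.det
  have hB := scalar_of_automorphism hirr hgal
    ((p₁ * a + m * q₁ * a') * (m * s₂) - (p₁ * b + m * q₁ * b') * r₂)
    (-(p₁ * a + m * q₁ * a') * (m * s₁) + (p₁ * b + m * q₁ * b') * r₁)
    ((p₂ * a + m * q₂ * a') * (m * s₂) - (p₂ * b + m * q₂ * b') * r₂)
    (-(p₂ * a + m * q₂ * a') * (m * s₁) + (p₂ * b + m * q₂ * b') * r₁) m ?_ ?_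
  · obtain ⟨h12, h21, h11, h22⟩ := hB
    refine ⟨a, a', ?_, ?_⟩
    · apply mul_left_cancel₀ hm
      linear_combination -(r₁ * h11) - r₂ * h12 + m * (p₁ * a + m * q₁ * a') * hdH
    · apply mul_left_cancel₀ hm
      linear_combination -(r₁ * h21) - r₂ * h22 + m * (p₂ * a + m * q₂ * a') * hdH
  · have : ((p₁ * a + m * q₁ * a') * (m * s₂) - (p₁ * b + m * q₁ * b') * r₂) *
        (-(p₂ * a + m * q₂ * a') * (m * s₁) + (p₂ * b + m * q₂ * b') * r₁) -
        (-(p₁ * a + m * q₁ * a') * (m * s₁) + (p₁ * b + m * q₁ * b') * r₁) *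
        ((p₂ * a + m * q₂ * a') * (m * s₂) - (p₂ * b + m * q₂ * b') * r₂) =
        m ^ 2 * (a * b' - b * a') := by
      linear_combination m ^ 2 * (a * b' - b * a') * (r₁ * s₂ - s₁ * r₂) * hdG +
        m ^ 2 * (a * b' - b * a') * hdH
    rw [this]
    exact mul_ne_zero (pow_ne_zero 2 hm) hU
  · intro x y
    have e1 := hH.eval_int (m * s₂ * x - m * s₁ * y) (-r₂ * x + r₁ * y)
    rw [hGH, hG.eval_int] at e1
    have e2 : binEval c (r₁ * (m * s₂ * x - m * s₁ * y) + m * s₁ * (-r₂ * x + r₁ * y))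
        (r₂ * (m * s₂ * x - m * s₁ * y) + m * s₂ * (-r₂ * x + r₁ * y)) =
        m ^ 3 * binEval c x y := by
      have f1 : r₁ * (m * s₂ * x - m * s₁ * y) + m * s₁ * (-r₂ * x + r₁ * y) = m * x := by
        linear_combination m * x * hdH
      have f2 : r₂ * (m * s₂ * x - m * s₁ * y) + m * s₂ * (-r₂ * x + r₁ * y) = m * y := by
        linear_combination m * y * hdH
      rw [f1, f2, binEval_cubic, binEval_cubic]
      ring
    rw [← e2, ← e1]
    congr 1 <;> ring

theorem exists_unimodular_of_forms {k : ℕ} {pr : ℕ → ℕ} (hpr : ∀ i < k, (pr i).Prime)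
    (hinj : ∀ i < k, ∀ j < k, i ≠ j → pr i ≠ pr j) (u v : ∀ i, ZMod (pr i))
    (h : ∀ i < k, u i ≠ 0 ∨ v i ≠ 0) : ∃ p₁ p₂ q₁ q₂ : ℤ, p₁ * q₂ - q₁ * p₂ = 1 ∧
      ∀ i < k, u i * p₁ + v i * p₂ = 0 := by
  have hcrt : ∀ w : ∀ i, ZMod (pr i), ∃ z : ℤ, ∀ i < k, (z : ZMod (pr i)) = w i := by
    intro w
    obtain ⟨z, hz⟩ := Nat.chineseRemainderOfFinset (fun i => (w i).val) pr (range k)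
      (fun i hi => (hpr i (mem_range.1 hi)).ne_zero) (fun i hi j hj hij =>
        (Nat.coprime_primes (hpr i (by simpa using hi)) (hpr j (by simpa using hj))).2
          (hinj i (by simpa using hi) j (by simpa using hj) hij))
    refine ⟨z, fun i hi => ?_⟩
    have : NeZero (pr i) := ⟨(hpr i hi).ne_zero⟩
    have h1 := (ZMod.natCast_eq_natCast_iff _ _ _).2 (hz i (mem_range.2 hi))
    simpa using h1
  have hloc : ∀ i, ∃ e t : ZMod (pr i), i < k → u i * (1 - e * t) + v i * t = 0 := by
    intro i
    by_cases hi : i < k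
    · have : Fact (pr i).Prime := ⟨hpr i hi⟩
      obtain ⟨e, t, l, h1, h2⟩ := exists_unimodular_multiple (-v i) (u i)
        ((h i hi).symm.imp neg_ne_zero.2 id)
      refine ⟨e, t, fun _ => ?_⟩
      rw [h1, h2]
      ring
    · exact ⟨0, 0, fun h => absurd h hi⟩
  choose e t het using hloc
  obtain ⟨E, hE⟩ := hcrt e
  obtain ⟨T, hT⟩ := hcrt t
  refine ⟨1 - E * T, T, -E, 1, by ring, fun i hi => ?_⟩
  push_cast
  rw [hE i hi, hT i hi]
  exact het i hi

/-- Over `K`, the cubic form is a product of pairwise non-proportional linear forms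
`a i x + b i y`. -/
structure SplitsInto {K : Type*} [Field K] (c : Fin 4 → ℤ) (a b : Fin 3 → K) : Prop where
  ne : ∀ i j, i ≠ j → a i * b j ≠ a j * b i
  c0 : (c 0 : K) = a 0 * a 1 * a 2
  c1 : (c 1 : K) = a 0 * a 1 * b 2 + a 0 * b 1 * a 2 + b 0 * a 1 * a 2
  c2 : (c 2 : K) = a 0 * b 1 * b 2 + b 0 * a 1 * b 2 + b 0 * b 1 * a 2
  c3 : (c 3 : K) = b 0 * b 1 * b 2

theorem SplitsInto.eval {K : Type*} [Field K] {c : Fin 4 → ℤ} {a b : Fin 3 → K}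
    (h : SplitsInto c a b) (x y : K) :
    binEval (fun i => (c i : K)) x y = ∏ i, (a i * x + b i * y) := by
  rw [binEval_cubic, Fin.prod_univ_three]
  simp only [h.c0, h.c1, h.c2, h.c3]
  ring

theorem eval_formPoly_cubic {R : Type*} [CommRing R] (c : Fin 4 → ℤ) (x y : R) :
    MvPolynomial.eval ![x, y] (formPoly R c) = binEval (fun i => (c i : R)) x y := by
  rw [formPoly_cubic, binEval_cubic]
  simp

theorem SplitsCompletelyMod.exists_splitsInto {p : ℕ} [Fact p.Prime] (hp : p ≠ 2)
    {c : Fin 4 → ℤ} (h : SplitsCompletelyMod p c) : ∃ a b : Fin 3 → ZMod p, SplitsInto c a b := by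
  obtain ⟨L, hL, hF⟩ := h
  have hev : ∀ x y : ZMod p, binEval (fun i => (c i : ZMod p)) x y =
      ∏ i, ((L i).1 * x + (L i).2 * y) := by
    intro x y
    rw [← eval_formPoly_cubic, hF]
    simp
  simp only [binEval_cubic, Fin.prod_univ_three] at hev
  have h1 := hev 1 0
  have h2 := hev 0 1
  have h3 := hev 1 1
  have h4 := hev 1 (-1)
  have h20 : (2 : ZMod p) ≠ 0 := by
    have : ((2 : ℕ) : ZMod p) ≠ 0 := by
      rw [Ne, ZMod.natCast_eq_zero_iff]
      intro hd
      exact hp ((Nat.prime_dvd_prime_iff_eq Fact.out Nat.prime_two).1 hd)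
    simpa using this
  refine ⟨fun i => (L i).1, fun i => (L i).2, hL, ?_, ?_, ?_, ?_⟩
  · linear_combination h1
  · apply mul_left_cancel₀ h20
    linear_combination (h3 - h4) - 2 * h2
  · apply mul_left_cancel₀ h20
    linear_combination (h3 + h4) - 2 * h1
  · linear_combination h2

theorem SplitsInto.disc_ne_zero {K : Type*} [Field K] {c : Fin 4 → ℤ} {a b : Fin 3 → K}
    (h : SplitsInto c a b) : ((cubicDisc c : ℤ) : K) ≠ 0 := by
  have : ((cubicDisc c : ℤ) : K) = ((a 0 * b 1 - a 1 * b 0) * (a 0 * b 2 - a 2 * b 0) *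
      (a 1 * b 2 - a 2 * b 1)) ^ 2 := by
    rw [cubicDisc]
    push_cast
    rw [h.c0, h.c1, h.c2, h.c3]
    ring
  rw [this]
  exact pow_ne_zero 2 (mul_ne_zero (mul_ne_zero (sub_ne_zero.2 (h.ne 0 1 (by decide)))
    (sub_ne_zero.2 (h.ne 0 2 (by decide)))) (sub_ne_zero.2 (h.ne 1 2 (by decide))))

theorem SplitsInto.not_both_zero {K : Type*} [Field K] {c : Fin 4 → ℤ} {a b : Fin 3 → K}
    (h : SplitsInto c a b) (i : Fin 3) : a i ≠ 0 ∨ b i ≠ 0 := by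
  by_contra! h0
  have := h.ne i (i + 1) (by fin_cases i <;> decide)
  rw [h0.1, h0.2] at this
  simp at this

theorem SplitsInto.eq_zero_of_two {K : Type*} [Field K] {c : Fin 4 → ℤ} {a b : Fin 3 → K}
    (h : SplitsInto c a b) {i j : Fin 3} (hij : i ≠ j) {x y : K} (hi : a i * x + b i * y = 0)
    (hj : a j * x + b j * y = 0) : x = 0 ∧ y = 0 := by
  have hne := sub_ne_zero.2 (h.ne i j hij)
  constructor
  · apply mul_left_cancel₀ hne
    linear_combination b j * hi - b i * hj
  · apply mul_left_cancel₀ hne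
    linear_combination a i * hj - a j * hi

open Polynomial in
theorem exists_padicInt_root {p : ℕ} [Fact p.Prime] (F : ℤ_[p][X]) (a : ZMod p)
    (h0 : (F.map PadicInt.toZMod).eval a = 0)
    (h1 : (F.map PadicInt.toZMod).derivative.eval a ≠ 0) : ∃ z : ℤ_[p], F.eval z = 0 := by
  obtain ⟨a, rfl⟩ := ZMod.ringHom_surjective PadicInt.toZMod a
  rw [derivative_map] at h1
  rw [eval_map_apply] at h0 h1
  have hker : ∀ x : ℤ_[p], PadicInt.toZMod x = 0 ↔ ¬ IsUnit x := by
    intro x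
    rw [← RingHom.mem_ker, PadicInt.ker_toZMod, IsLocalRing.mem_maximalIdeal, mem_nonunits_iff]
  rw [hker, PadicInt.isUnit_iff] at h0
  rw [Ne, hker, not_not, PadicInt.isUnit_iff] at h1
  obtain ⟨z, hz, -⟩ := hensels_lemma (p := p) (R := ℤ_[p]) (F := F) (a := a) (by
    simp only [coe_aeval_eq_eval]
    rw [h1, one_pow]
    exact lt_of_le_of_ne (PadicInt.norm_le_one _) h0)
  exact ⟨z, by simpa only [coe_aeval_eq_eval] using hz⟩

open Polynomial in
theorem exists_padicInt_cubic_root {p : ℕ} [Fact p.Prime] (g₀ g₁ g₂ g₃ : ℤ_[p]) (a : ZMod p)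
    (h0 : PadicInt.toZMod g₀ * a ^ 3 + PadicInt.toZMod g₁ * a ^ 2 + PadicInt.toZMod g₂ * a +
      PadicInt.toZMod g₃ = 0)
    (h1 : 3 * PadicInt.toZMod g₀ * a ^ 2 + 2 * PadicInt.toZMod g₁ * a + PadicInt.toZMod g₂ ≠ 0) :
    ∃ z : ℤ_[p], g₀ * z ^ 3 + g₁ * z ^ 2 + g₂ * z + g₃ = 0 := by
  obtain ⟨z, hz⟩ := exists_padicInt_root (C g₀ * X ^ 3 + C g₁ * X ^ 2 + C g₂ * X + C g₃) a
    (by simpa using h0) (by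
      intro h
      apply h1
      rw [← h]
      simp
      ring)
  exact ⟨z, by simpa using hz⟩

theorem exists_padicInt_binEval_eq {p : ℕ} [Fact p.Prime] (c : Fin 4 → ℤ) (h : ℤ) (x y : ZMod p)
    (hxy : binEval (fun i => (c i : ZMod p)) x y = h)
    (hsm : 3 * c 0 * x ^ 2 + 2 * c 1 * x * y + c 2 * y ^ 2 ≠ 0 ∨
      c 1 * x ^ 2 + 2 * c 2 * x * y + 3 * c 3 * y ^ 2 ≠ 0) :
    ∃ X Y : ℤ_[p], binEval (fun i => (c i : ℤ_[p])) X Y = h := by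
  rw [binEval_cubic] at hxy
  simp only [binEval_cubic]
  rcases hsm with hsm | hsm
  · obtain ⟨Y, rfl⟩ := ZMod.ringHom_surjective PadicInt.toZMod y
    obtain ⟨z, hz⟩ := exists_padicInt_cubic_root (c 0 : ℤ_[p]) ((c 1 : ℤ_[p]) * Y)
      ((c 2 : ℤ_[p]) * Y ^ 2) ((c 3 : ℤ_[p]) * Y ^ 3 - (h : ℤ_[p])) x
      (by
        simp only [map_intCast, map_mul, map_pow, map_sub]
        linear_combination hxy) (by
        simp only [map_intCast, map_mul, map_pow]
        convert hsm using 1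
        ring)
    exact ⟨z, Y, by linear_combination hz⟩
  · obtain ⟨X, rfl⟩ := ZMod.ringHom_surjective PadicInt.toZMod x
    obtain ⟨z, hz⟩ := exists_padicInt_cubic_root (c 3 : ℤ_[p]) ((c 2 : ℤ_[p]) * X)
      ((c 1 : ℤ_[p]) * X ^ 2) ((c 0 : ℤ_[p]) * X ^ 3 - (h : ℤ_[p])) y
      (by
        simp only [map_intCast, map_mul, map_pow, map_sub]
        linear_combination hxy) (by
        simp only [map_intCast, map_mul, map_pow]
        convert hsm using 1
        ring)
    exact ⟨X, z, by linear_combination hz⟩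

theorem exists_real_binEval_eq_one {G : Fin 4 → ℤ} (h0 : G 0 ≠ 0) :
    ∃ x y : ℝ, binEval (fun i => (G i : ℝ)) x y = 1 := by
  have hs : Function.Surjective (fun x : ℝ => x ^ 3) :=
    (continuous_pow 3).surjective (Filter.tendsto_pow_atTop (by decide)) (by
      have := (Odd.strictMono_pow (R := ℝ) (n := 3) (by decide))
      exact (Filter.tendsto_atBot_atBot.2 fun b => ⟨min b (-1), fun a ha => by
        have h1 := (le_min_iff.1 ha).1
        have h2 := (le_min_iff.1 ha).2
        nlinarith [sq_nonneg (a + 1)]⟩))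
  obtain ⟨x, hx⟩ := hs ((G 0 : ℝ)⁻¹)
  have h0' : (G 0 : ℝ) ≠ 0 := by exact_mod_cast h0
  refine ⟨x, 0, ?_⟩
  rw [binEval_cubic]
  simp only at hx
  rw [hx]
  field_simp
  ring

theorem IsTwist.padic_of_not_dvd {p : ℕ} [Fact p.Prime] {m : ℤ} (hpm : ¬ (p : ℤ) ∣ m)
    {c G : Fin 4 → ℤ} {p₁ p₂ q₁ q₂ : ℤ} (h : IsTwist m c G p₁ p₂ q₁ q₂) {X Y : ℤ_[p]}
    (hXY : binEval (fun i => (c i : ℤ_[p])) X Y = m) :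
    ∃ x y : ℤ_[p], binEval (fun i => (G i : ℤ_[p])) x y = 1 := by
  have hu : IsUnit (m : ℤ_[p]) := by
    rw [PadicInt.isUnit_iff]
    exact le_antisymm (PadicInt.norm_le_one _)
      (not_lt.1 fun hlt => hpm ((PadicInt.norm_int_lt_one_iff_dvd m).1 hlt))
  obtain ⟨n, hn⟩ := hu.exists_right_inv
  have hdet : (p₁ * q₂ - q₁ * p₂ : ℤ_[p]) = 1 := by exact_mod_cast h.det
  refine ⟨q₂ * X - q₁ * Y, n * (-p₂ * X + p₁ * Y), hu.mul_left_cancel ?_⟩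
  rw [h.eval, mul_one]
  refine Eq.trans ?_ hXY
  congr 1
  · linear_combination X * hdet + q₁ * (-p₂ * X + p₁ * Y) * hn
  · linear_combination Y * hdet + q₂ * (-p₂ * X + p₁ * Y) * hn

theorem IsTwist.padic_of_dvd {p : ℕ} [Fact p.Prime] {m : ℤ} (hpm : (p : ℤ) ∣ m)
    {c G : Fin 4 → ℤ} {p₁ p₂ q₁ q₂ : ℤ} (h : IsTwist m c G p₁ p₂ q₁ q₂)
    (h1 : (G 1 : ZMod p) ≠ 0) :
    ∃ x y : ℤ_[p], binEval (fun i => (G i : ℤ_[p])) x y = 1 := by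
  have hm0 : (m : ZMod p) = 0 := (ZMod.intCast_zmod_eq_zero_iff_dvd m p).2 hpm
  have h2 : (G 2 : ZMod p) = 0 := by rw [h.coeff2]; simp [hm0]
  have h3 : (G 3 : ZMod p) = 0 := by rw [h.coeff3]; simp [hm0]
  have := exists_padicInt_binEval_eq G 1 (1 : ZMod p) ((1 - G 0) / G 1) (by
    rw [binEval_cubic]
    simp only [h2, h3]
    field_simp
    push_cast
    ring) (Or.inr (by simpa [h2, h3] using h1))
  simpa using this

theorem IsTwist.coeff1_ne_zero {p : ℕ} [Fact p.Prime] {m : ℤ}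
    {c G : Fin 4 → ℤ} {p₁ p₂ q₁ q₂ : ℤ} (h : IsTwist m c G p₁ p₂ q₁ q₂) {a b : Fin 3 → ZMod p}
    (hs : SplitsInto c a b) {i : Fin 3} (hi : a i * p₁ + b i * p₂ = 0) : (G 1 : ZMod p) ≠ 0 := by
  have hdet : (p₁ * q₂ - q₁ * p₂ : ZMod p) = 1 := by exact_mod_cast congrArg (Int.cast : ℤ → ZMod p) h.det
  have hP : ∀ j, i ≠ j → a j * p₁ + b j * p₂ ≠ 0 := by
    intro j hij hj
    obtain ⟨e1, e2⟩ := hs.eq_zero_of_two hij hi hj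
    rw [e1, e2] at hdet
    simp at hdet
  have hQ : a i * q₁ + b i * q₂ ≠ 0 := by
    intro hq
    have e1 : a i = 0 := by linear_combination -(a i * hdet) + q₂ * hi - p₂ * hq
    have e2 : b i = 0 := by linear_combination -(b i * hdet) - q₁ * hi + p₁ * hq
    exact (hs.not_both_zero i).elim (fun h => h e1) fun h => h e2
  have hG : (G 1 : ZMod p) = (a 0 * q₁ + b 0 * q₂) * (a 1 * p₁ + b 1 * p₂) * (a 2 * p₁ + b 2 * p₂)
      + (a 0 * p₁ + b 0 * p₂) * (a 1 * q₁ + b 1 * q₂) * (a 2 * p₁ + b 2 * p₂)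
      + (a 0 * p₁ + b 0 * p₂) * (a 1 * p₁ + b 1 * p₂) * (a 2 * q₁ + b 2 * q₂) := by
    rw [h.coeff1, ← cubicSubst_intCast]
    simp only [cubicSubst, Matrix.cons_val, hs.c0, hs.c1, hs.c2, hs.c3]
    ring
  rw [hG]
  fin_cases i <;> simp only [Fin.zero_eta, Fin.mk_one, Fin.reduceFinMk] at hi hQ hP <;>
    rw [hi] <;> simp only [zero_mul, mul_zero, add_zero, zero_add]
  · exact mul_ne_zero (mul_ne_zero hQ (hP 1 (by decide))) (hP 2 (by decide))
  · exact mul_ne_zero (mul_ne_zero (hP 0 (by decide)) hQ) (hP 2 (by decide))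
  · exact mul_ne_zero (mul_ne_zero (hP 0 (by decide)) (hP 1 (by decide))) hQ

theorem exists_padicInt_of_zmod {p : ℕ} [Fact p.Prime] (hp3 : p ≠ 3) {c : Fin 4 → ℤ} {h : ℤ}
    (hh : (h : ZMod p) ≠ 0) (hex : ∃ x y : ZMod p, binEval (fun i => (c i : ZMod p)) x y = h) :
    ∃ X Y : ℤ_[p], binEval (fun i => (c i : ℤ_[p])) X Y = h := by
  obtain ⟨x, y, hxy⟩ := hex
  refine exists_padicInt_binEval_eq c h x y hxy ?_
  by_contra! hs
  rw [binEval_cubic] at hxy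
  have h30 : (3 : ZMod p) ≠ 0 := by
    have : ((3 : ℕ) : ZMod p) ≠ 0 := by
      rw [Ne, ZMod.natCast_eq_zero_iff]
      intro hd
      exact hp3 ((Nat.prime_dvd_prime_iff_eq Fact.out Nat.prime_three).1 hd)
    simpa using this
  apply mul_ne_zero h30 hh
  linear_combination -3 * hxy + x * hs.1 + y * hs.2

theorem exists_binEval_ne_zero_of_primitive {p : ℕ} [Fact p.Prime] (hp2 : p ≠ 2)
    {c : Fin 4 → ℤ} (hprim : IsPrimitiveForm c) :
    ∃ x y : ZMod p, binEval (fun i => (c i : ZMod p)) x y ≠ 0 := by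
  by_contra! h
  simp only [binEval_cubic] at h
  have h1 := h 1 0
  have h2 := h 0 1
  have h3 := h 1 1
  have h4 := h 1 (-1)
  have h20 : (2 : ZMod p) ≠ 0 := by
    have : ((2 : ℕ) : ZMod p) ≠ 0 := by
      rw [Ne, ZMod.natCast_eq_zero_iff]
      intro hd
      exact hp2 ((Nat.prime_dvd_prime_iff_eq Fact.out Nat.prime_two).1 hd)
    simpa using this
  have hu := hprim p fun i => by
    rw [← ZMod.intCast_zmod_eq_zero_iff_dvd]
    fin_cases i <;> simp only [Fin.zero_eta, Fin.mk_one, Fin.reduceFinMk]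
    · linear_combination h1
    · apply mul_left_cancel₀ h20
      linear_combination h3 - h4 - 2 * h2
    · apply mul_left_cancel₀ h20
      linear_combination h3 + h4 - 2 * h1
    · linear_combination h2
  exact (Nat.prime_iff_prime_int.1 (Fact.out : p.Prime)).not_isUnit hu

theorem exists_binEval_ne_zero_mod_two {c : Fin 4 → ℤ} (hprim : IsPrimitiveForm c)
    (h2 : ¬ SplitsCompletelyMod 2 c) :
    ∃ x y : ZMod 2, binEval (fun i => (c i : ZMod 2)) x y ≠ 0 := by
  by_contra! h
  simp only [binEval_cubic] at h
  have e0 : (c 0 : ZMod 2) = 0 := by simpa using h 1 0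
  have e3 : (c 3 : ZMod 2) = 0 := by simpa using h 0 1
  have e1 : (c 1 : ZMod 2) + c 2 = 0 := by simpa [e0, e3] using h 1 1
  have hcase : ∀ a b : ZMod 2, a + b = 0 → (a = 0 ∧ b = 0) ∨ (a = 1 ∧ b = 1) := by decide
  rcases hcase _ _ e1 with ⟨f1, f2⟩ | ⟨f1, f2⟩
  · have hu := hprim (2 : ℕ) fun i => by
      rw [← ZMod.intCast_zmod_eq_zero_iff_dvd]
      fin_cases i <;> assumption
    exact (Nat.prime_iff_prime_int.1 Nat.prime_two).not_isUnit hu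
  · refine h2 ⟨![(1, 0), (0, 1), (1, 1)], by decide, ?_⟩
    rw [formPoly_cubic, e0, e3, f1, f2, Fin.prod_univ_three]
    simp
    ring

theorem exists_binEval_eq_of_mod_three_eq_two {p : ℕ} [Fact p.Prime] (hp : p % 3 = 2)
    {c : Fin 4 → ℤ} (h : ∃ x y : ZMod p, binEval (fun i => (c i : ZMod p)) x y ≠ 0)
    (a : ZMod p) : ∃ x y : ZMod p, binEval (fun i => (c i : ZMod p)) x y = a := by
  obtain ⟨x, y, hxy⟩ := h
  set v := binEval (fun i => (c i : ZMod p)) x y with hv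
  have hcube : ∀ b : ZMod p, ∃ t, t ^ 3 = b := by
    intro b
    by_cases hb : b = 0
    · exact ⟨0, by simp [hb]⟩
    refine ⟨b ^ (2 * (p / 3) + 1), ?_⟩
    have h1 := ZMod.pow_card_sub_one_eq_one hb
    rw [← pow_mul, show (2 * (p / 3) + 1) * 3 = (p - 1) * 2 + 1 by omega, pow_succ, pow_mul, h1,
      one_pow, one_mul]
  obtain ⟨t, ht⟩ := hcube (a / v)
  refine ⟨t * x, t * y, ?_⟩
  have : binEval (fun i => (c i : ZMod p)) (t * x) (t * y) = t ^ 3 * v := by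
    rw [hv, binEval_cubic, binEval_cubic]
    ring
  rw [this, ht, div_mul_cancel₀ _ hxy]

theorem zmod_three_smooth_values : ∀ c₀ c₁ c₂ c₃ h : ZMod 3, (c₁ ≠ 0 ∨ c₂ ≠ 0) → h ≠ 0 →
    (∀ a b : ZMod 3, c₀ * a ^ 3 + c₁ * a ^ 2 + c₂ * a + c₃ = 0 →
      c₀ * b ^ 3 + c₁ * b ^ 2 + c₂ * b + c₃ = 0 → a = b) →
    ∃ x y : ZMod 3, c₀ * x ^ 3 + c₁ * x ^ 2 * y + c₂ * x * y ^ 2 + c₃ * y ^ 3 = h ∧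
      (3 * c₀ * x ^ 2 + 2 * c₁ * x * y + c₂ * y ^ 2 ≠ 0 ∨
      c₁ * x ^ 2 + 2 * c₂ * x * y + 3 * c₃ * y ^ 2 ≠ 0) := by
  decide +kernel

open Polynomial in
theorem exists_padicInt_three {c : Fin 4 → ℤ} (h3 : Irreducible (formPolyX (ZMod 3) c)) {h : ℤ}
    (hh : (h : ZMod 3) ≠ 0) [Fact (Nat.Prime 3)] :
    ∃ X Y : ℤ_[3], binEval (fun i => (c i : ℤ_[3])) X Y = h := by
  have hev : ∀ a, eval a (formPolyX (ZMod 3) c) = c 0 * a ^ 3 + c 1 * a ^ 2 + c 2 * a + c 3 := by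
    intro a
    rw [formPolyX_cubic]
    simp
  obtain ⟨x, y, hxy, hs⟩ := zmod_three_smooth_values (c 0) (c 1) (c 2) (c 3) h (by
    by_contra! h0
    have h30 : (3 : (ZMod 3)[X]) = 0 := by
      have : (3 : ZMod 3) = 0 := rfl
      rw [← map_ofNat C, this, map_zero]
    have hcube : ∀ a : ZMod 3, a = a ^ 3 := fun a => (ZMod.pow_card a).symm
    have : formPolyX (ZMod 3) c = (C (c 0 : ZMod 3) * X + C (c 3 : ZMod 3)) ^ 3 := by
      rw [formPolyX_cubic, h0.1, h0.2]
      conv_lhs => rw [hcube (c 0), hcube (c 3)]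
      simp only [map_pow, map_zero]
      linear_combination -(C (c 0 : ZMod 3) ^ 2 * X ^ 2 * C (c 3 : ZMod 3) +
        C (c 0 : ZMod 3) * X * C (c 3 : ZMod 3) ^ 2) * h30
    rw [this] at h3
    exact not_irreducible_pow (by decide) h3) hh (by
    intro a b ha hb
    rw [← hev] at ha hb
    obtain ⟨g, hg⟩ := dvd_iff_isRoot.2 ha
    have hu : IsUnit g := (h3.isUnit_or_isUnit hg).resolve_left (not_isUnit_X_sub_C a)
    rw [hg, eval_mul, mul_eq_zero] at hb
    rcases hb with hb | hb
    · simp only [eval_sub, eval_X, eval_C] at hb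
      exact (sub_eq_zero.1 hb).symm
    · exact absurd hb (hu.map (evalRingHom b)).ne_zero)
  exact exists_padicInt_binEval_eq c h x y (by rw [binEval_cubic]; exact hxy) hs

theorem MulChar.isCube_of_apply_eq_one {K : Type*} [Field K] [Finite K] {χ : MulChar K ℂ}
    (hχ : orderOf χ = 3) {u : K} (hu : χ u = 1) : ∃ t, u = t ^ 3 := by
  have hu0 : u ≠ 0 := by
    rintro rfl
    simp at hu
  obtain ⟨g, hg⟩ := IsCyclic.exists_generator (α := Kˣ)
  obtain ⟨n, hn⟩ := (mem_powers_iff_mem_zpowers.2 (hg (Units.mk0 u hu0)))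
  have hug : u = (g : K) ^ n := by
    have := congrArg (Units.val) hn
    simpa using this.symm
  have hχ3 : χ ^ 3 = 1 := hχ ▸ pow_orderOf_eq_one χ
  have hg3 : χ g ^ 3 = 1 := by
    rw [← MulChar.pow_apply_coe, hχ3, MulChar.one_apply_coe]
  have hg1 : χ g ≠ 1 := by
    intro h1
    have : χ = 1 := by
      ext x
      obtain ⟨k, hk⟩ := (mem_powers_iff_mem_zpowers.2 (hg x))
      have hk' : (x : K) = (g : K) ^ k := by
        have := congrArg (Units.val) hk
        simpa using this.symm
      rw [hk', map_pow, h1, one_pow, ← hk', MulChar.one_apply_coe]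
    rw [this, orderOf_one] at hχ
    norm_num at hχ
  have hord := orderOf_eq_prime hg3 hg1
  rw [hug, map_pow] at hu
  obtain ⟨k, rfl⟩ : 3 ∣ n := hord ▸ orderOf_dvd_of_pow_eq_one hu
  exact ⟨(g : K) ^ k, by rw [hug, ← pow_mul, mul_comm]⟩

theorem MulChar.two_mul_re_of_not_cube {K : Type*} [Field K] [Finite K] {χ : MulChar K ℂ}
    (hχ : orderOf χ = 3) {u : K} (hu0 : u ≠ 0) (hu : ¬ ∃ t, u = t ^ 3) :
    2 * (χ u).re = -1 := by
  have h1 : χ u ≠ 1 := fun h => hu (MulChar.isCube_of_apply_eq_one hχ h)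
  have hχ3 : χ ^ 3 = 1 := hχ ▸ pow_orderOf_eq_one χ
  have h3 : χ u ^ 3 = 1 := by
    rw [← MulChar.pow_apply' _ (by norm_num), hχ3, MulChar.one_apply hu0.isUnit]
  have hn : ‖χ u‖ = 1 := Complex.norm_eq_one_of_pow_eq_one h3 (by norm_num)
  have hq : χ u ^ 2 + χ u + 1 = 0 := by
    apply mul_left_cancel₀ (sub_ne_zero.2 h1)
    linear_combination h3
  have hconj : starRingEnd ℂ (χ u) = χ u ^ 2 := by
    have h4 : χ u * starRingEnd ℂ (χ u) = 1 := by
      rw [Complex.mul_conj, Complex.normSq_eq_norm_sq, hn]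
      norm_num
    have h5 : χ u ≠ 0 := by
      intro h0
      rw [h0] at hn
      simp at hn
    apply mul_left_cancel₀ h5
    rw [h4, ← h3]
    ring
  have h6 := Complex.add_conj (χ u)
  rw [hconj] at h6
  have h7 : ((2 * (χ u).re : ℝ) : ℂ) = ((-1 : ℝ) : ℂ) := by
    rw [← h6]
    push_cast
    linear_combination hq
  exact_mod_cast h7

theorem card_le_two_mul_norm_sum_mulChar {K : Type*} [Field K] [Finite K] [DecidableEq K]
    {χ : MulChar K ℂ} (hχ : orderOf χ = 3) {ι : Type*} (s : Finset ι) (f : ι → K) {a : K}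
    (ha : a ≠ 0) (hf : ∀ i ∈ s, ∀ t, f i ≠ a * t ^ 3 ∨ t = 0) :
    ((s.filter fun i => f i ≠ 0).card : ℝ) ≤ 2 * ‖∑ i ∈ s, χ (f i)‖ := by
  have h1 : ∑ i ∈ s, χ (f i / a) = χ a⁻¹ * ∑ i ∈ s, χ (f i) := by
    rw [mul_sum]
    refine sum_congr rfl fun i _ => ?_
    rw [div_eq_inv_mul, map_mul]
  have h2 : 2 * (∑ i ∈ s, χ (f i / a)).re = -((s.filter fun i => f i ≠ 0).card : ℝ) := by
    rw [Complex.re_sum, mul_sum, card_filter, Nat.cast_sum, ← sum_neg_distrib]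
    refine sum_congr rfl fun i hi => ?_
    by_cases h0 : f i = 0
    · rw [h0, zero_div, MulChar.map_zero]
      simp
    rw [MulChar.two_mul_re_of_not_cube hχ (div_ne_zero h0 ha)]
    · simp [h0]
    · rintro ⟨t, ht⟩
      rcases hf i hi t with h | rfl
      · exact h (by rw [← ht, mul_div_cancel₀ _ ha])
      · simp [h0, ha] at ht
  have h3 : ‖χ a⁻¹‖ ≤ 1 := by
    have : χ a⁻¹ ^ 3 = 1 := by
      have hχ3 : χ ^ 3 = 1 := hχ ▸ pow_orderOf_eq_one χ
      rw [← MulChar.pow_apply' _ (by norm_num), hχ3, MulChar.one_apply (inv_ne_zero ha).isUnit]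
    exact (Complex.norm_eq_one_of_pow_eq_one this (by norm_num)).le
  have h4 := (abs_le.1 (Complex.abs_re_le_norm (∑ i ∈ s, χ (f i / a)))).1
  have h5 : ‖∑ i ∈ s, χ (f i / a)‖ ≤ ‖∑ i ∈ s, χ (f i)‖ := by
    rw [h1, norm_mul]
    exact mul_le_of_le_one_left (norm_nonneg _) h3
  linarith

theorem norm_sum_mulChar_sq_sub {p : ℕ} [Fact p.Prime] (hp : p ≠ 2) {χ : MulChar (ZMod p) ℂ}
    (hχ : orderOf χ = 3) {d : ZMod p} (hd : d ≠ 0) :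
    ‖∑ z : ZMod p, χ (z ^ 2 - d)‖ ^ 2 = p := by
  have hring : ringChar (ZMod p) ≠ 2 := by rwa [ZMod.ringChar_zmod_n]
  set η : MulChar (ZMod p) ℂ := (quadraticChar (ZMod p)).ringHomComp (Int.castRingHom ℂ) with hη
  have hη1 : η ≠ 1 := by
    rw [hη]
    intro h
    exact quadraticChar_ne_one hring
      ((MulChar.ringHomComp_eq_one_iff (Int.cast_injective)).1 h)
  have hη2 : η ^ 2 = 1 := by
    rw [hη, MulChar.ringHomComp_pow, (quadraticChar_isQuadratic (ZMod p)).sq_eq_one]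
    exact (MulChar.ringHomComp_eq_one_iff (Int.cast_injective)).2 rfl
  have hχ1 : χ ≠ 1 := by
    rintro rfl
    rw [orderOf_one] at hχ
    norm_num at hχ
  have hηχ : η * χ ≠ 1 := by
    intro h
    have h1 : χ ^ 2 = 1 := by
      have := congrArg (· ^ 2) h
      simpa [mul_pow, hη2] using this
    have := orderOf_dvd_of_pow_eq_one h1
    rw [hχ] at this
    norm_num at this
  have hsum : ∑ z : ZMod p, χ (z ^ 2 - d) = ∑ u : ZMod p, χ (u - d) * (η u + 1) := by
    have hfib := Finset.sum_fiberwise (univ : Finset (ZMod p)) (fun z => z ^ 2)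
      (fun z => χ (z ^ 2 - d))
    rw [← hfib]
    refine sum_congr rfl fun u _ => ?_
    rw [sum_congr rfl (g := fun _ => χ (u - d)) (by
      intro z hz
      rw [(mem_filter.1 hz).2]), sum_const, nsmul_eq_mul, mul_comm]
    congr 1
    have := quadraticChar_card_sqrts hring u
    have h2 : (Set.toFinset {x : ZMod p | x ^ 2 = u}) = univ.filter fun x => x ^ 2 = u := by
      ext
      simp
    rw [h2] at this
    rw [hη]
    simp only [MulChar.ringHomComp_apply, Int.coe_castRingHom]
    exact_mod_cast this
  have h0 : ∑ u : ZMod p, χ (u - d) = 0 := by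
    rw [← MulChar.sum_eq_zero_of_ne_one hχ1]
    exact Fintype.sum_equiv (Equiv.subRight d) _ _ fun _ => rfl
  have hJ : ∑ z : ZMod p, χ (z ^ 2 - d) = χ (-d) * η d * jacobiSum η χ := by
    rw [hsum]
    simp only [mul_add, mul_one]
    rw [sum_add_distrib, h0, add_zero, jacobiSum, mul_sum]
    refine (Fintype.sum_equiv (Equiv.mulLeft₀ d hd) _ _ fun v => ?_).symm
    change _ = χ (d * v - d) * η (d * v)
    rw [show d * v - d = -d * (1 - v) by ring, map_mul, map_mul]
    ring
  have hnχ : ∀ x : ZMod p, x ≠ 0 → ‖χ x‖ = 1 := fun x hx => by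
    have hχ3 : χ ^ 3 = 1 := hχ ▸ pow_orderOf_eq_one χ
    refine Complex.norm_eq_one_of_pow_eq_one (n := 3) ?_ (by norm_num)
    rw [← MulChar.pow_apply' _ (by norm_num), hχ3, MulChar.one_apply hx.isUnit]
  have hnη : ‖η d‖ = 1 := by
    refine Complex.norm_eq_one_of_pow_eq_one (n := 2) ?_ (by norm_num)
    rw [← MulChar.pow_apply' _ (by norm_num), hη2, MulChar.one_apply hd.isUnit]
  rw [hJ, norm_mul, norm_mul, hnχ _ (neg_ne_zero.2 hd), hnη, one_mul, one_mul]
  have hstar : star (jacobiSum η χ) = jacobiSum η⁻¹ χ⁻¹ := by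
    simp [jacobiSum, star_sum, star_mul', MulChar.star_apply']
  have hmul := jacobiSum_mul_jacobiSum_inv (F := ZMod p) (F' := ℂ) (by
    rw [ZMod.ringChar_zmod_n, ringChar.eq_zero]
    exact (Fact.out : p.Prime).ne_zero.symm) hη1 hχ1 hηχ
  rw [← hstar, ZMod.card] at hmul
  have : ((‖jacobiSum η χ‖ ^ 2 : ℝ) : ℂ) = ((p : ℝ) : ℂ) := by
    rw [← Complex.normSq_eq_norm_sq, Complex.normSq_eq_conj_mul_self, mul_comm]
    exact_mod_cast hmul
  exact_mod_cast this

theorem exists_mulChar_orderOf_three {p : ℕ} [Fact p.Prime] (hp : p % 3 = 1) :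
    ∃ χ : MulChar (ZMod p) ℂ, orderOf χ = 3 := by
  refine MulChar.exists_mulChar_orderOf (ZMod p) ?_ (Complex.isPrimitiveRoot_exp 3 (by norm_num))
  rw [ZMod.card]
  have := (Fact.out : p.Prime).pos
  omega

theorem zmod_two_ne_zero {p : ℕ} [Fact p.Prime] (hp : p ≠ 2) : (2 : ZMod p) ≠ 0 := by
  have : ((2 : ℕ) : ZMod p) ≠ 0 := by
    rw [Ne, ZMod.natCast_eq_zero_iff]
    intro hd
    exact hp ((Nat.prime_dvd_prime_iff_eq Fact.out Nat.prime_two).1 hd)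
  simpa using this

theorem exists_mul_quadratic_eq {p : ℕ} [Fact p.Prime] (hp : p % 3 = 1) (hp13 : 13 ≤ p)
    {u v w : ZMod p} (huv : u ≠ 0 ∨ v ≠ 0) {a : ZMod p} (ha : a ≠ 0) :
    ∃ x y, y * (u * x ^ 2 + v * x * y + w * y ^ 2) = a := by
  have h2 := zmod_two_ne_zero (p := p) (by omega)
  by_cases hu : u = 0
  · have hv : v ≠ 0 := huv.resolve_left (not_not.2 hu)
    refine ⟨(a - w) / v, 1, ?_⟩
    rw [hu]
    field_simp
    ring
  by_cases hd : v ^ 2 - 4 * u * w = 0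
  · refine ⟨1 - v * (a / u) / (2 * u), a / u, ?_⟩
    field_simp
    linear_combination -(a ^ 2) * hd
  obtain ⟨χ, hχ⟩ := exists_mulChar_orderOf_three hp
  by_contra! hno
  set d := v ^ 2 - 4 * u * w with hdd
  have h4u : (4 * u : ZMod p) ≠ 0 := by
    rw [show (4 : ZMod p) = 2 * 2 by norm_num]
    exact mul_ne_zero (mul_ne_zero h2 h2) hu
  have hcard := card_le_two_mul_norm_sum_mulChar hχ (univ : Finset (ZMod p))
    (fun z => (4 * u)⁻¹ * (z ^ 2 - d)) ha (by
      intro z _ t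
      by_contra! h
      obtain ⟨h, ht⟩ := h
      refine hno ((z - v) / (2 * u) / t) (1 / t) ?_
      have h' : z ^ 2 - d = 4 * u * (a * t ^ 3) := by
        rw [← h, mul_inv_cancel_left₀ h4u]
      rw [hdd] at h'
      field_simp
      linear_combination h')
  simp only [map_mul] at hcard
  rw [← mul_sum, norm_mul] at hcard
  have hn : ‖χ (4 * u)⁻¹‖ = 1 := by
    have hχ3 : χ ^ 3 = 1 := hχ ▸ pow_orderOf_eq_one χ
    refine Complex.norm_eq_one_of_pow_eq_one (n := 3) ?_ (by norm_num)
    rw [← MulChar.pow_apply' _ (by norm_num), hχ3, MulChar.one_apply (inv_ne_zero h4u).isUnit]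
  rw [hn, one_mul] at hcard
  have hsq := norm_sum_mulChar_sq_sub (p := p) (by omega) hχ hd
  have hzero : ((univ : Finset (ZMod p)).filter fun z => (4 * u)⁻¹ * (z ^ 2 - d) = 0).card ≤ 2 := by
    have : ((univ : Finset (ZMod p)).filter fun z => (4 * u)⁻¹ * (z ^ 2 - d) = 0) ⊆
        (Polynomial.nthRoots 2 d).toFinset := by
      intro z hz
      rw [Multiset.mem_toFinset, Polynomial.mem_nthRoots (by norm_num)]
      have := (mem_filter.1 hz).2
      rw [mul_eq_zero] at this
      exact sub_eq_zero.1 (this.resolve_left (inv_ne_zero h4u))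
    exact (card_le_card this).trans ((Multiset.toFinset_card_le _).trans
      (Polynomial.card_nthRoots 2 d))
  have hsplit := card_filter_add_card_filter_not (s := (univ : Finset (ZMod p)))
    (fun z => (4 * u)⁻¹ * (z ^ 2 - d) = 0)
  rw [card_univ, ZMod.card] at hsplit
  have hlow : (p : ℝ) - 2 ≤ 2 * ‖∑ z : ZMod p, χ (z ^ 2 - d)‖ := by
    refine le_trans ?_ hcard
    rw [sub_le_iff_le_add]
    exact_mod_cast (by omega : p ≤ _ + 2)
  have hp13' : (13 : ℝ) ≤ p := by exact_mod_cast hp13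
  nlinarith [norm_nonneg (∑ z : ZMod p, χ (z ^ 2 - d))]

theorem exists_binEval_eq_of_root {p : ℕ} [Fact p.Prime] (hp : p % 3 = 1) (hp13 : 13 ≤ p)
    {c : Fin 4 → ℤ} (hc : ¬ ∃ (c₀ l₁ l₂ : ZMod p), formPoly (ZMod p) c =
      MvPolynomial.C c₀ * (MvPolynomial.C l₁ * MvPolynomial.X 0 +
        MvPolynomial.C l₂ * MvPolynomial.X 1) ^ 3) {x₀ y₀ : ZMod p} (h0 : x₀ ≠ 0 ∨ y₀ ≠ 0)
    (hroot : binEval (fun i => (c i : ZMod p)) x₀ y₀ = 0) {a : ZMod p} (ha : a ≠ 0) :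
    ∃ x y : ZMod p, binEval (fun i => (c i : ZMod p)) x y = a := by
  have h2 := zmod_two_ne_zero (p := p) (by omega)
  obtain ⟨s, t, hst⟩ : ∃ s t, x₀ * t - s * y₀ = 1 := by
    by_cases hx : x₀ = 0
    · have hy := h0.resolve_left (not_not.2 hx)
      exact ⟨-y₀⁻¹, 0, by field_simp; simp⟩
    · exact ⟨0, x₀⁻¹, by field_simp; simp⟩
  set e := cubicSubst (fun i => (c i : ZMod p)) x₀ s y₀ t with he
  have he0 : e 0 = 0 := by
    rw [← hroot, binEval_cubic, he]
    simp [cubicSubst]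
  have hev : ∀ X Y, binEval (fun i => (c i : ZMod p)) (x₀ * X + s * Y) (y₀ * X + t * Y) =
      Y * (e 1 * X ^ 2 + e 2 * X * Y + e 3 * Y ^ 2) := by
    intro X Y
    rw [← binEval_cubicSubst, ← he, binEval_cubic, he0]
    ring
  by_cases hlin : e 1 = 0 ∧ e 2 = 0
  · exfalso
    apply hc
    have hcube : ∀ x y, binEval (fun i => (c i : ZMod p)) x y = e 3 * (x₀ * y - y₀ * x) ^ 3 := by
      intro x y
      have := hev (t * x - s * y) (x₀ * y - y₀ * x)
      rw [hlin.1, hlin.2] at this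
      rw [show x₀ * (t * x - s * y) + s * (x₀ * y - y₀ * x) = x by linear_combination x * hst,
        show y₀ * (t * x - s * y) + t * (x₀ * y - y₀ * x) = y by linear_combination y * hst] at this
      rw [this]
      ring
    simp only [binEval_cubic] at hcube
    have h10 := hcube 1 0
    have h01 := hcube 0 1
    have h11 := hcube 1 1
    have h1n := hcube 1 (-1)
    have f0 : (c 0 : ZMod p) = -(e 3 * y₀ ^ 3) := by linear_combination h10
    have f3 : (c 3 : ZMod p) = e 3 * x₀ ^ 3 := by linear_combination h01
    have f1 : (c 1 : ZMod p) = 3 * e 3 * x₀ * y₀ ^ 2 := by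
      apply mul_left_cancel₀ h2
      linear_combination h11 - h1n - 2 * h01
    have f2 : (c 2 : ZMod p) = -(3 * e 3 * x₀ ^ 2 * y₀) := by
      apply mul_left_cancel₀ h2
      linear_combination h11 + h1n - 2 * h10
    refine ⟨e 3, -y₀, x₀, ?_⟩
    rw [formPoly_cubic, f0, f1, f2, f3]
    simp only [map_mul, map_neg, map_pow, map_ofNat]
    ring
  · obtain ⟨X, Y, hXY⟩ := exists_mul_quadratic_eq hp hp13 (u := e 1) (v := e 2) (w := e 3)
      (by tauto) ha
    exact ⟨_, _, (hev X Y).trans hXY⟩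

/-- The multiplicative character of an extension obtained by composing a character of the base
field with the norm. -/
noncomputable def MulChar.compNorm {K : Type*} (L : Type*) [Field K] [Field L] [Algebra K L]
    [FiniteDimensional K L] (χ : MulChar K ℂ) : MulChar L ℂ :=
  { χ.toMonoidHom.comp (Algebra.norm K (S := L)) with
    map_nonunit' := by
      intro a ha
      have h0 : a = 0 := by simpa using ha
      subst h0
      simp [Algebra.norm_zero] }

theorem MulChar.compNorm_apply {K L : Type*} [Field K] [Field L] [Algebra K L]
    [FiniteDimensional K L] (χ : MulChar K ℂ) (a : L) :
    χ.compNorm L a = χ (Algebra.norm K a) := rfl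

theorem norm_sum_ker_mulChar {p : ℕ} [Fact p.Prime] {L : Type*} [Field L] [Fintype L]
    [Algebra (ZMod p) L] {φ : L →ₗ[ZMod p] ZMod p} (hφ : φ ≠ 0) {ψ : MulChar L ℂ} (hψ : ψ ≠ 1)
    (hψ1 : ∀ t : ZMod p, t ≠ 0 → ψ (algebraMap (ZMod p) L t) = 1) :
    ((p : ℝ) * ‖∑ a with φ a = 0, ψ a‖) ^ 2 = ((p : ℝ) - 1) ^ 2 * Fintype.card L := by
  have hp : p.Prime := Fact.out
  set e : AddChar L ℂ := (ZMod.stdAddChar (N := p)).compAddMonoidHom φ.toAddMonoidHom with he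
  have hea : ∀ a, e a = ZMod.stdAddChar (φ a) := fun a => rfl
  have hprim := ZMod.isPrimitive_stdAddChar p
  have he1 : e ≠ 1 := by
    intro h
    apply hφ
    ext a
    by_contra ha
    have ha' : φ a ≠ 0 := ha
    have : ∀ t : ZMod p, ZMod.stdAddChar t = 1 := by
      intro t
      have := DFunLike.congr_fun h ((t / φ a) • a)
      rw [hea, map_smul, smul_eq_mul, div_mul_cancel₀ _ ha'] at this
      simpa using this
    exact one_ne_zero (ZMod.injective_stdAddChar ((this 1).trans (this 0).symm))
  have hG := gaussSum_mul_gaussSum_eq_card hψ (AddChar.IsPrimitive.of_ne_one he1)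
  rw [← star_gaussSum_eq] at hG
  have hGn : ‖gaussSum ψ e‖ ^ 2 = Fintype.card L := by
    have : ((‖gaussSum ψ e‖ ^ 2 : ℝ) : ℂ) = ((Fintype.card L : ℝ) : ℂ) := by
      rw [← Complex.normSq_eq_norm_sq, Complex.normSq_eq_conj_mul_self, mul_comm]
      exact_mod_cast hG
    exact_mod_cast this
  have hsum : (p : ℂ) * ∑ a with φ a = 0, ψ a = ((p : ℂ) - 1) * gaussSum ψ e := by
    have h1 : ∀ a, ψ a * ∑ t : ZMod p, ZMod.stdAddChar (t * φ a) =
        if φ a = 0 then (p : ℂ) * ψ a else 0 := by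
      intro a
      rw [AddChar.sum_mulShift _ hprim, ZMod.card]
      split_ifs <;> simp [mul_comm]
    have h2 : ∀ t : ZMod p, t ≠ 0 → ∑ a, ψ a * ZMod.stdAddChar (t * φ a) = gaussSum ψ e := by
      intro t ht
      have hu : algebraMap (ZMod p) L t ≠ 0 := by simpa using ht
      rw [← gaussSum_mulShift ψ e (Units.mk0 _ hu), Units.val_mk0, hψ1 t ht, one_mul, gaussSum]
      refine sum_congr rfl fun a _ => ?_
      rw [AddChar.mulShift_apply, hea, ← Algebra.smul_def, map_smul, smul_eq_mul]
    rw [mul_sum, sum_filter, ← sum_congr rfl fun a _ => h1 a]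
    simp only [mul_sum]
    rw [sum_comm, ← add_sum_erase univ _ (mem_univ (0 : ZMod p)),
      sum_congr rfl fun t ht => h2 t (ne_of_mem_erase ht)]
    simp [MulChar.sum_eq_zero_of_ne_one hψ, card_erase_of_mem, hp.one_le]
  have := congrArg (fun z => ‖z‖ ^ 2) hsum
  simp only [norm_mul] at this
  rw [Complex.norm_natCast] at this
  rw [this, mul_pow, hGn]
  congr 1
  have : ((p : ℂ) - 1) = (((p : ℝ) - 1 : ℝ) : ℂ) := by push_cast; rfl
  rw [this, Complex.norm_real, Real.norm_eq_abs, sq_abs]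

theorem PowerBasis.norm_sub_smul_gen {K L : Type*} [Field K] [Field L] [Algebra K L]
    [FiniteDimensional K L] (pb : PowerBasis K L) {a₁ a₂ a₃ : K}
    (h : minpoly K pb.gen = Polynomial.X ^ 3 + Polynomial.C a₁ * Polynomial.X ^ 2 +
      Polynomial.C a₂ * Polynomial.X + Polynomial.C a₃) (hd : Module.finrank K L = 3) (x y : K) :
    Algebra.norm K (algebraMap K L x - y • pb.gen) =
      x ^ 3 + a₁ * x ^ 2 * y + a₂ * x * y ^ 2 + a₃ * y ^ 3 := by
  by_cases hy : y = 0
  · rw [hy, zero_smul, sub_zero, Algebra.norm_algebraMap, hd]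
    ring
  have h1 : ∀ z : K, Algebra.norm K (algebraMap K L z - pb.gen) =
      z ^ 3 + a₁ * z ^ 2 + a₂ * z + a₃ := by
    intro z
    have := Matrix.eval_charpoly (Algebra.leftMulMatrix pb.basis pb.gen) z
    rw [charpoly_leftMulMatrix, h] at this
    rw [Algebra.norm_eq_matrix_det pb.basis, map_sub, AlgHom.commutes]
    simpa [Matrix.algebraMap_eq_diagonal, Pi.algebraMap_def] using this.symm
  have h2 : algebraMap K L x - y • pb.gen = algebraMap K L y * (algebraMap K L (x / y) - pb.gen) := by
    rw [mul_sub, ← map_mul, mul_div_cancel₀ _ hy, Algebra.smul_def]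
  rw [h2, map_mul, Algebra.norm_algebraMap, hd, h1]
  field_simp

theorem sum_ker_basis_coord {p : ℕ} [Fact p.Prime] {L : Type*} [Field L] [Fintype L]
    [Algebra (ZMod p) L] (b : Module.Basis (Fin 3) (ZMod p) L) (f : L → ℂ) :
    ∑ v : ZMod p × ZMod p, f (v.1 • b 0 - v.2 • b 1) = ∑ a with b.coord 2 a = 0, f a := by
  refine sum_nbij' (fun v => v.1 • b 0 - v.2 • b 1) (fun a => (b.repr a 0, -b.repr a 1))
    ?_ ?_ ?_ ?_ ?_
  · simp
  · simp
  · simp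
  · intro a ha
    have ha' : b.repr a 2 = 0 := by simpa using ha
    conv_rhs => rw [← b.sum_repr a, Fin.sum_univ_three, ha']
    simp
  · simp

theorem exists_binEval_eq_of_no_root {p : ℕ} [Fact p.Prime] (hp : p % 3 = 1)
    {c : Fin 4 → ZMod p} (hroot : ∀ x y : ZMod p, binEval c x y = 0 → x = 0 ∧ y = 0)
    {a : ZMod p} (ha : a ≠ 0) : ∃ x y : ZMod p, binEval c x y = a := by
  have hc0 : c 0 ≠ 0 := by
    intro h
    have := hroot 1 0 (by rw [binEval_cubic, h]; ring)
    simp at this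
  set g : Polynomial (ZMod p) := Polynomial.X ^ 3 + Polynomial.C (c 1 / c 0) * Polynomial.X ^ 2 +
      Polynomial.C (c 2 / c 0) * Polynomial.X + Polynomial.C (c 3 / c 0) with hg
  have hdeg : g.natDegree = 3 := by rw [hg]; compute_degree!
  have hmonic : g.Monic := by rw [hg]; monicity!
  have hirr : Irreducible g := by
    refine Polynomial.irreducible_of_degree_le_three_of_not_isRoot (by simp [hdeg]) fun x hx => ?_
    have := hroot x 1 (by
      rw [Polynomial.IsRoot.def, hg] at hx
      simp only [Polynomial.eval_add, Polynomial.eval_mul, Polynomial.eval_pow, Polynomial.eval_X,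
        Polynomial.eval_C] at hx
      field_simp at hx
      rw [binEval_cubic]
      linear_combination hx)
    simp at this
  have : Fact (Irreducible g) := ⟨hirr⟩
  set L := AdjoinRoot g
  set pb : PowerBasis (ZMod p) L := AdjoinRoot.powerBasis' hmonic with hpb
  have hdim : pb.dim = 3 := by rw [hpb, AdjoinRoot.powerBasis'_dim, hdeg]
  have : FiniteDimensional (ZMod p) L := pb.finite
  have hrank : Module.finrank (ZMod p) L = 3 := by rw [pb.finrank, hdim]
  have : Finite L := Module.finite_of_finite (ZMod p)
  have := Fintype.ofFinite L
  have hcard : Fintype.card L = p ^ 3 := by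
    rw [Module.card_eq_pow_finrank (K := ZMod p), hrank, ZMod.card]
  set b := pb.basis.reindex (finCongr hdim) with hb
  have hbi : ∀ i : Fin 3, b i = pb.gen ^ (i : ℕ) := by
    intro i
    rw [hb, Module.Basis.reindex_apply, pb.basis_eq_pow]
    rfl
  have hmin : minpoly (ZMod p) pb.gen = g := by
    rw [hpb, AdjoinRoot.powerBasis'_gen, AdjoinRoot.minpoly_root hirr.ne_zero, hmonic.leadingCoeff]
    simp
  obtain ⟨χ, hχ⟩ := exists_mulChar_orderOf_three hp
  have hχ3 : χ ^ 3 = 1 := hχ ▸ pow_orderOf_eq_one χ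
  set ψ := χ.compNorm L with hψd
  have hψ : ψ ≠ 1 := by
    intro h
    have : χ = 1 := by
      ext u
      obtain ⟨v, hv⟩ := FiniteField.norm_surjective (ZMod p) L (u : ZMod p)
      have hv0 : v ≠ 0 := by
        rintro rfl
        rw [Algebra.norm_zero] at hv
        exact u.ne_zero hv.symm
      rw [← hv, ← MulChar.compNorm_apply, ← hψd, h, hv, MulChar.one_apply_coe,
        MulChar.one_apply hv0.isUnit]
    rw [this, orderOf_one] at hχ
    norm_num at hχ
  have hψ1 : ∀ t : ZMod p, t ≠ 0 → ψ (algebraMap (ZMod p) L t) = 1 := by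
    intro t ht
    rw [hψd, MulChar.compNorm_apply, Algebra.norm_algebraMap, hrank, map_pow,
      ← MulChar.pow_apply' _ (by norm_num), hχ3, MulChar.one_apply ht.isUnit]
  have hφ : b.coord 2 ≠ 0 := by
    intro h
    have := LinearMap.congr_fun h (b 2)
    simp at this
  have hS := norm_sum_ker_mulChar hφ hψ hψ1
  rw [← sum_ker_basis_coord, hcard] at hS
  have hev : ∀ v : ZMod p × ZMod p, χ (binEval c v.1 v.2) = χ (c 0) * ψ (v.1 • b 0 - v.2 • b 1) := by
    intro v
    rw [hψd, MulChar.compNorm_apply, hbi, hbi, ← map_mul]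
    have := pb.norm_sub_smul_gen (hmin.trans hg) hrank v.1 v.2
    simp only [Fin.val_zero, pow_zero, Fin.val_one, pow_one, ← Algebra.algebraMap_eq_smul_one]
    rw [this, binEval_cubic]
    congr 1
    field_simp
  by_contra! hno
  have hle := card_le_two_mul_norm_sum_mulChar hχ (univ : Finset (ZMod p × ZMod p))
    (fun v => binEval c v.1 v.2) ha (by
      intro v _ t
      by_contra! h
      obtain ⟨h, ht⟩ := h
      refine hno (v.1 / t) (v.2 / t) ?_
      rw [binEval_cubic] at h ⊢
      field_simp
      linear_combination h)
  simp only [hev] at hle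
  rw [← mul_sum, norm_mul] at hle
  have hn : ‖χ (c 0)‖ = 1 := by
    refine Complex.norm_eq_one_of_pow_eq_one (n := 3) ?_ (by norm_num)
    rw [← MulChar.pow_apply' _ (by norm_num), hχ3, MulChar.one_apply hc0.isUnit]
  rw [hn, one_mul] at hle
  have hfil : (univ.filter fun v : ZMod p × ZMod p => binEval c v.1 v.2 ≠ 0) = univ.erase 0 := by
    ext v
    simp only [mem_filter, mem_univ, true_and, mem_erase, and_true]
    refine not_congr ⟨fun h => Prod.ext (hroot _ _ h).1 (hroot _ _ h).2, ?_⟩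
    rintro rfl
    rw [binEval_cubic]
    simp
  rw [hfil, card_erase_of_mem (mem_univ _), card_univ, Fintype.card_prod, ZMod.card,
    Nat.cast_sub (by nlinarith [(Fact.out : p.Prime).one_le])] at hle
  set S := ‖∑ v : ZMod p × ZMod p, ψ (v.1 • b 0 - v.2 • b 1)‖
  have hp2 : (2 : ℝ) ≤ p := by exact_mod_cast (Fact.out : p.Prime).two_le
  push_cast at hle hS
  have hS0 : 0 ≤ S := norm_nonneg _
  have hS' : S ^ 2 = ((p : ℝ) - 1) ^ 2 * p := by
    apply mul_left_cancel₀ (pow_ne_zero 2 (by linarith : (p : ℝ) ≠ 0))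
    linear_combination hS
  have hpos : (0 : ℝ) ≤ p * p - 1 := by nlinarith
  have hsq := pow_le_pow_left₀ hpos hle 2
  have h4 : ((p : ℝ) - 1) ^ 2 * (p - 1) ^ 2 ≤ 0 := by
    have : (p * p - 1 : ℝ) ^ 2 - (2 * S) ^ 2 = ((p : ℝ) - 1) ^ 2 * (p - 1) ^ 2 := by
      linear_combination -4 * hS'
    linarith
  have : (0 : ℝ) < ((p : ℝ) - 1) ^ 2 * (p - 1) ^ 2 := by
    have : (0 : ℝ) < (p : ℝ) - 1 := by linarith
    positivity
  linarith

theorem IsTwist.locallyRep {m : ℤ} (hm : m ≠ 0) {c G : Fin 4 → ℤ} {p₁ p₂ q₁ q₂ : ℤ}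
    (h : IsTwist m c G p₁ p₂ q₁ q₂) (hprim : IsPrimitiveForm c)
    (hirr : Irreducible (formPoly ℚ c)) (h3 : Irreducible (formPolyX (ZMod 3) c))
    (h2 : ¬ SplitsCompletelyMod 2 c)
    (hdvd : ∀ (p : ℕ) [Fact p.Prime], (p : ℤ) ∣ m → ∃ a b : Fin 3 → ZMod p,
      SplitsInto c a b ∧ ∃ i, a i * p₁ + b i * p₂ = 0)
    (hbig : ∀ p : ℕ, p.Prime → ¬ (p : ℤ) ∣ m → p % 3 = 1 → 13 ≤ p ∧
      ¬ ∃ (c₀ l₁ l₂ : ZMod p), formPoly (ZMod p) c = MvPolynomial.C c₀ *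
        (MvPolynomial.C l₁ * MvPolynomial.X 0 + MvPolynomial.C l₂ * MvPolynomial.X 1) ^ 3) :
    LocallyRep G 1 := by
  constructor
  · have h0 := leading_ne_zero_of_irreducible (h.irreducible hm hirr)
    obtain ⟨x, y, hxy⟩ := exists_real_binEval_eq_one (G := G) (by exact_mod_cast h0)
    exact ⟨x, y, by simpa using hxy⟩
  intro p hp
  have : Fact p.Prime := ⟨hp⟩
  simp only [Int.cast_one]
  by_cases hpm : (p : ℤ) ∣ m
  · obtain ⟨a, b, hs, i, hi⟩ := hdvd p hpm
    exact h.padic_of_dvd hpm (h.coeff1_ne_zero hs hi)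
  have hmp : (m : ZMod p) ≠ 0 := by rwa [Ne, ZMod.intCast_zmod_eq_zero_iff_dvd]
  have hX : ∃ X Y : ℤ_[p], binEval (fun i => (c i : ℤ_[p])) X Y = m := by
    by_cases hp3 : p = 3
    · subst hp3
      exact exists_padicInt_three h3 hmp
    refine exists_padicInt_of_zmod hp3 hmp ?_
    have h30 : p % 3 ≠ 0 := fun h0 =>
      hp3 ((Nat.prime_dvd_prime_iff_eq Nat.prime_three hp).1 (Nat.dvd_of_mod_eq_zero h0)).symm
    by_cases hp31 : p % 3 = 1
    · obtain ⟨hp13, hc⟩ := hbig p hp hpm hp31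
      by_cases hr : ∀ x y : ZMod p, binEval (fun i => (c i : ZMod p)) x y = 0 → x = 0 ∧ y = 0
      · exact exists_binEval_eq_of_no_root hp31 hr hmp
      · push Not at hr
        obtain ⟨x₀, y₀, hr, h0⟩ := hr
        exact exists_binEval_eq_of_root hp31 hp13 hc (by tauto) hr hmp
    · refine exists_binEval_eq_of_mod_three_eq_two (by omega) ?_ _
      by_cases hp2 : p = 2
      · subst hp2
        exact exists_binEval_ne_zero_mod_two hprim h2
      · exact exists_binEval_ne_zero_of_primitive hp2 hprim
  obtain ⟨X, Y, hXY⟩ := hX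
  exact h.padic_of_not_dvd hpm hXY

theorem infinite_setOf_prime_gt_three : {r : ℕ | r.Prime ∧ 3 < r}.Infinite := by
  refine Set.infinite_of_forall_exists_gt fun n => ?_
  obtain ⟨p, hp, hpp⟩ := Nat.exists_infinite_primes (n + 4)
  exact ⟨p, ⟨hpp, by omega⟩, by omega⟩

theorem add_four_le_nth_prime_gt_three (i : ℕ) :
    i + 4 ≤ Nat.nth (fun r => Nat.Prime r ∧ 3 < r) i := by
  induction i with
  | zero => exact (Nat.nth_mem_of_infinite infinite_setOf_prime_gt_three 0).2
  | succ i ih =>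
    have := Nat.nth_strictMono infinite_setOf_prime_gt_three (Nat.lt_succ_self i)
    simp only [Nat.succ_eq_add_one] at this
    omega

theorem exists_separating_digits (k : ℕ) :
    ∃ J : Fin (3 ^ k) → ℕ → Fin 3, ∀ s t, s ≠ t → ∃ i < k, J s i ≠ J t i := by
  refine ⟨fun s i => if h : i < k then finFunctionFinEquiv.symm s ⟨i, h⟩ else 0, ?_⟩
  intro s t hst
  obtain ⟨i, hi⟩ := Function.ne_iff.1 (finFunctionFinEquiv.symm.injective.ne hst)
  exact ⟨i, i.2, by simpa using hi⟩

/-- A family of twists of a form `c` which splits modulo the distinct primes `pr i`, `i < k`, one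
for each choice `J` of a root modulo every `pr i`. -/
theorem exists_twist_family {k : ℕ} {pr : ℕ → ℕ} (hpr : ∀ i < k, (pr i).Prime)
    (hinj : ∀ i < k, ∀ j < k, i ≠ j → pr i ≠ pr j) {c : Fin 4 → ℤ}
    {a b : ∀ i, Fin 3 → ZMod (pr i)}
    (hab : ∀ i (hi : i < k), letI := Fact.mk (hpr i hi); SplitsInto c (a i) (b i)) {m : ℤ}
    (hm : m = ∏ i ∈ range k, (pr i : ℤ)) (J : ℕ → Fin 3) :
    ∃ (G : Fin 4 → ℤ) (p₁ p₂ q₁ q₂ : ℤ), IsTwist m c G p₁ p₂ q₁ q₂ ∧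
      ∀ i < k, a i (J i) * p₁ + b i (J i) * p₂ = 0 := by
  obtain ⟨p₁, p₂, q₁, q₂, hdet, hP⟩ := exists_unimodular_of_forms hpr hinj
    (fun i => a i (J i)) (fun i => b i (J i)) (fun i hi => by
      have := Fact.mk (hpr i hi)
      exact (hab i hi).not_both_zero _)
  obtain ⟨G, hG⟩ := exists_isTwist (m := m) (c := c) hdet (by
    rw [hm]
    refine Finset.prod_dvd_of_coprime ?_ ?_
    · intro i hi j hj hij
      rw [Function.onFun, Nat.isCoprime_iff_coprime]
      exact (Nat.coprime_primes (hpr i (by simpa using hi)) (hpr j (by simpa using hj))).2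
        (hinj i (by simpa using hi) j (by simpa using hj) hij)
    · intro i hi
      have hi := mem_range.1 hi
      have := Fact.mk (hpr i hi)
      rw [← ZMod.intCast_zmod_eq_zero_iff_dvd, ← binEval_intCast, (hab i hi).eval]
      exact prod_eq_zero (mem_univ (J i)) (hP i hi))
  exact ⟨G, p₁, p₂, q₁, q₂, hG, hP⟩

/-- the cubic construction (Theorem 4.1 of the paper). From a suitable binary
cubic form `F` one obtains `3^k` pairwise inequivalent irreducible maximal binary cubic
forms `Gⱼ` of discriminant `disc(F) m²`, at least `3^k - 34` of which locally represent `1`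
everywhere, do not represent `1` globally, and are maximal. -/
theorem cubic_construction
    (k : ℕ) (hk : 4 ≤ k)
    (m : ℕ) (hm : m = ∏ i ∈ Finset.range k, Nat.nth (fun r => Nat.Prime r ∧ 3 < r) i)
    (c : Fin 4 → ℤ)
    (hmax : IsMaximalForm c) (hprim : IsPrimitiveForm c)
    (hirr : Irreducible (formPoly ℚ c))
    (hgal : Nonempty ((formPolyX ℚ c).Gal ≃* Equiv.Perm (Fin 3)))
    (D : ℤ) (hD : IsDisc c D)
    (hdisc : (m : ℝ) ^ 20 * (3.5 : ℝ) ^ 30 * 3 ^ 15 < (|D| : ℝ))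
    (h3 : Irreducible (formPolyX (ZMod 3) c))
    (h2 : ¬ SplitsCompletelyMod 2 c)
    (hsplit : ∀ i, i < k → SplitsCompletelyMod (Nat.nth (fun r => Nat.Prime r ∧ 3 < r) i) c)
    (hbig : ∀ q : ℕ, q.Prime → Nat.nth (fun r => Nat.Prime r ∧ 3 < r) (k - 1) < q →
      q % 3 = 1 →
      ¬ ∃ (c₀ l₁ l₂ : ZMod q), formPoly (ZMod q) c =
        MvPolynomial.C c₀ *
          (MvPolynomial.C l₁ * MvPolynomial.X 0 +
            MvPolynomial.C l₂ * MvPolynomial.X 1) ^ 3) :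
    ∃ G : Fin (3 ^ k) → (Fin 4 → ℤ),
      (∀ j₁ j₂, j₁ ≠ j₂ → ¬ FormEquiv (G j₁) (G j₂)) ∧
      (∀ j, Irreducible (formPoly ℚ (G j)) ∧ IsMaximalForm (G j) ∧
        IsDisc (G j) (D * (m : ℤ) ^ 2)) ∧
      ∃ T : Finset (Fin (3 ^ k)), 3 ^ k - 34 ≤ T.card ∧
        ∀ j ∈ T, LocallyRep (G j) 1 ∧ (¬ ∃ x y : ℤ, binEval (G j) x y = 1) ∧
          IsMaximalForm (G j) := by
  set pr : ℕ → ℕ := Nat.nth (fun r => Nat.Prime r ∧ 3 < r) with hprd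
  have hprP : ∀ i, (pr i).Prime ∧ 3 < pr i := Nat.nth_mem_of_infinite infinite_setOf_prime_gt_three
  have hmono : StrictMono pr := Nat.nth_strictMono infinite_setOf_prime_gt_three
  have hpr : ∀ i < k, (pr i).Prime := fun i _ => (hprP i).1
  have hfact : ∀ i, Fact (pr i).Prime := fun i => ⟨(hprP i).1⟩
  have hinj : ∀ i < k, ∀ j < k, i ≠ j → pr i ≠ pr j := fun i _ j _ hij => hmono.injective.ne hij
  have hex : ∀ i, ∃ a b : Fin 3 → ZMod (pr i), i < k → SplitsInto c a b := by
    intro i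
    by_cases hi : i < k
    · obtain ⟨a, b, h⟩ := (hsplit i hi).exists_splitsInto (by have := (hprP i).2; omega)
      exact ⟨a, b, fun _ => h⟩
    · exact ⟨0, 0, fun h => absurd h hi⟩
  choose a b hab using hex
  have hmZ : (m : ℤ) = ∏ i ∈ range k, (pr i : ℤ) := by rw [hm]; push_cast; rfl
  have hm0 : m ≠ 0 := by
    rw [hm]
    exact prod_ne_zero_iff.2 fun i _ => (hprP i).1.ne_zero
  have hmZ0 : (m : ℤ) ≠ 0 := by exact_mod_cast hm0
  have hdvd_m : ∀ i < k, (pr i : ℤ) ∣ m := fun i hi => by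
    rw [hmZ]
    exact dvd_prod_of_mem _ (mem_range.2 hi)
  have hprime_dvd : ∀ q : ℕ, q.Prime → (q : ℤ) ∣ m → ∃ i < k, pr i = q := by
    intro q hq hqm
    rw [Int.natCast_dvd_natCast, hm] at hqm
    obtain ⟨i, hi, hqi⟩ := hq.prime.exists_mem_finset_dvd hqm
    exact ⟨i, mem_range.1 hi, ((Nat.prime_dvd_prime_iff_eq hq (hprP i).1).1 hqi).symm⟩
  have hsq : Squarefree (m : ℤ) := by
    rw [hmZ]
    refine Finset.squarefree_prod_of_pairwise_isCoprime ?_ fun i _ =>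
      (Nat.prime_iff_prime_int.1 (hprP i).1).squarefree
    intro i _ j _ hij
    refine IsCoprime.isRelPrime ?_
    rw [Nat.isCoprime_iff_coprime]
    exact (Nat.coprime_primes (hprP i).1 (hprP j).1).2 (hmono.injective.ne hij)
  have hmD : ∀ q : ℕ, q.Prime → (q : ℤ) ∣ m → ¬ (q : ℤ) ∣ D := by
    intro q hq hqm
    obtain ⟨i, hi, rfl⟩ := hprime_dvd q hq hqm
    rw [← ZMod.intCast_zmod_eq_zero_iff_dvd, hD.eq_cubicDisc]
    exact (hab i hi).disc_ne_zero
  obtain ⟨J, hJ⟩ := exists_separating_digits k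
  choose G p₁ p₂ q₁ q₂ hG hP using fun s => exists_twist_family hpr hinj (c := c) hab hmZ (J s)
  have hroot : ∀ s, ∀ i < k, ∀ x y r₁ r₂ : ℤ, r₁ = p₁ s * x + m * q₁ s * y →
      r₂ = p₂ s * x + m * q₂ s * y →
      a i (J s i) * (r₁ : ZMod (pr i)) + b i (J s i) * (r₂ : ZMod (pr i)) = 0 := by
    intro s i hi x y r₁ r₂ h₁ h₂
    have hmi : ((m : ℤ) : ZMod (pr i)) = 0 :=
      (ZMod.intCast_zmod_eq_zero_iff_dvd _ _).2 (hdvd_m i hi)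
    rw [h₁, h₂]
    push_cast at hmi ⊢
    rw [hmi]
    linear_combination (x : ZMod (pr i)) * hP s i hi
  refine ⟨G, ?_, fun s => ⟨(hG s).irreducible hmZ0 hirr, (hG s).isMaximalForm hmZ0 hsq hmax hD hmD,
    (hG s).isDisc hmZ0 hD⟩, ?_⟩
  · intro s t hst hequiv
    obtain ⟨i, hi, hJi⟩ := hJ s t hst
    obtain ⟨x, y, h₁, h₂⟩ := (hG s).mem_range_of_formEquiv hmZ0 (hG t) hirr hgal hequiv
    obtain ⟨e₁, e₂⟩ := (hab i hi).eq_zero_of_two hJi (hroot s i hi x y _ _ h₁ h₂) (hP t i hi)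
    have hdet := congrArg (Int.cast : ℤ → ZMod (pr i)) (hG t).det
    push_cast at hdet
    rw [e₁, e₂] at hdet
    simp at hdet
  classical
  set B : Finset (Fin (3 ^ k)) := univ.filter fun s => ∃ x y : ℤ, binEval (G s) x y = 1 with hB
  have hBex : ∀ s, ∃ v : ℤ × ℤ, s ∈ B → binEval (G s) v.1 v.2 = 1 := by
    intro s
    by_cases hs : s ∈ B
    · obtain ⟨x, y, hxy⟩ := (mem_filter.1 hs).2
      exact ⟨(x, y), fun _ => hxy⟩
    · exact ⟨0, fun h => absurd h hs⟩
  choose v hv using hBex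
  set w : Fin (3 ^ k) → ℤ × ℤ := fun s => (p₁ s * (v s).1 + m * q₁ s * (v s).2,
    p₂ s * (v s).1 + m * q₂ s * (v s).2) with hw
  have hwm : ∀ s ∈ B, binEval c (w s).1 (w s).2 = m := by
    intro s hs
    rw [← (hG s).eval_int, hv s hs, mul_one]
  have hwinj : Set.InjOn w B := by
    intro s hs t ht hst
    by_contra hne
    obtain ⟨i, hi, hJi⟩ := hJ s t hne
    have hs' := hroot s i hi (v s).1 (v s).2 (w s).1 (w s).2 rfl rfl
    have ht' := hroot t i hi (v t).1 (v t).2 (w t).1 (w t).2 rfl rfl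
    rw [← hst] at ht'
    obtain ⟨e₁, e₂⟩ := (hab i hi).eq_zero_of_two hJi hs' ht'
    rw [ZMod.intCast_zmod_eq_zero_iff_dvd] at e₁ e₂
    obtain ⟨x, hx⟩ := e₁
    obtain ⟨y, hy⟩ := e₂
    have hval := hwm s hs
    rw [binEval_cubic, hx, hy] at hval
    have hunit := hsq (pr i : ℤ) ⟨pr i * binEval c x y, by
      rw [← hval, binEval_cubic]
      ring⟩
    exact (Nat.prime_iff_prime_int.1 (hprP i).1).not_isUnit hunit
  have hBcard : B.card ≤ 33 := by
    rw [← card_image_of_injOn hwinj]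
    refine card_solutions_le D hD m (Nat.one_le_iff_ne_zero.2 hm0) hdisc _ fun u hu => ?_
    obtain ⟨s, hs, rfl⟩ := mem_image.1 hu
    exact hwm s hs
  refine ⟨Bᶜ, ?_, fun s hs => ⟨(hG s).locallyRep hmZ0 hprim hirr h3 h2 ?_ ?_, by
    simpa [hB] using hs, (hG s).isMaximalForm hmZ0 hsq hmax hD hmD⟩⟩
  · rw [card_compl, Fintype.card_fin]
    omega
  · intro p hp hpm
    obtain ⟨i, hi, rfl⟩ := hprime_dvd p hp.out hpm
    exact ⟨a i, b i, hab i hi, J s i, hP s i hi⟩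
  · intro p hp hpm hp31
    have hp3 : 3 < p := by
      have := hp.two_le
      by_contra! hle
      interval_cases p <;> omega
    obtain ⟨i, hi⟩ : ∃ i, pr i = p := Nat.exists_lt_card_nth_eq ⟨hp, hp3⟩ |>.imp fun _ h => h.2
    have hik : k ≤ i := by
      by_contra! hik
      exact hpm (hi ▸ hdvd_m i hik)
    have hlt : pr (k - 1) < p := hi ▸ hmono (by omega)
    refine ⟨?_, hbig p hp hlt hp31⟩
    have h7 : k - 1 + 4 ≤ pr (k - 1) := add_four_le_nth_prime_gt_three (k - 1)
    by_contra! h13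
    have : p = 10 := by omega
    subst this
    norm_num at hp
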